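/- If G is C², then there exist δ₀ > 0 and a constant C > 0 such that for all 0 < δ ≤ δ₀ there exists a C² map φ_δ : ℝ/Lℝ → ℝⁿ satisfying: (i) ⟨φ_δ(θ), q'(θ)⟩ = 0 for all θ; (ii) sup_{θ ∈ ℝ/Lℝ} max{‖φ_δ(θ)‖, ‖φ'_δ(θ)‖, ‖φ''_δ(θ)‖} ≤ Cδ; and (iii) the set M^δ := {q(θ) + φ_δ(θ) : θ ∈ ℝ/Lℝ} is invariant under the perturbed flow dX_t = (−∇V[X_t] + δG[X_t])dt, and is a stable normally hyperbolic manifold for this flow (its generalized Lyapunov-type numbers satisfy ν̄(M^δ) < 1 and σ̄(M^δ) < 1). -/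

import Mathlib

noncomputable section

open MeasureTheory Set Filter RealInnerProductSpace

/-- The Hessian of `V` at `X`, as a continuous linear map. -/
def hessLM {n : ℕ} (V : EuclideanSpace ℝ (Fin n) → ℝ) (X : EuclideanSpace ℝ (Fin n)) :
    EuclideanSpace ℝ (Fin n) →L[ℝ] EuclideanSpace ℝ (Fin n) :=
  fderiv ℝ (gradient V) X

/-- The perturbed invariant curve `M^δ = {q θ + φ_δ θ}`. -/
def Mset {n : ℕ} (q : ℝ → EuclideanSpace ℝ (Fin n)) (Φ : ℝ → ℝ → EuclideanSpace ℝ (Fin n))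
    (δ : ℝ) : Set (EuclideanSpace ℝ (Fin n)) :=
  Set.range fun θ => q θ + Φ δ θ

/-- Invariance of a set under the flow `dX = (-∇V[X] + δ G[X]) dt`. -/
def flowInvariant {n : ℕ} (V : EuclideanSpace ℝ (Fin n) → ℝ)
    (G : EuclideanSpace ℝ (Fin n) → EuclideanSpace ℝ (Fin n)) (δ : ℝ)
    (S : Set (EuclideanSpace ℝ (Fin n))) : Prop :=
  ∀ Y : ℝ → EuclideanSpace ℝ (Fin n),
    (∀ t, HasDerivAt Y (-(gradient V (Y t)) + δ • G (Y t)) t) → Y 0 ∈ S → ∀ t, Y t ∈ S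

/-- Costs of finite-time absolutely continuous paths from `P₁` to `P₂` for the
rate function `I_{δ,T}`. -/
def rateSet {n : ℕ} (V : EuclideanSpace ℝ (Fin n) → ℝ)
    (G : EuclideanSpace ℝ (Fin n) → EuclideanSpace ℝ (Fin n)) (δ : ℝ)
    (P₁ P₂ : EuclideanSpace ℝ (Fin n)) : Set ℝ :=
  {c | ∃ T : ℝ, T < 0 ∧ ∃ Y g : ℝ → EuclideanSpace ℝ (Fin n),
      IntervalIntegrable g volume T 0 ∧
      (∀ t ∈ Icc T (0:ℝ), Y t = Y T + ∫ s in T..t, g s) ∧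
      Y T = P₁ ∧ Y 0 = P₂ ∧
      c = (1/2) * ∫ t in T..(0:ℝ), ‖g t + gradient V (Y t) - δ • G (Y t)‖^2}

/-- The quasipotential `W_δ(P₁, P₂)`. -/
def quasipotential {n : ℕ} (V : EuclideanSpace ℝ (Fin n) → ℝ)
    (G : EuclideanSpace ℝ (Fin n) → EuclideanSpace ℝ (Fin n)) (δ : ℝ)
    (P₁ P₂ : EuclideanSpace ℝ (Fin n)) : ℝ :=
  sInf (rateSet V G δ P₁ P₂)

/-- Costs of absolutely continuous paths on `ℝ/L_δℝ` (written through `L_δ`-periodic lifts)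
from `φ₁` to `φ₂` for the reduced rate function. -/
def redRateSet (bδ : ℝ → ℝ) (Lδ φ₁ φ₂ : ℝ) : Set ℝ :=
  {c | ∃ T : ℝ, T < 0 ∧ ∃ f g : ℝ → ℝ,
      IntervalIntegrable g volume T 0 ∧
      (∀ t ∈ Icc T (0:ℝ), f t = f T + ∫ s in T..t, g s) ∧
      (∃ k : ℤ, f T = φ₁ + k * Lδ) ∧ (∃ k : ℤ, f 0 = φ₂ + k * Lδ) ∧
      c = (1/2) * ∫ t in T..(0:ℝ), |g t - bδ (f t)|^2}

/-- The reduced quasipotential `W^red_δ(φ₁, φ₂)`. -/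
def redQuasipotential (bδ : ℝ → ℝ) (Lδ φ₁ φ₂ : ℝ) : ℝ :=
  sInf (redRateSet bδ Lδ φ₁ φ₂)

/-- The reduced drift `b_δ(φ) = ⟨-∇V[q_δ(φ)] + δ G[q_δ(φ)], q_δ'(φ)⟩`. -/
def reducedDrift {n : ℕ} (V : EuclideanSpace ℝ (Fin n) → ℝ)
    (G : EuclideanSpace ℝ (Fin n) → EuclideanSpace ℝ (Fin n))
    (Qd : ℝ → EuclideanSpace ℝ (Fin n)) (δ φ : ℝ) : ℝ :=
  ⟪-(gradient V (Qd φ)) + δ • G (Qd φ), deriv Qd φ⟫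

/-- The tube `U^δ` around `M^δ`. -/
def tubeU {n : ℕ} (q : ℝ → EuclideanSpace ℝ (Fin n)) (Φ : ℝ → ℝ → EuclideanSpace ℝ (Fin n))
    (Pd : ℝ → EuclideanSpace ℝ (Fin n) → ℝ) (phiA : ℝ → ℝ) (C₀ Δ₁ Δ₂ δ : ℝ) :
    Set (EuclideanSpace ℝ (Fin n)) :=
  {Z | Metric.infDist Z (Mset q Φ δ) ≤ C₀ * Real.sqrt δ ∧
       Pd δ Z ∈ Icc (phiA δ - Δ₁) (phiA δ + Δ₂)}

/-- Costs of infinite-time paths from `A` (at `-∞`) to `B` (at time `0`). -/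
def infRateSet {n : ℕ} (V : EuclideanSpace ℝ (Fin n) → ℝ)
    (G : EuclideanSpace ℝ (Fin n) → EuclideanSpace ℝ (Fin n)) (δ : ℝ)
    (A B : EuclideanSpace ℝ (Fin n)) : Set ℝ :=
  {c | ∃ Y g : ℝ → EuclideanSpace ℝ (Fin n),
      ContinuousOn Y (Iic 0) ∧ Tendsto Y atBot (nhds A) ∧ Y 0 = B ∧
      (∀ T < (0:ℝ), IntervalIntegrable g volume T 0) ∧
      (∀ t ≤ (0:ℝ), Y 0 = Y t + ∫ s in t..(0:ℝ), g s) ∧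
      c = (1/2) * ∫ t in Iic (0:ℝ), ‖g t + gradient V (Y t) - δ • G (Y t)‖^2}

/-- `Y` is an optimal path from `A` (at `-∞`) to `B` (at time `0`): it is continuous,
absolutely continuous with derivative `g`, and its infinite-time cost realizes the
quasipotential `W_δ(A, B)`. -/
def IsOptimalPath {n : ℕ} (V : EuclideanSpace ℝ (Fin n) → ℝ)
    (G : EuclideanSpace ℝ (Fin n) → EuclideanSpace ℝ (Fin n)) (δ : ℝ)
    (A B : EuclideanSpace ℝ (Fin n)) (Y : ℝ → EuclideanSpace ℝ (Fin n)) : Prop :=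
  ContinuousOn Y (Iic 0) ∧ Tendsto Y atBot (nhds A) ∧ Y 0 = B ∧
  ∃ g : ℝ → EuclideanSpace ℝ (Fin n),
    (∀ T < (0:ℝ), IntervalIntegrable g volume T 0) ∧
    (∀ t ≤ (0:ℝ), Y 0 = Y t + ∫ s in t..(0:ℝ), g s) ∧
    (1/2) * (∫ t in Iic (0:ℝ), ‖g t + gradient V (Y t) - δ • G (Y t)‖^2) =
      quasipotential V G δ A B

/-- Orthogonal projection onto the line spanned by `τ`. -/
def projTan {n : ℕ} (τ x : EuclideanSpace ℝ (Fin n)) : EuclideanSpace ℝ (Fin n) :=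
  (⟪τ, x⟫ / ‖τ‖ ^ 2) • τ

/-- Projection onto the orthogonal complement of the line spanned by `τ`. -/
def projNor {n : ℕ} (τ x : EuclideanSpace ℝ (Fin n)) : EuclideanSpace ℝ (Fin n) :=
  x - projTan τ x

section SlowFast

set_option maxSynthPendingDepth 3

variable {E F : Type*} [NormedAddCommGroup E] [NormedSpace ℝ E]
  [NormedAddCommGroup F] [NormedSpace ℝ F]

/-- The curve `θ ↦ (δ, θ, k θ)`. -/
def graphLift (δ : ℝ) (k : ℝ → E) (θ : ℝ) : ℝ × ℝ × E := (δ, θ, k θ)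

/-- First derivative of `f` along a graph whose slope is `p`. -/
def alongDeriv (f : ℝ × ℝ × E → F) (δ : ℝ) (k p : ℝ → E) (θ : ℝ) : F :=
  fderiv ℝ f (graphLift δ k θ) (0, 1, p θ)

/-- Second derivative of `f` along a graph with slope `p` and second derivative `r`. -/
def alongDeriv₂ (f : ℝ × ℝ × E → F) (δ : ℝ) (k p r : ℝ → E) (θ : ℝ) : F :=
  fderiv ℝ (fderiv ℝ f) (graphLift δ k θ) (0, 1, p θ) (0, 1, p θ)
    + fderiv ℝ f (graphLift δ k θ) (0, 0, r θ)

theorem hasDerivAt_graphLift {δ : ℝ} {k : ℝ → E} {p : E} {θ : ℝ} (hk : HasDerivAt k p θ) :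
    HasDerivAt (graphLift δ k) (0, 1, p) θ :=
  (hasDerivAt_const θ δ).prodMk ((hasDerivAt_id θ).prodMk hk)

theorem hasDerivAt_comp_graphLift {f : ℝ × ℝ × E → F} (hf : ContDiff ℝ 2 f) {δ : ℝ}
    {k p : ℝ → E} {θ : ℝ} (hk : HasDerivAt k (p θ) θ) :
    HasDerivAt (fun x => f (graphLift δ k x)) (alongDeriv f δ k p θ) θ :=
  ((hf.differentiable (by norm_num)) _).hasFDerivAt.comp_hasDerivAt θ (hasDerivAt_graphLift hk)

theorem hasDerivAt_alongDeriv {f : ℝ × ℝ × E → F} (hf : ContDiff ℝ 2 f) {δ : ℝ}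
    {k p r : ℝ → E} {θ : ℝ} (hk : HasDerivAt k (p θ) θ) (hp : HasDerivAt p (r θ) θ) :
    HasDerivAt (alongDeriv f δ k p) (alongDeriv₂ f δ k p r θ) θ := by
  have h1 : ContDiff ℝ 1 (fderiv ℝ f) := hf.fderiv_right (by norm_num)
  have h2 := ((h1.differentiable (by norm_num)) (graphLift δ k θ)).hasFDerivAt.comp_hasDerivAt θ
    (hasDerivAt_graphLift hk)
  have h3 : HasDerivAt (fun x => ((0, 1, p x) : ℝ × ℝ × E)) (0, 0, r θ) θ :=
    (hasDerivAt_const θ (0 : ℝ)).prodMk ((hasDerivAt_const θ (1 : ℝ)).prodMk hp)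
  exact h2.clm_apply h3

/-- The tube of parameters `(δ, θ, z)` with `δ ∈ [0, 1]` and `‖z‖ ≤ ρ`. -/
def slowTube (E : Type*) [NormedAddCommGroup E] (ρ : ℝ) : Set (ℝ × ℝ × E) :=
  {w | w.1 ∈ Icc (0 : ℝ) 1 ∧ ‖w.2.2‖ ≤ ρ}

/-- `f` is `C²`, with `B` a bound on the tube for `f` and its two derivatives, and with
`m ε` the slope of an affine modulus of continuity of the second derivative with offset `ε`. -/
structure TubeBound (f : ℝ × ℝ × E → F) (ρ B : ℝ) (m : ℝ → ℝ) : Prop where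
  contDiff : ContDiff ℝ 2 f
  norm_le : ∀ w ∈ slowTube E ρ, ‖f w‖ ≤ B
  fderiv_le : ∀ w ∈ slowTube E ρ, ‖fderiv ℝ f w‖ ≤ B
  fderiv₂_le : ∀ w ∈ slowTube E ρ, ‖fderiv ℝ (fderiv ℝ f) w‖ ≤ B
  modulus : ∀ ε > 0, ∀ w ∈ slowTube E ρ, ∀ w' ∈ slowTube E ρ,
    ‖fderiv ℝ (fderiv ℝ f) w - fderiv ℝ (fderiv ℝ f) w'‖ ≤ ε + m ε * ‖w - w'‖

theorem convex_slowTube (ρ : ℝ) : Convex ℝ (slowTube E ρ) := by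
  have : slowTube E ρ = Icc (0 : ℝ) 1 ×ˢ ((univ : Set ℝ) ×ˢ Metric.closedBall (0 : E) ρ) := by
    ext w; simp [slowTube]
  rw [this]
  exact (convex_Icc 0 1).prod (convex_univ.prod (convex_closedBall 0 ρ))

theorem TubeBound.fderiv_lipschitz {f : ℝ × ℝ × E → F} {ρ B : ℝ} {m : ℝ → ℝ}
    (h : TubeBound f ρ B m) {w w' : ℝ × ℝ × E} (hw : w ∈ slowTube E ρ) (hw' : w' ∈ slowTube E ρ) :
    ‖fderiv ℝ f w - fderiv ℝ f w'‖ ≤ B * ‖w - w'‖ := by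
  have h1 : ContDiff ℝ 1 (fderiv ℝ f) := h.contDiff.fderiv_right (by norm_num)
  exact (convex_slowTube ρ).norm_image_sub_le_of_norm_fderiv_le
    (fun x _ => (h1.differentiable (by norm_num)) x) (fun x hx => h.fderiv₂_le x hx) hw' hw

theorem TubeBound.lipschitz {f : ℝ × ℝ × E → F} {ρ B : ℝ} {m : ℝ → ℝ}
    (h : TubeBound f ρ B m) {w w' : ℝ × ℝ × E} (hw : w ∈ slowTube E ρ) (hw' : w' ∈ slowTube E ρ) :
    ‖f w - f w'‖ ≤ B * ‖w - w'‖ :=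
  (convex_slowTube ρ).norm_image_sub_le_of_norm_fderiv_le
    (fun x _ => (h.contDiff.differentiable (by norm_num)) x) (fun x hx => h.fderiv_le x hx) hw' hw

theorem TubeBound.mono {f : ℝ × ℝ × E → F} {ρ B B' : ℝ} {m m' : ℝ → ℝ} (h : TubeBound f ρ B m)
    (hB : B ≤ B') (hm : ∀ ε, m ε ≤ m' ε) : TubeBound f ρ B' m' :=
  ⟨h.contDiff, fun w hw => (h.norm_le w hw).trans hB, fun w hw => (h.fderiv_le w hw).trans hB,
    fun w hw => (h.fderiv₂_le w hw).trans hB, fun ε hε w hw w' hw' =>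
      (h.modulus ε hε w hw w' hw').trans (by gcongr; exact hm ε)⟩

/-- `k` is an `L`-periodic `C²` function with derivatives `p`, `r`, bounded by `ρ`, `C₁`, `C₂`, and
`m ε` is the slope of an affine modulus of continuity of `r` with offset `ε`. -/
structure JetBound (L ρ C₁ C₂ : ℝ) (m : ℝ → ℝ) (k p r : ℝ → E) : Prop where
  deriv : ∀ θ, HasDerivAt k (p θ) θ
  deriv₂ : ∀ θ, HasDerivAt p (r θ) θ
  periodic : ∀ θ, k (θ + L) = k θ
  norm_le : ∀ θ, ‖k θ‖ ≤ ρ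
  deriv_le : ∀ θ, ‖p θ‖ ≤ C₁
  deriv₂_le : ∀ θ, ‖r θ‖ ≤ C₂
  modulus : ∀ ε > 0, ∀ x y, ‖r x - r y‖ ≤ ε + m ε * |x - y|

variable {L ρ C₁ C₂ B δ : ℝ} {m m' : ℝ → ℝ} {k p r : ℝ → E} {f : ℝ × ℝ × E → F}

theorem JetBound.lipschitz (h : JetBound L ρ C₁ C₂ m k p r) (x y : ℝ) :
    ‖k x - k y‖ ≤ C₁ * |x - y| :=
  convex_univ.norm_image_sub_le_of_norm_hasDerivWithin_le
    (fun t _ => (h.deriv t).hasDerivWithinAt) (fun t _ => h.deriv_le t) (mem_univ y) (mem_univ x)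

theorem JetBound.deriv_lipschitz (h : JetBound L ρ C₁ C₂ m k p r) (x y : ℝ) :
    ‖p x - p y‖ ≤ C₂ * |x - y| :=
  convex_univ.norm_image_sub_le_of_norm_hasDerivWithin_le
    (fun t _ => (h.deriv₂ t).hasDerivWithinAt) (fun t _ => h.deriv₂_le t) (mem_univ y) (mem_univ x)

theorem JetBound.mem_tube (h : JetBound L ρ C₁ C₂ m k p r) (hδ : δ ∈ Icc (0 : ℝ) 1) (θ : ℝ) :
    graphLift δ k θ ∈ slowTube E ρ := ⟨hδ, h.norm_le θ⟩

theorem JetBound.nonneg (h : JetBound L ρ C₁ C₂ m k p r) : 0 ≤ ρ ∧ 0 ≤ C₁ ∧ 0 ≤ C₂ :=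
  ⟨(norm_nonneg _).trans (h.norm_le 0), (norm_nonneg _).trans (h.deriv_le 0),
    (norm_nonneg _).trans (h.deriv₂_le 0)⟩

theorem JetBound.norm_velocity_le (h : JetBound L ρ C₁ C₂ m k p r) (θ : ℝ) :
    ‖((0, 1, p θ) : ℝ × ℝ × E)‖ ≤ 1 + C₁ := by
  have := h.deriv_le θ
  have := h.nonneg
  simp only [Prod.norm_def]
  simp
  constructor <;> linarith

theorem norm_vertical {V : Type*} [SeminormedAddCommGroup V] (v : V) :
    ‖((0, 0, v) : ℝ × ℝ × V)‖ = ‖v‖ := by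
  simp [Prod.norm_def]

theorem JetBound.graphLift_lipschitz (h : JetBound L ρ C₁ C₂ m k p r) (x y : ℝ) :
    ‖graphLift δ k x - graphLift δ k y‖ ≤ (1 + C₁) * |x - y| := by
  have h1 := h.lipschitz x y
  have h2 := h.nonneg
  have h3 := abs_nonneg (x - y)
  have h4 : 0 ≤ C₁ * |x - y| := mul_nonneg h2.2.1 h3
  simp only [graphLift, Prod.mk_sub_mk, Prod.norm_def, sub_self, norm_zero, Real.norm_eq_abs]
  refine max_le (by nlinarith) (max_le ?_ ?_) <;> linarith

theorem TubeBound.nonneg (hf : TubeBound f ρ B m') (hρ : 0 ≤ ρ) : 0 ≤ B :=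
  (norm_nonneg _).trans (hf.norm_le (0, 0, 0) ⟨by simp, by simpa using hρ⟩)

theorem JetBound.norm_alongDeriv_le (h : JetBound L ρ C₁ C₂ m k p r) (hf : TubeBound f ρ B m')
    (hδ : δ ∈ Icc (0 : ℝ) 1) (θ : ℝ) : ‖alongDeriv f δ k p θ‖ ≤ B * (1 + C₁) :=
  (ContinuousLinearMap.le_opNorm _ _).trans
    (mul_le_mul (hf.fderiv_le _ (h.mem_tube hδ θ)) (h.norm_velocity_le θ) (norm_nonneg _)
      (hf.nonneg h.nonneg.1))

theorem ContinuousLinearMap.norm_apply₂_le {G H K : Type*} [NormedAddCommGroup G] [NormedSpace ℝ G]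
    [NormedAddCommGroup H] [NormedSpace ℝ H] [NormedAddCommGroup K] [NormedSpace ℝ K]
    (T : G →L[ℝ] H →L[ℝ] K) {u : G} {v : H} {a b c : ℝ} (hT : ‖T‖ ≤ a) (hu : ‖u‖ ≤ b)
    (hv : ‖v‖ ≤ c) : ‖T u v‖ ≤ a * b * c := by
  have ha := (norm_nonneg _).trans hT
  have hb := (norm_nonneg _).trans hu
  exact (T.le_opNorm₂ u v).trans (by gcongr)

theorem JetBound.norm_quadratic_le (h : JetBound L ρ C₁ C₂ m k p r) (hf : TubeBound f ρ B m')
    (hδ : δ ∈ Icc (0 : ℝ) 1) (θ : ℝ) :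
    ‖fderiv ℝ (fderiv ℝ f) (graphLift δ k θ) (0, 1, p θ) (0, 1, p θ)‖ ≤ B * (1 + C₁) ^ 2 := by
  have := ContinuousLinearMap.norm_apply₂_le _ (hf.fderiv₂_le _ (h.mem_tube hδ θ))
    (h.norm_velocity_le θ) (h.norm_velocity_le θ)
  linarith

theorem JetBound.norm_alongDeriv₂_le (h : JetBound L ρ C₁ C₂ m k p r) (hf : TubeBound f ρ B m')
    (hδ : δ ∈ Icc (0 : ℝ) 1) (θ : ℝ) :
    ‖alongDeriv₂ f δ k p r θ‖ ≤ B * (1 + C₁) ^ 2 + B * C₂ := by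
  refine (norm_add_le _ _).trans (add_le_add (h.norm_quadratic_le hf hδ θ) ?_)
  refine (ContinuousLinearMap.le_opNorm _ _).trans ?_
  rw [norm_vertical]
  exact mul_le_mul (hf.fderiv_le _ (h.mem_tube hδ θ)) (h.deriv₂_le θ) (norm_nonneg _)
      (hf.nonneg h.nonneg.1)

/-- The variation of the second derivative along a graph, apart from the term carrying the
variation of `r`. -/
theorem JetBound.norm_alongDeriv₂_sub_le (h : JetBound L ρ C₁ C₂ m k p r)
    (hf : TubeBound f ρ B m') (hδ : δ ∈ Icc (0 : ℝ) 1) {ε : ℝ} (hε : 0 < ε) (hm : 0 ≤ m' ε)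
    (x y : ℝ) :
    ‖alongDeriv₂ f δ k p r x - alongDeriv₂ f δ k p r y
        - fderiv ℝ f (graphLift δ k x) (0, 0, r x - r y)‖ ≤
      ε * (1 + C₁) ^ 2 + (m' ε * (1 + C₁) ^ 3 + 3 * B * (1 + C₁) * C₂) * |x - y| := by
  have hB := hf.nonneg h.nonneg.1
  have hC := h.nonneg
  set D := 1 + C₁ with hD
  have hD0 : 0 ≤ D := by linarith [hC.2.1]
  set d := |x - y|
  have hd : 0 ≤ d := abs_nonneg _
  have hx := h.mem_tube hδ x
  have hy := h.mem_tube hδ y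
  have hl : ‖graphLift δ k x - graphLift δ k y‖ ≤ D * d := h.graphLift_lipschitz x y
  have hvx := h.norm_velocity_le x
  have hvy := h.norm_velocity_le y
  have hvd : ‖((0, 0, p x - p y) : ℝ × ℝ × E)‖ ≤ C₂ * d := by
    rw [norm_vertical]; exact h.deriv_lipschitz x y
  have h2 : ‖fderiv ℝ (fderiv ℝ f) (graphLift δ k x) - fderiv ℝ (fderiv ℝ f) (graphLift δ k y)‖
      ≤ ε + m' ε * (D * d) :=
    (hf.modulus ε hε _ hx _ hy).trans (by gcongr)
  have h1 : ‖fderiv ℝ f (graphLift δ k x) - fderiv ℝ f (graphLift δ k y)‖ ≤ B * (D * d) :=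
    (hf.fderiv_lipschitz hx hy).trans (by gcongr)
  have e1 := ContinuousLinearMap.norm_apply₂_le _ h2 hvx hvx
  have e2 := ContinuousLinearMap.norm_apply₂_le _ (hf.fderiv₂_le _ hy) hvd hvx
  have e3 := ContinuousLinearMap.norm_apply₂_le _ (hf.fderiv₂_le _ hy) hvy hvd
  have e4 : ‖(fderiv ℝ f (graphLift δ k x) - fderiv ℝ f (graphLift δ k y)) (0, 0, r y)‖
      ≤ B * (D * d) * C₂ := by
    refine (ContinuousLinearMap.le_opNorm _ _).trans ?_
    rw [norm_vertical]
    exact mul_le_mul h1 (h.deriv₂_le y) (norm_nonneg _) (by positivity)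
  have key : alongDeriv₂ f δ k p r x - alongDeriv₂ f δ k p r y
        - fderiv ℝ f (graphLift δ k x) (0, 0, r x - r y) =
      (fderiv ℝ (fderiv ℝ f) (graphLift δ k x) - fderiv ℝ (fderiv ℝ f) (graphLift δ k y))
        (0, 1, p x) (0, 1, p x)
      + fderiv ℝ (fderiv ℝ f) (graphLift δ k y) (0, 0, p x - p y) (0, 1, p x)
      + fderiv ℝ (fderiv ℝ f) (graphLift δ k y) (0, 1, p y) (0, 0, p x - p y)
      + (fderiv ℝ f (graphLift δ k x) - fderiv ℝ f (graphLift δ k y)) (0, 0, r y) := by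
    have a1 : ((0, 0, p x - p y) : ℝ × ℝ × E) = (0, 1, p x) - (0, 1, p y) := by simp
    have a2 : ((0, 0, r x - r y) : ℝ × ℝ × E) = (0, 0, r x) - (0, 0, r y) := by simp
    simp only [alongDeriv₂, a1, a2, map_sub, sub_apply]
    abel
  rw [key]
  have n1 := norm_add_le
    ((fderiv ℝ (fderiv ℝ f) (graphLift δ k x) - fderiv ℝ (fderiv ℝ f) (graphLift δ k y))
        (0, 1, p x) (0, 1, p x)
      + fderiv ℝ (fderiv ℝ f) (graphLift δ k y) (0, 0, p x - p y) (0, 1, p x)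
      + fderiv ℝ (fderiv ℝ f) (graphLift δ k y) (0, 1, p y) (0, 0, p x - p y))
      ((fderiv ℝ f (graphLift δ k x) - fderiv ℝ f (graphLift δ k y)) (0, 0, r y))
  refine n1.trans ((add_le_add norm_add₃_le le_rfl).trans ?_)
  calc _ ≤ (ε + m' ε * (D * d)) * D * D + B * (C₂ * d) * D + B * D * (C₂ * d)
        + B * (D * d) * C₂ := by gcongr
    _ = _ := by ring

end SlowFast

section GraphStep

set_option maxSynthPendingDepth 3

variable {E : Type*} [NormedAddCommGroup E] [InnerProductSpace ℝ E]

/-- Foot of the discretised characteristic through `(θ, k θ)`. -/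
def footPoint (s : ℝ × ℝ × E → ℝ) (δ τ : ℝ) (k : ℝ → E) (θ : ℝ) : ℝ :=
  θ - τ * (δ * s (graphLift δ k θ))

/-- One explicit Euler step in the fibre direction. -/
def eulerStep (R : ℝ × ℝ × E → E) (δ τ : ℝ) (k : ℝ → E) (y : ℝ) : E :=
  k y + τ • R (graphLift δ k y)

/-- Discretised graph transform. -/
def graphStep (R : ℝ × ℝ × E → E) (s : ℝ × ℝ × E → ℝ) (δ τ : ℝ) (k : ℝ → E) (θ : ℝ) : E :=
  eulerStep R δ τ k (footPoint s δ τ k θ)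

/-- First derivative of `footPoint`. -/
def footPointDeriv (s : ℝ × ℝ × E → ℝ) (δ τ : ℝ) (k p : ℝ → E) (θ : ℝ) : ℝ :=
  1 - τ * (δ * alongDeriv s δ k p θ)

/-- Second derivative of `footPoint`. -/
def footPointDeriv₂ (s : ℝ × ℝ × E → ℝ) (δ τ : ℝ) (k p r : ℝ → E) (θ : ℝ) : ℝ :=
  -(τ * (δ * alongDeriv₂ s δ k p r θ))

/-- First derivative of `eulerStep`. -/
def eulerStepDeriv (R : ℝ × ℝ × E → E) (δ τ : ℝ) (k p : ℝ → E) (y : ℝ) : E :=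
  p y + τ • alongDeriv R δ k p y

/-- Second derivative of `eulerStep`. -/
def eulerStepDeriv₂ (R : ℝ × ℝ × E → E) (δ τ : ℝ) (k p r : ℝ → E) (y : ℝ) : E :=
  r y + τ • alongDeriv₂ R δ k p r y

/-- First derivative of `graphStep`. -/
def graphStepDeriv (R : ℝ × ℝ × E → E) (s : ℝ × ℝ × E → ℝ) (δ τ : ℝ) (k p : ℝ → E) (θ : ℝ) : E :=
  footPointDeriv s δ τ k p θ • eulerStepDeriv R δ τ k p (footPoint s δ τ k θ)

/-- Second derivative of `graphStep`. -/
def graphStepDeriv₂ (R : ℝ × ℝ × E → E) (s : ℝ × ℝ × E → ℝ) (δ τ : ℝ) (k p r : ℝ → E)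
    (θ : ℝ) : E :=
  footPointDeriv s δ τ k p θ ^ 2 • eulerStepDeriv₂ R δ τ k p r (footPoint s δ τ k θ)
    + footPointDeriv₂ s δ τ k p r θ • eulerStepDeriv R δ τ k p (footPoint s δ τ k θ)

/-- Standing hypotheses on the scaled slow-fast field `θ' = δ s`, `z' = R`, together with the
smallness conditions on `δ` and on the time step `τ`. -/
structure StepHyp (R : ℝ × ℝ × E → E) (s : ℝ × ℝ × E → ℝ) (L ρ B μ C₁ C₂ δ τ : ℝ)
    (m' : ℝ → ℝ) : Prop where
  boundR : TubeBound R ρ B m'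
  bounds : TubeBound s ρ B m'
  m'_nonneg : ∀ ε > 0, 0 ≤ m' ε
  perR : ∀ d θ z, R (d, θ + L, z) = R (d, θ, z)
  pers : ∀ d θ z, s (d, θ + L, z) = s (d, θ, z)
  B_nonneg : 0 ≤ B
  μ_pos : 0 < μ
  ρ_nonneg : 0 ≤ ρ
  δ_mem : δ ∈ Icc (0 : ℝ) 1
  τ_pos : 0 < τ
  dissip : ∀ θ z v, ‖z‖ ≤ ρ → ⟪fderiv ℝ R (δ, θ, z) (0, 0, v), v⟫ ≤ -(2 * μ) * ‖v‖ ^ 2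
  zero_le : ∀ θ, ‖R (δ, θ, 0)‖ ≤ μ * ρ
  C₁_eq : μ * C₁ = 4 * B
  C₂_eq : μ * C₂ = 4 * (B * (1 + C₁) ^ 2)
  τμ_le : τ * μ ≤ 1
  τB_le : τ * B ^ 2 ≤ 2 * μ
  τη_le : τ * (δ * (B * (1 + C₁))) ≤ 1
  small₁ : δ * (B * (1 + C₁)) * C₁ ≤ 3 * B
  small₂ : 3 * (δ * (B * (1 + C₁))) * C₂ + δ * (B * (1 + C₁) ^ 2 + B * C₂) * C₁
    ≤ 3 * (B * (1 + C₁) ^ 2)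
  small₃ : 7 * (δ * (B * (1 + C₁))) + δ * C₁ * B ≤ μ / 2
  small₄ : δ * C₁ ≤ 1

/-- The affine modulus of second derivatives preserved by `graphStep`. -/
def stepModulus (B μ C₁ C₂ : ℝ) (m' : ℝ → ℝ) (ε : ℝ) : ℝ :=
  2 / μ * (9 * (m' (μ * ε / (18 * (1 + C₁) ^ 2)) * (1 + C₁) ^ 3 + 3 * B * (1 + C₁) * C₂)
    + 6 * (B * (1 + C₁) ^ 2 + B * C₂) * C₂)

variable {R : ℝ × ℝ × E → E} {s : ℝ × ℝ × E → ℝ} {L ρ B μ C₁ C₂ δ τ : ℝ} {m m' : ℝ → ℝ}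
  {k p r : ℝ → E}

theorem StepHyp.C_nonneg (h : StepHyp R s L ρ B μ C₁ C₂ δ τ m') : 0 ≤ C₁ ∧ 0 ≤ C₂ := by
  have h1 := h.C₁_eq
  have h2 := h.C₂_eq
  have hB := h.B_nonneg
  exact ⟨nonneg_of_mul_nonneg_right (by rw [h1]; positivity) h.μ_pos,
    nonneg_of_mul_nonneg_right (by rw [h2]; positivity) h.μ_pos⟩

theorem norm_add_smul_le_of_dissipative {v w : E} {τ μ B : ℝ} (hτ : 0 < τ) (hτμ : τ * μ ≤ 1)
    (hτB : τ * B ^ 2 ≤ 2 * μ) (hw : ‖w‖ ≤ B * ‖v‖) (hd : ⟪w, v⟫ ≤ -(2 * μ) * ‖v‖ ^ 2) :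
    ‖v + τ • w‖ ≤ (1 - τ * μ) * ‖v‖ := by
  have h1 : 0 ≤ 1 - τ * μ := by linarith
  refine abs_le_of_sq_le_sq' ?_ (by positivity) |>.2
  rw [norm_add_sq_real, norm_smul, inner_smul_right, real_inner_comm, Real.norm_eq_abs,
    abs_of_pos hτ]
  have h2 : ‖w‖ ^ 2 ≤ B ^ 2 * ‖v‖ ^ 2 := by
    rw [← mul_pow]; gcongr
  have h3 : τ * ⟪w, v⟫ ≤ τ * (-(2 * μ) * ‖v‖ ^ 2) := by gcongr
  have h4 : τ ^ 2 * ‖w‖ ^ 2 ≤ τ ^ 2 * (B ^ 2 * ‖v‖ ^ 2) := by gcongr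
  have h5 : τ * (τ * B ^ 2) * ‖v‖ ^ 2 ≤ τ * (2 * μ) * ‖v‖ ^ 2 := by gcongr
  have h6 : 0 ≤ (τ * μ) ^ 2 * ‖v‖ ^ 2 := by positivity
  nlinarith

theorem StepHyp.contract (h : StepHyp R s L ρ B μ C₁ C₂ δ τ m') {θ : ℝ} {z : E} (hz : ‖z‖ ≤ ρ)
    (v : E) : ‖v + τ • fderiv ℝ R (δ, θ, z) (0, 0, v)‖ ≤ (1 - τ * μ) * ‖v‖ := by
  refine norm_add_smul_le_of_dissipative h.τ_pos h.τμ_le h.τB_le ?_ (h.dissip θ z v hz)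
  refine (ContinuousLinearMap.le_opNorm _ _).trans ?_
  rw [norm_vertical]
  exact mul_le_mul_of_nonneg_right (h.boundR.fderiv_le _ ⟨h.δ_mem, hz⟩) (norm_nonneg _)

theorem StepHyp.contract_sub (h : StepHyp R s L ρ B μ C₁ C₂ δ τ m') {θ : ℝ} {z z' : E}
    (hz : ‖z‖ ≤ ρ) (hz' : ‖z'‖ ≤ ρ) :
    ‖(z + τ • R (δ, θ, z)) - (z' + τ • R (δ, θ, z'))‖ ≤ (1 - τ * μ) * ‖z - z'‖ := by
  have hd : ∀ x ∈ Metric.closedBall (0 : E) ρ,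
      HasFDerivWithinAt (fun z => z + τ • R (δ, θ, z))
        (ContinuousLinearMap.id ℝ E + τ • (fderiv ℝ R (δ, θ, x)).comp
          ((ContinuousLinearMap.inr ℝ ℝ (ℝ × E)).comp (ContinuousLinearMap.inr ℝ ℝ E)))
        (Metric.closedBall (0 : E) ρ) x := by
    intro x _
    refine HasFDerivAt.hasFDerivWithinAt ?_
    refine (hasFDerivAt_id x).add (HasFDerivAt.const_smul ?_ τ)
    refine HasFDerivAt.comp x
      ((h.boundR.contDiff.differentiable (by norm_num)) (δ, θ, x)).hasFDerivAt ?_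
    have h1 : HasFDerivAt (fun z : E => ((θ, z) : ℝ × E)) (ContinuousLinearMap.inr ℝ ℝ E) x :=
      hasFDerivAt_prodMk_right θ x
    exact (hasFDerivAt_prodMk_right δ (θ, x)).comp x h1
  refine (convex_closedBall (0 : E) ρ).norm_image_sub_le_of_norm_hasFDerivWithin_le hd ?_
    (by simpa using hz') (by simpa using hz)
  intro x hx
  refine ContinuousLinearMap.opNorm_le_bound _ (by linarith [h.τμ_le]) fun v => ?_
  simpa using h.contract (θ := θ) (z := x) (by simpa using hx) v

theorem StepHyp.hasDerivAt_footPoint (h : StepHyp R s L ρ B μ C₁ C₂ δ τ m')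
    (J : JetBound L ρ C₁ C₂ m k p r) (θ : ℝ) :
    HasDerivAt (footPoint s δ τ k) (footPointDeriv s δ τ k p θ) θ := by
  have := hasDerivAt_comp_graphLift h.bounds.contDiff (δ := δ) (J.deriv θ)
  exact (hasDerivAt_id θ).sub ((this.const_mul δ).const_mul τ)

theorem StepHyp.hasDerivAt_footPointDeriv (h : StepHyp R s L ρ B μ C₁ C₂ δ τ m')
    (J : JetBound L ρ C₁ C₂ m k p r) (θ : ℝ) :
    HasDerivAt (footPointDeriv s δ τ k p) (footPointDeriv₂ s δ τ k p r θ) θ := by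
  have := hasDerivAt_alongDeriv h.bounds.contDiff (δ := δ) (J.deriv θ) (J.deriv₂ θ)
  exact ((this.const_mul δ).const_mul τ).const_sub 1

theorem StepHyp.hasDerivAt_eulerStep (h : StepHyp R s L ρ B μ C₁ C₂ δ τ m')
    (J : JetBound L ρ C₁ C₂ m k p r) (θ : ℝ) :
    HasDerivAt (eulerStep R δ τ k) (eulerStepDeriv R δ τ k p θ) θ :=
  (J.deriv θ).add ((hasDerivAt_comp_graphLift h.boundR.contDiff (δ := δ) (J.deriv θ)).const_smul τ)

theorem StepHyp.hasDerivAt_eulerStepDeriv (h : StepHyp R s L ρ B μ C₁ C₂ δ τ m')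
    (J : JetBound L ρ C₁ C₂ m k p r) (θ : ℝ) :
    HasDerivAt (eulerStepDeriv R δ τ k p) (eulerStepDeriv₂ R δ τ k p r θ) θ :=
  (J.deriv₂ θ).add
    ((hasDerivAt_alongDeriv h.boundR.contDiff (δ := δ) (J.deriv θ) (J.deriv₂ θ)).const_smul τ)

theorem StepHyp.hasDerivAt_graphStep (h : StepHyp R s L ρ B μ C₁ C₂ δ τ m')
    (J : JetBound L ρ C₁ C₂ m k p r) (θ : ℝ) :
    HasDerivAt (graphStep R s δ τ k) (graphStepDeriv R s δ τ k p θ) θ :=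
  (h.hasDerivAt_eulerStep J (footPoint s δ τ k θ)).scomp θ (h.hasDerivAt_footPoint J θ)

theorem StepHyp.hasDerivAt_graphStepDeriv (h : StepHyp R s L ρ B μ C₁ C₂ δ τ m')
    (J : JetBound L ρ C₁ C₂ m k p r) (θ : ℝ) :
    HasDerivAt (graphStepDeriv R s δ τ k p) (graphStepDeriv₂ R s δ τ k p r θ) θ := by
  have h1 := (h.hasDerivAt_eulerStepDeriv J (footPoint s δ τ k θ)).scomp θ
    (h.hasDerivAt_footPoint J θ)
  convert (h.hasDerivAt_footPointDeriv J θ).smul h1 using 1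
  · rfl
  · simp only [graphStepDeriv₂, Function.comp, smul_smul, sq]

theorem StepHyp.norm_eulerStep_le (h : StepHyp R s L ρ B μ C₁ C₂ δ τ m')
    (J : JetBound L ρ C₁ C₂ m k p r) (θ : ℝ) : ‖eulerStep R δ τ k θ‖ ≤ ρ := by
  have h1 := h.contract_sub (θ := θ) (J.norm_le θ) (z' := 0) (by simpa using h.ρ_nonneg)
  have h2 : eulerStep R δ τ k θ =
      ((k θ + τ • R (δ, θ, k θ)) - (0 + τ • R (δ, θ, 0))) + τ • R (δ, θ, 0) := by
    simp [eulerStep, graphLift]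
  rw [h2]
  refine (norm_add_le _ _).trans ?_
  rw [norm_smul, Real.norm_eq_abs, abs_of_pos h.τ_pos]
  have h3 := mul_le_mul_of_nonneg_left (h.zero_le θ) h.τ_pos.le
  have h4 : (1 - τ * μ) * ‖k θ - 0‖ ≤ (1 - τ * μ) * ρ :=
    mul_le_mul_of_nonneg_left (by simpa using J.norm_le θ) (by linarith [h.τμ_le])
  linarith

theorem StepHyp.norm_eulerStepDeriv_le (h : StepHyp R s L ρ B μ C₁ C₂ δ τ m')
    (J : JetBound L ρ C₁ C₂ m k p r) (θ : ℝ) :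
    ‖eulerStepDeriv R δ τ k p θ‖ ≤ C₁ - 3 * (τ * B) := by
  have h1 := h.contract (θ := θ) (J.norm_le θ) (p θ)
  have h2 : eulerStepDeriv R δ τ k p θ = (p θ + τ • fderiv ℝ R (δ, θ, k θ) (0, 0, p θ))
      + τ • fderiv ℝ R (δ, θ, k θ) (0, 1, 0) := by
    have : ((0, 1, p θ) : ℝ × ℝ × E) = (0, 0, p θ) + (0, 1, 0) := by simp
    simp only [eulerStepDeriv, alongDeriv, graphLift, this, map_add, smul_add, add_assoc]
  rw [h2]
  refine (norm_add_le _ _).trans ?_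
  have h3 : ‖fderiv ℝ R (δ, θ, k θ) (0, 1, 0)‖ ≤ B := by
    refine (ContinuousLinearMap.le_of_opNorm_le _
      (h.boundR.fderiv_le _ (J.mem_tube h.δ_mem θ)) _).trans ?_
    simp [Prod.norm_def]
  rw [norm_smul, Real.norm_eq_abs, abs_of_pos h.τ_pos]
  have h4 := mul_le_mul_of_nonneg_left h3 h.τ_pos.le
  have h5 : (1 - τ * μ) * ‖p θ‖ ≤ (1 - τ * μ) * C₁ :=
    mul_le_mul_of_nonneg_left (J.deriv_le θ) (by linarith [h.τμ_le])
  have h6 : τ * (μ * C₁) = τ * (4 * B) := by rw [h.C₁_eq]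
  linarith

theorem StepHyp.norm_eulerStepDeriv₂_le (h : StepHyp R s L ρ B μ C₁ C₂ δ τ m')
    (J : JetBound L ρ C₁ C₂ m k p r) (θ : ℝ) :
    ‖eulerStepDeriv₂ R δ τ k p r θ‖ ≤ C₂ - 3 * (τ * (B * (1 + C₁) ^ 2)) := by
  have h1 := h.contract (θ := θ) (J.norm_le θ) (r θ)
  have h2 : eulerStepDeriv₂ R δ τ k p r θ = (r θ + τ • fderiv ℝ R (δ, θ, k θ) (0, 0, r θ))
      + τ • fderiv ℝ (fderiv ℝ R) (graphLift δ k θ) (0, 1, p θ) (0, 1, p θ) := by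
    simp only [eulerStepDeriv₂, alongDeriv₂, graphLift, smul_add]
    abel
  rw [h2]
  refine (norm_add_le _ _).trans ?_
  have h3 := J.norm_quadratic_le h.boundR h.δ_mem θ
  rw [norm_smul τ (fderiv ℝ (fderiv ℝ R) _ _ _), Real.norm_eq_abs, abs_of_pos h.τ_pos]
  have h4 := mul_le_mul_of_nonneg_left h3 h.τ_pos.le
  have h5 : (1 - τ * μ) * ‖r θ‖ ≤ (1 - τ * μ) * C₂ :=
    mul_le_mul_of_nonneg_left (J.deriv₂_le θ) (by linarith [h.τμ_le])
  have h6 : τ * (μ * C₂) = τ * (4 * (B * (1 + C₁) ^ 2)) := by rw [h.C₂_eq]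
  linarith

theorem StepHyp.abs_footPointDeriv_le (h : StepHyp R s L ρ B μ C₁ C₂ δ τ m')
    (J : JetBound L ρ C₁ C₂ m k p r) (θ : ℝ) :
    |footPointDeriv s δ τ k p θ| ≤ 1 + τ * (δ * (B * (1 + C₁))) := by
  have h1 := J.norm_alongDeriv_le h.bounds h.δ_mem θ
  refine (abs_sub _ _).trans ?_
  rw [abs_one, abs_mul, abs_mul, abs_of_pos h.τ_pos, abs_of_nonneg h.δ_mem.1]
  have := h.δ_mem.1
  have := h.τ_pos
  rw [Real.norm_eq_abs] at h1
  gcongr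

theorem StepHyp.abs_footPointDeriv₂_le (h : StepHyp R s L ρ B μ C₁ C₂ δ τ m')
    (J : JetBound L ρ C₁ C₂ m k p r) (θ : ℝ) :
    |footPointDeriv₂ s δ τ k p r θ| ≤ τ * (δ * (B * (1 + C₁) ^ 2 + B * C₂)) := by
  have h1 := J.norm_alongDeriv₂_le h.bounds h.δ_mem θ
  rw [footPointDeriv₂, abs_neg, abs_mul, abs_mul, abs_of_pos h.τ_pos, abs_of_nonneg h.δ_mem.1]
  have := h.δ_mem.1
  have := h.τ_pos
  rw [Real.norm_eq_abs] at h1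
  gcongr

theorem StepHyp.eulerStep_lipschitz (h : StepHyp R s L ρ B μ C₁ C₂ δ τ m')
    (J : JetBound L ρ C₁ C₂ m k p r) (x y : ℝ) :
    ‖eulerStep R δ τ k x - eulerStep R δ τ k y‖ ≤ C₁ * |x - y| :=
  convex_univ.norm_image_sub_le_of_norm_hasDerivWithin_le
    (fun t _ => (h.hasDerivAt_eulerStep J t).hasDerivWithinAt)
    (fun t _ => (h.norm_eulerStepDeriv_le J t).trans
      (by nlinarith [h.τ_pos, h.B_nonneg, mul_nonneg h.τ_pos.le h.B_nonneg]))
    (mem_univ y) (mem_univ x)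

theorem StepHyp.eulerStepDeriv_lipschitz (h : StepHyp R s L ρ B μ C₁ C₂ δ τ m')
    (J : JetBound L ρ C₁ C₂ m k p r) (x y : ℝ) :
    ‖eulerStepDeriv R δ τ k p x - eulerStepDeriv R δ τ k p y‖ ≤ C₂ * |x - y| :=
  convex_univ.norm_image_sub_le_of_norm_hasDerivWithin_le
    (fun t _ => (h.hasDerivAt_eulerStepDeriv J t).hasDerivWithinAt)
    (fun t _ => (h.norm_eulerStepDeriv₂_le J t).trans
      (by nlinarith [mul_nonneg h.τ_pos.le (mul_nonneg h.B_nonneg (sq_nonneg (1 + C₁)))]))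
    (mem_univ y) (mem_univ x)

theorem StepHyp.footPoint_lipschitz (h : StepHyp R s L ρ B μ C₁ C₂ δ τ m')
    (J : JetBound L ρ C₁ C₂ m k p r) (x y : ℝ) :
    |footPoint s δ τ k x - footPoint s δ τ k y| ≤ (1 + τ * (δ * (B * (1 + C₁)))) * |x - y| :=
  convex_univ.norm_image_sub_le_of_norm_hasDerivWithin_le
    (fun t _ => (h.hasDerivAt_footPoint J t).hasDerivWithinAt)
    (fun t _ => h.abs_footPointDeriv_le J t) (mem_univ y) (mem_univ x)

theorem StepHyp.footPointDeriv_lipschitz (h : StepHyp R s L ρ B μ C₁ C₂ δ τ m')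
    (J : JetBound L ρ C₁ C₂ m k p r) (x y : ℝ) :
    |footPointDeriv s δ τ k p x - footPointDeriv s δ τ k p y| ≤
      τ * (δ * (B * (1 + C₁) ^ 2 + B * C₂)) * |x - y| :=
  convex_univ.norm_image_sub_le_of_norm_hasDerivWithin_le
    (fun t _ => (h.hasDerivAt_footPointDeriv J t).hasDerivWithinAt)
    (fun t _ => h.abs_footPointDeriv₂_le J t) (mem_univ y) (mem_univ x)

theorem StepHyp.norm_graphStepDeriv_le (h : StepHyp R s L ρ B μ C₁ C₂ δ τ m')
    (J : JetBound L ρ C₁ C₂ m k p r) (θ : ℝ) : ‖graphStepDeriv R s δ τ k p θ‖ ≤ C₁ := by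
  have hη : 0 ≤ δ * (B * (1 + C₁)) :=
    mul_nonneg h.δ_mem.1 (mul_nonneg h.B_nonneg (by linarith [h.C_nonneg.1]))
  have hτ := h.τ_pos
  have hB := h.B_nonneg
  have h1 := h.abs_footPointDeriv_le J θ
  have h2 := h.norm_eulerStepDeriv_le J (footPoint s δ τ k θ)
  have h3 := h.small₁
  rw [graphStepDeriv, norm_smul, Real.norm_eq_abs]
  refine (mul_le_mul h1 h2 (norm_nonneg _) (by positivity)).trans ?_
  set η := δ * (B * (1 + C₁))
  have h4 := mul_le_mul_of_nonneg_left h3 hτ.le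
  have h5 : 0 ≤ τ * η * (τ * B) := by positivity
  nlinarith

theorem StepHyp.norm_graphStepDeriv₂_le (h : StepHyp R s L ρ B μ C₁ C₂ δ τ m')
    (J : JetBound L ρ C₁ C₂ m k p r) (θ : ℝ) : ‖graphStepDeriv₂ R s δ τ k p r θ‖ ≤ C₂ := by
  have hη : 0 ≤ δ * (B * (1 + C₁)) :=
    mul_nonneg h.δ_mem.1 (mul_nonneg h.B_nonneg (by linarith [h.C_nonneg.1]))
  have hτ := h.τ_pos
  have hB := h.B_nonneg
  have hδ := h.δ_mem.1
  obtain ⟨hC1, hC2⟩ := h.C_nonneg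
  have h1 := h.abs_footPointDeriv_le J θ
  have h1' := h.abs_footPointDeriv₂_le J θ
  have h2 := h.norm_eulerStepDeriv_le J (footPoint s δ τ k θ)
  have h2' := h.norm_eulerStepDeriv₂_le J (footPoint s δ τ k θ)
  have h3 := h.small₂
  have h4 := h.τη_le
  refine (norm_add_le _ _).trans ?_
  rw [norm_smul, norm_smul, Real.norm_eq_abs, Real.norm_eq_abs, abs_pow]
  set η := δ * (B * (1 + C₁))
  set D := B * (1 + C₁) ^ 2
  have hD : 0 ≤ D := by positivity
  have h5 : |footPointDeriv s δ τ k p θ| ^ 2 ≤ 1 + 3 * (τ * η) := by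
    have : 0 ≤ τ * η := by positivity
    calc _ ≤ (1 + τ * η) ^ 2 := by gcongr
      _ ≤ _ := by nlinarith
  have h6 : ‖eulerStepDeriv R δ τ k p (footPoint s δ τ k θ)‖ ≤ C₁ := by
    nlinarith [mul_nonneg hτ.le hB]
  have h7 := mul_le_mul h5 h2' (norm_nonneg _) (by positivity)
  have h8 := mul_le_mul h1' h6 (norm_nonneg _) (by positivity)
  have h9 := mul_le_mul_of_nonneg_left h3 hτ.le
  have h10 : 0 ≤ τ * η * (τ * D) := by positivity
  nlinarith

/-- The second derivative of the Euler step gains the contraction factor on the affine modulus. -/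
theorem StepHyp.eulerStepDeriv₂_modulus (h : StepHyp R s L ρ B μ C₁ C₂ δ τ m')
    (J : JetBound L ρ C₁ C₂ m k p r) {ε ε' K : ℝ} (hε' : 0 < ε')
    (hK : ∀ x y, ‖r x - r y‖ ≤ ε + K * |x - y|) (x y : ℝ) :
    ‖eulerStepDeriv₂ R δ τ k p r x - eulerStepDeriv₂ R δ τ k p r y‖ ≤
      (1 - τ * μ) * (ε + K * |x - y|) + τ * (ε' * (1 + C₁) ^ 2 +
        (m' ε' * (1 + C₁) ^ 3 + 3 * B * (1 + C₁) * C₂) * |x - y|) := by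
  have h1 := J.norm_alongDeriv₂_sub_le h.boundR h.δ_mem hε' (h.m'_nonneg _ hε') x y
  have h2 := h.contract (θ := x) (J.norm_le x) (r x - r y)
  have h3 : eulerStepDeriv₂ R δ τ k p r x - eulerStepDeriv₂ R δ τ k p r y =
      (r x - r y + τ • fderiv ℝ R (δ, x, k x) (0, 0, r x - r y)) +
      τ • (alongDeriv₂ R δ k p r x - alongDeriv₂ R δ k p r y
        - fderiv ℝ R (graphLift δ k x) (0, 0, r x - r y)) := by
    simp only [eulerStepDeriv₂, graphLift, smul_sub]
    abel
  rw [h3]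
  refine (norm_add_le _ _).trans ?_
  rw [norm_smul τ (alongDeriv₂ R δ k p r x - alongDeriv₂ R δ k p r y
        - fderiv ℝ R (graphLift δ k x) (0, 0, r x - r y)), Real.norm_eq_abs, abs_of_pos h.τ_pos]
  exact add_le_add (h2.trans (mul_le_mul_of_nonneg_left (hK x y) (by linarith [h.τμ_le])))
    (mul_le_mul_of_nonneg_left h1 h.τ_pos.le)

theorem StepHyp.footPointDeriv₂_modulus (h : StepHyp R s L ρ B μ C₁ C₂ δ τ m')
    (J : JetBound L ρ C₁ C₂ m k p r) {ε ε' K : ℝ} (hε' : 0 < ε')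
    (hK : ∀ x y, ‖r x - r y‖ ≤ ε + K * |x - y|) (x y : ℝ) :
    |footPointDeriv₂ s δ τ k p r x - footPointDeriv₂ s δ τ k p r y| ≤
      τ * (δ * (B * (ε + K * |x - y|) + (ε' * (1 + C₁) ^ 2 +
        (m' ε' * (1 + C₁) ^ 3 + 3 * B * (1 + C₁) * C₂) * |x - y|))) := by
  have h1 := J.norm_alongDeriv₂_sub_le h.bounds h.δ_mem hε' (h.m'_nonneg _ hε') x y
  have h2 : ‖fderiv ℝ s (graphLift δ k x) (0, 0, r x - r y)‖ ≤ B * (ε + K * |x - y|) := by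
    refine (ContinuousLinearMap.le_of_opNorm_le _
      (h.bounds.fderiv_le _ (J.mem_tube h.δ_mem x)) _).trans ?_
    rw [norm_vertical]
    exact mul_le_mul_of_nonneg_left (hK x y) h.B_nonneg
  have h3 : footPointDeriv₂ s δ τ k p r x - footPointDeriv₂ s δ τ k p r y =
      -(τ * (δ * (fderiv ℝ s (graphLift δ k x) (0, 0, r x - r y) +
        (alongDeriv₂ s δ k p r x - alongDeriv₂ s δ k p r y
          - fderiv ℝ s (graphLift δ k x) (0, 0, r x - r y))))) := by
    simp only [footPointDeriv₂]; ring
  rw [h3, abs_neg, abs_mul, abs_mul, abs_of_pos h.τ_pos, abs_of_nonneg h.δ_mem.1]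
  refine mul_le_mul_of_nonneg_left (mul_le_mul_of_nonneg_left ?_ h.δ_mem.1) h.τ_pos.le
  exact (norm_add_le _ _).trans (add_le_add h2 h1)

end GraphStep

section GraphStepBounds

set_option maxSynthPendingDepth 3

variable {E : Type*} [NormedAddCommGroup E] [InnerProductSpace ℝ E]
  {R : ℝ × ℝ × E → E} {s : ℝ × ℝ × E → ℝ} {L ρ B μ C₁ C₂ δ τ : ℝ} {m' : ℝ → ℝ}
  {k p r : ℝ → E}

theorem one_add_cube_le {e : ℝ} (h0 : 0 ≤ e) (h1 : e ≤ 1) : (1 + e) ^ 2 * (1 + e) ≤ 1 + 7 * e := by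
  nlinarith [mul_nonneg h0 h0]

set_option maxHeartbeats 1000000 in
theorem StepHyp.graphStepDeriv₂_modulus (h : StepHyp R s L ρ B μ C₁ C₂ δ τ m')
    (J : JetBound L ρ C₁ C₂ (stepModulus B μ C₁ C₂ m') k p r) {ε : ℝ} (hε : 0 < ε) (x y : ℝ) :
    ‖graphStepDeriv₂ R s δ τ k p r x - graphStepDeriv₂ R s δ τ k p r y‖ ≤
      ε + stepModulus B μ C₁ C₂ m' ε * |x - y| := by
  obtain ⟨hC1, hC2⟩ := h.C_nonneg
  have hμ := h.μ_pos
  have hτ := h.τ_pos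
  have hB := h.B_nonneg
  have hδ := h.δ_mem
  set K := stepModulus B μ C₁ C₂ m' ε with hKdef
  set ε' := μ * ε / (18 * (1 + C₁) ^ 2) with hε'def
  have hε' : 0 < ε' := by positivity
  have hm := h.m'_nonneg _ hε'
  set N := m' ε' * (1 + C₁) ^ 3 + 3 * B * (1 + C₁) * C₂ with hN
  set M := ε' * (1 + C₁) ^ 2 with hM
  set S := B * (1 + C₁) ^ 2 + B * C₂ with hS
  set η := δ * (B * (1 + C₁)) with hη
  have hNn : 0 ≤ N := by positivity
  have hMn : 0 ≤ M := by positivity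
  have hSn : 0 ≤ S := by positivity
  have hηn : 0 ≤ η := mul_nonneg hδ.1 (by positivity)
  have hKeq : μ / 2 * K = 9 * N + 6 * S * C₂ := by
    have : K = 2 / μ * (9 * N + 6 * S * C₂) := rfl
    rw [this]; field_simp
  have hMeq : 9 * M = μ / 2 * ε := by
    rw [hM, hε'def]; field_simp; ring
  have hKn : 0 ≤ K := by
    refine nonneg_of_mul_nonneg_right (a := μ / 2) ?_ (by positivity)
    rw [hKeq]; positivity
  set d := |x - y| with hd
  have hdn : 0 ≤ d := abs_nonneg _
  set X := footPoint s δ τ k x with hX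
  set Y := footPoint s δ τ k y with hY
  have hXY : |X - Y| ≤ (1 + τ * η) * d := h.footPoint_lipschitz J x y
  have he : τ * η ≤ 1 := h.τη_le
  have hen : 0 ≤ τ * η := by positivity
  set e := τ * η with hedef
  have hXY2 : |X - Y| ≤ 2 * d :=
    hXY.trans (mul_le_mul_of_nonneg_right (by linarith) hdn)
  have hY'x := h.abs_footPointDeriv_le J x
  have hY'y := h.abs_footPointDeriv_le J y
  have hY'd := h.footPointDeriv_lipschitz J x y
  have hY''x := h.abs_footPointDeriv₂_le J x
  have hY''d := h.footPointDeriv₂_modulus J hε' (J.modulus ε hε) x y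
  have hU := h.eulerStepDeriv₂_modulus J hε' (J.modulus ε hε) X Y
  have hUb := h.norm_eulerStepDeriv₂_le J Y
  have hPb := h.norm_eulerStepDeriv_le J Y
  have hPd := h.eulerStepDeriv_lipschitz J X Y
  have hUb' : ‖eulerStepDeriv₂ R δ τ k p r Y‖ ≤ C₂ := hUb.trans
    (by linarith [mul_nonneg h.τ_pos.le (mul_nonneg h.B_nonneg (sq_nonneg (1 + C₁)))])
  have hPb' : ‖eulerStepDeriv R δ τ k p Y‖ ≤ C₁ := hPb.trans (by linarith [mul_nonneg hτ.le hB])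
  have hsplit : graphStepDeriv₂ R s δ τ k p r x - graphStepDeriv₂ R s δ τ k p r y =
      footPointDeriv s δ τ k p x ^ 2 •
          (eulerStepDeriv₂ R δ τ k p r X - eulerStepDeriv₂ R δ τ k p r Y) +
        ((footPointDeriv s δ τ k p x + footPointDeriv s δ τ k p y) *
          (footPointDeriv s δ τ k p x - footPointDeriv s δ τ k p y)) •
            eulerStepDeriv₂ R δ τ k p r Y +
        footPointDeriv₂ s δ τ k p r x •
          (eulerStepDeriv R δ τ k p X - eulerStepDeriv R δ τ k p Y) +
        (footPointDeriv₂ s δ τ k p r x - footPointDeriv₂ s δ τ k p r y) •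
          eulerStepDeriv R δ τ k p Y := by
    simp only [graphStepDeriv₂, ← hX, ← hY]
    module
  rw [hsplit]
  set a := footPointDeriv s δ τ k p x
  set b := footPointDeriv s δ τ k p y
  have t1 : ‖a ^ 2 • (eulerStepDeriv₂ R δ τ k p r X - eulerStepDeriv₂ R δ τ k p r Y)‖ ≤
      (1 + 7 * e) * ((1 - τ * μ) * (ε + K * d)) + 8 * (τ * (M + N * d)) := by
    rw [norm_smul, Real.norm_eq_abs, abs_pow]
    have h1 : |a| ^ 2 ≤ (1 + e) ^ 2 := by gcongr
    have h0 : 0 ≤ 1 - τ * μ := by linarith [h.τμ_le]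
    have h2 : ‖eulerStepDeriv₂ R δ τ k p r X - eulerStepDeriv₂ R δ τ k p r Y‖ ≤
        (1 + e) * ((1 - τ * μ) * (ε + K * d) + τ * (M + N * d)) := by
      refine hU.trans ?_
      have h3 : ε + K * |X - Y| ≤ (1 + e) * (ε + K * d) := by
        linarith [mul_le_mul_of_nonneg_left hXY hKn, mul_nonneg hen hε.le]
      have h4 : M + N * |X - Y| ≤ (1 + e) * (M + N * d) := by
        linarith [mul_le_mul_of_nonneg_left hXY hNn, mul_nonneg hen hMn]
      have h5 := mul_le_mul_of_nonneg_left h3 h0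
      have h6 := mul_le_mul_of_nonneg_left h4 hτ.le
      linarith
    refine (mul_le_mul h1 h2 (norm_nonneg _) (by positivity)).trans ?_
    have h7 : 0 ≤ (1 - τ * μ) * (ε + K * d) := by positivity
    have h8 : 0 ≤ τ * (M + N * d) := by positivity
    have h9 : (1 + e) ^ 2 * (1 + e) ≤ 1 + 7 * e := one_add_cube_le hen he
    have h10 : (1 + e) ^ 2 * (1 + e) ≤ 8 := by linarith
    have := mul_le_mul_of_nonneg_right h9 h7
    have := mul_le_mul_of_nonneg_right h10 h8
    linarith
  have t2 : ‖((a + b) * (a - b)) • eulerStepDeriv₂ R δ τ k p r Y‖ ≤ 4 * (τ * (S * C₂ * d)) := by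
    rw [norm_smul, Real.norm_eq_abs, abs_mul]
    have h1 : |a + b| ≤ 4 := (abs_add_le _ _).trans (by linarith)
    have h2 : |a - b| ≤ τ * (S * d) := hY'd.trans (by
      have : τ * (S * d) * δ ≤ τ * (S * d) * 1 := by gcongr; exact hδ.2
      linarith)
    calc _ ≤ 4 * (τ * (S * d)) * C₂ := by gcongr
      _ = _ := by ring
  have t3 : ‖footPointDeriv₂ s δ τ k p r x •
      (eulerStepDeriv R δ τ k p X - eulerStepDeriv R δ τ k p Y)‖ ≤ 2 * (τ * (S * C₂ * d)) := by
    rw [norm_smul, Real.norm_eq_abs]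
    have h2 : |footPointDeriv₂ s δ τ k p r x| ≤ τ * S := hY''x.trans (by
      have : τ * S * δ ≤ τ * S * 1 := by gcongr; exact hδ.2
      linarith)
    have h3 := hPd.trans (mul_le_mul_of_nonneg_left hXY2 hC2)
    calc _ ≤ τ * S * (C₂ * (2 * d)) := by gcongr
      _ = _ := by ring
  have t4 : ‖(footPointDeriv₂ s δ τ k p r x - footPointDeriv₂ s δ τ k p r y) •
      eulerStepDeriv R δ τ k p Y‖ ≤ τ * (δ * C₁ * B * (ε + K * d)) + τ * (M + N * d) := by
    rw [norm_smul, Real.norm_eq_abs]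
    refine (mul_le_mul hY''d hPb' (norm_nonneg _) ((abs_nonneg _).trans hY''d)).trans ?_
    have h8 : 0 ≤ τ * (M + N * d) := by positivity
    have := mul_le_mul_of_nonneg_right h.small₄ h8
    linarith
  refine (norm_add_le _ _).trans ((add_le_add ((norm_add_le _ _).trans (add_le_add
    ((norm_add_le _ _).trans (add_le_add t1 t2)) t3)) t4).trans ?_)
  have hQ : 0 ≤ ε + K * d := by positivity
  have f1 := mul_le_mul_of_nonneg_left h.small₃ hτ.le
  have f2 := mul_le_mul_of_nonneg_right f1 hQ
  have f3 : 0 ≤ e * (τ * μ) * (ε + K * d) := by positivity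
  have f4 : τ * d * (μ / 2 * K) = τ * d * (9 * N + 6 * S * C₂) := by rw [hKeq]
  have f5 : τ * (9 * M) = τ * (μ / 2 * ε) := by rw [hMeq]
  have f6 : τ * (7 * η) * (ε + K * d) = 7 * e * (ε + K * d) := by rw [hedef]; ring
  have f7 : τ * (7 * (δ * (B * (1 + C₁))) + δ * C₁ * B) * (ε + K * d) =
      τ * (7 * η) * (ε + K * d) + τ * (δ * C₁ * B * (ε + K * d)) := by rw [hη]; ring
  rw [f7, f6] at f2
  linarith

/-- The graph step preserves the class of jets with the given bounds. -/
theorem StepHyp.jetBound_graphStep (h : StepHyp R s L ρ B μ C₁ C₂ δ τ m')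
    (J : JetBound L ρ C₁ C₂ (stepModulus B μ C₁ C₂ m') k p r) :
    JetBound L ρ C₁ C₂ (stepModulus B μ C₁ C₂ m') (graphStep R s δ τ k)
      (graphStepDeriv R s δ τ k p) (graphStepDeriv₂ R s δ τ k p r) where
  deriv := h.hasDerivAt_graphStep J
  deriv₂ := h.hasDerivAt_graphStepDeriv J
  periodic θ := by
    have h1 : footPoint s δ τ k (θ + L) = footPoint s δ τ k θ + L := by
      simp only [footPoint, graphLift, J.periodic, h.pers]; ring
    simp only [graphStep, h1, eulerStep, graphLift, J.periodic, h.perR]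
  norm_le _ := h.norm_eulerStep_le J _
  deriv_le := h.norm_graphStepDeriv_le J
  deriv₂_le := h.norm_graphStepDeriv₂_le J
  modulus _ hε := h.graphStepDeriv₂_modulus J hε

theorem StepHyp.norm_graphStep_sub_le (h : StepHyp R s L ρ B μ C₁ C₂ δ τ m') {m : ℝ → ℝ}
    {k' p' r' : ℝ → E} (J : JetBound L ρ C₁ C₂ m k p r) (J' : JetBound L ρ C₁ C₂ m k' p' r')
    {M : ℝ} (hM : ∀ θ, ‖k θ - k' θ‖ ≤ M) (θ : ℝ) :
    ‖graphStep R s δ τ k θ - graphStep R s δ τ k' θ‖ ≤ (1 - τ * μ / 2) * M := by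
  have hM0 : 0 ≤ M := (norm_nonneg _).trans (hM 0)
  obtain ⟨hC1, hC2⟩ := h.C_nonneg
  have hB := h.B_nonneg
  have hτ := h.τ_pos
  have hδ := h.δ_mem.1
  set X := footPoint s δ τ k θ with hX
  set Y := footPoint s δ τ k' θ with hY
  have h1 : |X - Y| ≤ τ * (δ * (B * M)) := by
    have h2 := h.bounds.lipschitz (J.mem_tube h.δ_mem θ) (J'.mem_tube h.δ_mem θ)
    have h3 : graphLift δ k θ - graphLift δ k' θ = (0, 0, k θ - k' θ) := by
      simp [graphLift]
    rw [h3, norm_vertical, Real.norm_eq_abs] at h2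
    have h4 : X - Y = -(τ * (δ * (s (graphLift δ k θ) - s (graphLift δ k' θ)))) := by
      simp only [hX, hY, footPoint]; ring
    rw [h4, abs_neg, abs_mul, abs_mul, abs_of_pos hτ, abs_of_nonneg hδ]
    have h5 := h2.trans (mul_le_mul_of_nonneg_left (hM θ) hB)
    gcongr
  have h6 : ‖eulerStep R δ τ k X - eulerStep R δ τ k' X‖ ≤ (1 - τ * μ) * M :=
    (h.contract_sub (J.norm_le X) (J'.norm_le X)).trans
      (mul_le_mul_of_nonneg_left (hM X) (by linarith [h.τμ_le]))
  have h7 := (h.eulerStep_lipschitz J' X Y).trans (mul_le_mul_of_nonneg_left h1 hC1)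
  have h8 : graphStep R s δ τ k θ - graphStep R s δ τ k' θ =
      (eulerStep R δ τ k X - eulerStep R δ τ k' X) +
        (eulerStep R δ τ k' X - eulerStep R δ τ k' Y) := by
    simp [graphStep, hX, hY]
  rw [h8]
  refine (norm_add_le _ _).trans ((add_le_add h6 h7).trans ?_)
  have h9 : δ * C₁ * B ≤ μ / 2 := by
    have : 0 ≤ 7 * (δ * (B * (1 + C₁))) := by positivity
    linarith [h.small₃]
  have h10 := mul_le_mul_of_nonneg_right (mul_le_mul_of_nonneg_left h9 hτ.le) hM0
  linarith

end GraphStepBounds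

section InvariantGraph

set_option maxSynthPendingDepth 3

theorem norm_sub_sub_smul_le_of_deriv {E : Type*} [NormedAddCommGroup E] [NormedSpace ℝ E]
    {f f' : ℝ → E} {c : E} {A x y : ℝ} (hf : ∀ t, HasDerivAt f (f' t) t)
    (hA : ∀ t, |t - x| ≤ |y - x| → ‖f' t - c‖ ≤ A) :
    ‖f y - f x - (y - x) • c‖ ≤ A * |y - x| := by
  have h1 : ∀ t ∈ Metric.closedBall x |y - x|,
      HasDerivWithinAt (fun t => f t - t • c) (f' t - c) (Metric.closedBall x |y - x|) t := by
    intro t _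
    have := (hf t).sub ((hasDerivAt_id t).smul_const c)
    rw [one_smul] at this
    exact this.hasDerivWithinAt
  have h2 := (convex_closedBall x |y - x|).norm_image_sub_le_of_norm_hasDerivWithin_le h1
    (C := A) (x := x) (y := y) (fun t ht => hA t (by simpa [Real.dist_eq] using ht))
    (by simp) (by simp [Real.dist_eq])
  have h3 : f y - f x - (y - x) • c = f y - y • c - (f x - x • c) := by module
  rw [h3]
  exact h2

theorem hasDerivAt_of_norm_sub_le {E : Type*} [NormedAddCommGroup E] [NormedSpace ℝ E]
    {f : ℝ → E} {c : E} {x : ℝ}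
    (h : ∀ ε > 0, ∃ m : ℝ, ∀ y, ‖f y - f x - (y - x) • c‖ ≤ (ε + m * |y - x|) * |y - x|) :
    HasDerivAt f c x := by
  rw [hasDerivAt_iff_isLittleO, Asymptotics.isLittleO_iff]
  intro ε hε
  obtain ⟨m, hm⟩ := h (ε / 2) (by positivity)
  have h1 : Tendsto (fun y => ε / 2 + m * |y - x|) (nhds x) (nhds (ε / 2 + m * |x - x|)) :=
    Continuous.tendsto (by fun_prop) x
  have h2 := h1.eventually (gt_mem_nhds (show ε / 2 + m * |x - x| < ε by simp; linarith))
  filter_upwards [h2] with y hy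
  refine (hm y).trans ?_
  rw [Real.norm_eq_abs]
  exact mul_le_mul_of_nonneg_right hy.le (abs_nonneg _)

variable {E : Type*} [NormedAddCommGroup E]

section Normed

variable [NormedSpace ℝ E] {L ρ C₁ C₂ : ℝ} {m : ℝ → ℝ} {k p r : ℝ → E}

theorem JetBound.taylor (h : JetBound L ρ C₁ C₂ m k p r) (x y : ℝ) :
    ‖k y - k x - (y - x) • p x‖ ≤ C₂ * |y - x| * |y - x| :=
  norm_sub_sub_smul_le_of_deriv h.deriv fun t ht =>
    (h.deriv_lipschitz t x).trans (mul_le_mul_of_nonneg_left ht h.nonneg.2.2)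

theorem JetBound.taylor_deriv (h : JetBound L ρ C₁ C₂ m k p r) {ε : ℝ} (hε : 0 < ε)
    (hm : 0 ≤ m ε) (x y : ℝ) :
    ‖p y - p x - (y - x) • r x‖ ≤ (ε + m ε * |y - x|) * |y - x| :=
  norm_sub_sub_smul_le_of_deriv h.deriv₂ fun t ht =>
    (h.modulus ε hε t x).trans (by gcongr)

/-- The class of jets with given bounds is compact for pointwise convergence. -/
theorem JetBound.exists_ultrafilter_limit [ProperSpace E] {ι : Type*} (u : Ultrafilter ι)
    (hm : ∀ ε > 0, 0 ≤ m ε) {k p r : ι → ℝ → E}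
    (h : ∀ i, JetBound L ρ C₁ C₂ m (k i) (p i) (r i)) :
    ∃ K P Q : ℝ → E, JetBound L ρ C₁ C₂ m K P Q ∧
      (∀ θ, Tendsto (fun i => k i θ) u (nhds (K θ))) ∧
      (∀ θ, Tendsto (fun i => p i θ) u (nhds (P θ))) := by
  have key : ∀ (D : ℝ) (g : ι → ℝ → E), (∀ i θ, ‖g i θ‖ ≤ D) →
      ∀ θ, ∃ z : E, Tendsto (fun i => g i θ) u (nhds z) := by
    intro D g hg θ
    obtain ⟨z, -, hz⟩ := (isCompact_closedBall (0 : E) D).ultrafilter_le_nhds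
      (u.map fun i => g i θ) (by
        rw [le_principal_iff, Ultrafilter.mem_coe, Ultrafilter.mem_map]
        exact Filter.univ_mem' fun i => by simpa using hg i θ)
    exact ⟨z, hz⟩
  choose K hK using key ρ k fun i => (h i).norm_le
  choose P hP using key C₁ p fun i => (h i).deriv_le
  choose Q hQ using key C₂ r fun i => (h i).deriv₂_le
  have hC2 : 0 ≤ C₂ := by
    obtain ⟨i⟩ : Nonempty ι := u.neBot.nonempty
    exact (h i).nonneg.2.2
  refine ⟨K, P, Q, ⟨fun x => ?_, fun x => ?_, fun x => ?_, fun x => ?_, fun x => ?_, fun x => ?_,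
    fun ε hε x y => ?_⟩, hK, hP⟩
  · refine hasDerivAt_of_norm_sub_le fun ε hε => ⟨C₂, fun y => ?_⟩
    refine (le_of_tendsto (((hK y).sub (hK x)).sub ((hP x).const_smul (y - x))).norm
      (Eventually.of_forall fun i => (h i).taylor x y)).trans ?_
    gcongr; linarith
  · refine hasDerivAt_of_norm_sub_le fun ε hε => ⟨m ε, fun y => ?_⟩
    exact le_of_tendsto (((hP y).sub (hP x)).sub ((hQ x).const_smul (y - x))).norm
      (Eventually.of_forall fun i => (h i).taylor_deriv hε (hm ε hε) x y)
  · refine tendsto_nhds_unique (hK (x + L)) ?_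
    simpa only [(h _).periodic] using hK x
  · exact le_of_tendsto (hK x).norm (Eventually.of_forall fun i => (h i).norm_le x)
  · exact le_of_tendsto (hP x).norm (Eventually.of_forall fun i => (h i).deriv_le x)
  · exact le_of_tendsto (hQ x).norm (Eventually.of_forall fun i => (h i).deriv₂_le x)
  · exact le_of_tendsto ((hQ x).sub (hQ y)).norm
      (Eventually.of_forall fun i => (h i).modulus ε hε x y)

end Normed

variable [InnerProductSpace ℝ E] {R : ℝ × ℝ × E → E} {s : ℝ × ℝ × E → ℝ}
  {L ρ B μ C₁ C₂ δ τ : ℝ} {m' : ℝ → ℝ} {k p r : ℝ → E}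

theorem StepHyp.stepModulus_nonneg (h : StepHyp R s L ρ B μ C₁ C₂ δ τ m') {ε : ℝ} (hε : 0 < ε) :
    0 ≤ stepModulus B μ C₁ C₂ m' ε := by
  obtain ⟨hC1, hC2⟩ := h.C_nonneg
  have hμ := h.μ_pos
  have hB := h.B_nonneg
  have := h.m'_nonneg (μ * ε / (18 * (1 + C₁) ^ 2)) (by positivity)
  rw [stepModulus]
  positivity

theorem StepHyp.exists_almost_fixed (h : StepHyp R s L ρ B μ C₁ C₂ δ τ m') {ε : ℝ} (hε : 0 < ε) :
    ∃ k p r : ℝ → E, JetBound L ρ C₁ C₂ (stepModulus B μ C₁ C₂ m') k p r ∧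
      ∀ θ, ‖graphStep R s δ τ k θ - k θ‖ ≤ ε := by
  obtain ⟨hC1, hC2⟩ := h.C_nonneg
  have hρ := h.ρ_nonneg
  have hτμ : 0 < τ * μ := mul_pos h.τ_pos h.μ_pos
  have key : ∀ n : ℕ, ∃ k p r : ℝ → E, JetBound L ρ C₁ C₂ (stepModulus B μ C₁ C₂ m') k p r ∧
      ∀ θ, ‖graphStep R s δ τ k θ - k θ‖ ≤ (1 - τ * μ / 2) ^ n * ρ := by
    intro n
    induction n with
    | zero =>
      have J : JetBound L ρ C₁ C₂ (stepModulus B μ C₁ C₂ m') (fun _ => (0 : E)) (fun _ => 0)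
          (fun _ => 0) :=
        ⟨fun θ => hasDerivAt_const θ 0, fun θ => hasDerivAt_const θ 0, fun _ => rfl,
          fun _ => by simpa, fun _ => by simpa, fun _ => by simpa, fun ε hε x y => by
            have := h.stepModulus_nonneg hε
            simp only [sub_self, norm_zero]; positivity⟩
      exact ⟨_, _, _, J, fun θ => by
        simpa [graphStep] using h.norm_eulerStep_le J (footPoint s δ τ (fun _ => 0) θ)⟩
    | succ n ih =>
      obtain ⟨k, p, r, J, hk⟩ := ih
      have J' := h.jetBound_graphStep J
      refine ⟨_, _, _, J', fun θ => ?_⟩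
      rw [pow_succ', mul_assoc]
      exact h.norm_graphStep_sub_le J' J hk θ
  have h1 : Tendsto (fun n : ℕ => (1 - τ * μ / 2) ^ n * ρ) atTop (nhds (0 * ρ)) :=
    (tendsto_pow_atTop_nhds_zero_of_lt_one (by linarith [h.τμ_le]) (by linarith)).mul_const ρ
  rw [zero_mul] at h1
  obtain ⟨n, hn⟩ := (h1.eventually (gt_mem_nhds hε)).exists
  obtain ⟨k, p, r, J, hk⟩ := key n
  exact ⟨k, p, r, J, fun θ => (hk θ).trans hn.le⟩

theorem StepHyp.norm_defect_le (h : StepHyp R s L ρ B μ C₁ C₂ δ τ m') {m : ℝ → ℝ}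
    (J : JetBound L ρ C₁ C₂ m k p r) (hk : ∀ θ, ‖graphStep R s δ τ k θ - k θ‖ ≤ τ ^ 2) (θ : ℝ) :
    ‖R (graphLift δ k θ) - (δ * s (graphLift δ k θ)) • p θ‖ ≤
      τ * (1 + C₂ * B ^ 2 + B ^ 2 * (1 + C₁)) := by
  obtain ⟨hC1, hC2⟩ := h.C_nonneg
  have hτ := h.τ_pos
  have hB := h.B_nonneg
  have hδ := h.δ_mem
  set σ := s (graphLift δ k θ) with hσ
  set y := footPoint s δ τ k θ with hy
  have hyθ : y - θ = -(τ * (δ * σ)) := by simp only [hy, footPoint, hσ]; ring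
  have hσB : |σ| ≤ B := h.bounds.norm_le _ (J.mem_tube hδ θ)
  have hd : |y - θ| ≤ τ * B := by
    rw [hyθ, abs_neg, abs_mul, abs_mul, abs_of_pos hτ, abs_of_nonneg hδ.1]
    have : δ * |σ| ≤ 1 * B := by gcongr; exact hδ.2
    rw [one_mul] at this
    gcongr
  have h1 := J.taylor θ y
  have h1' : ‖k y - k θ - (y - θ) • p θ‖ ≤ C₂ * (τ * B) * (τ * B) := h1.trans (by gcongr)
  have h2 : ‖R (graphLift δ k y) - R (graphLift δ k θ)‖ ≤ B * ((1 + C₁) * (τ * B)) :=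
    (h.boundR.lipschitz (J.mem_tube hδ y) (J.mem_tube hδ θ)).trans
      (mul_le_mul_of_nonneg_left ((J.graphLift_lipschitz y θ).trans (by gcongr)) hB)
  have h3 := hk θ
  have h4 : τ • (R (graphLift δ k θ) - (δ * σ) • p θ) =
      (graphStep R s δ τ k θ - k θ) - (k y - k θ - (y - θ) • p θ)
        - τ • (R (graphLift δ k y) - R (graphLift δ k θ)) := by
    rw [hyθ]
    simp only [graphStep, ← hy, eulerStep]
    module
  have h5 : τ * ‖R (graphLift δ k θ) - (δ * σ) • p θ‖ ≤
      τ ^ 2 + C₂ * (τ * B) * (τ * B) + τ * (B * ((1 + C₁) * (τ * B))) := by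
    calc _ = ‖τ • (R (graphLift δ k θ) - (δ * σ) • p θ)‖ := by
          rw [norm_smul, Real.norm_eq_abs, abs_of_pos hτ]
      _ ≤ _ := by
          rw [h4]
          refine (norm_sub_le _ _).trans (add_le_add ((norm_sub_le _ _).trans
            (add_le_add h3 h1')) ?_)
          rw [norm_smul, Real.norm_eq_abs, abs_of_pos hτ]
          gcongr
  refine le_of_mul_le_mul_left (h5.trans (le_of_eq ?_)) hτ
  ring

/-- Existence of an invariant graph for the scaled slow-fast field. -/
theorem exists_invariant_graph [ProperSpace E] {τ₀ : ℝ} (hτ₀ : 0 < τ₀)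
    (h : ∀ τ, 0 < τ → τ ≤ τ₀ → StepHyp R s L ρ B μ C₁ C₂ δ τ m') :
    ∃ k p r : ℝ → E, JetBound L ρ C₁ C₂ (stepModulus B μ C₁ C₂ m') k p r ∧
      ∀ θ, (δ * s (graphLift δ k θ)) • p θ = R (graphLift δ k θ) := by
  have h0 := h τ₀ hτ₀ le_rfl
  have hτn : ∀ n : ℕ, 0 < τ₀ * (1 / ((n : ℝ) + 1)) := fun n => by positivity
  have hτn' : ∀ n : ℕ, τ₀ * (1 / ((n : ℝ) + 1)) ≤ τ₀ := fun n =>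
    mul_le_of_le_one_right hτ₀.le (by
      rw [div_le_one (by positivity)]; linarith [(Nat.cast_nonneg n : (0 : ℝ) ≤ n)])
  choose k p r J hk using fun n : ℕ =>
    (h _ (hτn n) (hτn' n)).exists_almost_fixed (pow_pos (hτn n) 2)
  obtain ⟨K, P, Q, JK, hK, hP⟩ := JetBound.exists_ultrafilter_limit (hyperfilter ℕ)
    (fun ε hε => h0.stepModulus_nonneg hε) J
  refine ⟨K, P, Q, JK, fun θ => ?_⟩
  have hlift : Tendsto (fun n => graphLift δ (k n) θ) (hyperfilter ℕ) (nhds (graphLift δ K θ)) :=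
    tendsto_const_nhds.prodMk_nhds (tendsto_const_nhds.prodMk_nhds (hK θ))
  have hR := (h0.boundR.contDiff.continuous.tendsto (graphLift δ K θ)).comp hlift
  have hs := (h0.bounds.contDiff.continuous.tendsto (graphLift δ K θ)).comp hlift
  have hdef := (hR.sub ((hs.const_mul δ).smul (hP θ))).norm
  have hτ0 : Tendsto (fun n : ℕ => τ₀ * (1 / ((n : ℝ) + 1)) *
      (1 + C₂ * B ^ 2 + B ^ 2 * (1 + C₁))) (hyperfilter ℕ) (nhds 0) := by
    have := (tendsto_one_div_add_atTop_nhds_zero_nat (𝕜 := ℝ)).const_mul τ₀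
    have := this.mul_const (1 + C₂ * B ^ 2 + B ^ 2 * (1 + C₁))
    rw [mul_zero, zero_mul] at this
    exact this.mono_left (Nat.hyperfilter_le_atTop)
  have hle := le_of_tendsto_of_tendsto hdef hτ0 (Eventually.of_forall fun n =>
    (h _ (hτn n) (hτn' n)).norm_defect_le (J n) (hk n) θ)
  exact (sub_eq_zero.1 (norm_le_zero_iff.1 hle)).symm

end InvariantGraph

section SmallParameter

set_option maxSynthPendingDepth 3

theorem exists_pos_mul_le {ι : Type*} (S : Finset ι) (a b : ι → ℝ) (hb : ∀ i ∈ S, 0 < b i) :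
    ∃ δ₀ > 0, δ₀ ≤ (1 : ℝ) ∧ ∀ δ, 0 ≤ δ → δ ≤ δ₀ → ∀ i ∈ S, δ * a i ≤ b i := by
  have h1 : ∀ᶠ δ : ℝ in nhds 0, ∀ i ∈ S, δ * a i < b i := by
    rw [eventually_all_finset]
    intro i hi
    have : Tendsto (fun δ : ℝ => δ * a i) (nhds 0) (nhds (0 * a i)) :=
      tendsto_id.mul_const (a i)
    exact this.eventually (gt_mem_nhds (by simpa using hb i hi))
  obtain ⟨η, hη, h2⟩ := Metric.eventually_nhds_iff.1 h1
  refine ⟨min (η / 2) 1, by positivity, min_le_right _ _, fun δ h0 h3 i hi => (h2 ?_ i hi).le⟩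
  rw [Real.dist_eq, sub_zero, abs_of_nonneg h0]
  linarith [h3.trans (min_le_left _ _)]

theorem exists_pos_mul_le_list (l : List (ℝ × ℝ)) (hb : ∀ i ∈ l, 0 < i.2) :
    ∃ δ₀ > 0, δ₀ ≤ (1 : ℝ) ∧ ∀ δ, 0 ≤ δ → δ ≤ δ₀ → ∀ i ∈ l, δ * i.1 ≤ i.2 := by
  classical
  simpa using exists_pos_mul_le l.toFinset Prod.fst Prod.snd (by simpa using hb)

variable {E : Type*} [NormedAddCommGroup E] [InnerProductSpace ℝ E]
  {R : ℝ × ℝ × E → E} {s : ℝ × ℝ × E → ℝ} {L ρ B μ : ℝ} {m' : ℝ → ℝ}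

/-- For small `δ` the field `θ' = δ s`, `z' = R` has an invariant graph which is bounded in `C²`
uniformly in `δ`. -/
theorem exists_invariant_graph_family [ProperSpace E] (hR : TubeBound R ρ B m')
    (hs : TubeBound s ρ B m') (hm' : ∀ ε > 0, 0 ≤ m' ε)
    (perR : ∀ d θ z, R (d, θ + L, z) = R (d, θ, z))
    (pers : ∀ d θ z, s (d, θ + L, z) = s (d, θ, z)) (hB : 0 < B) (hμ : 0 < μ) (hρ : 0 ≤ ρ)
    (dissip : ∀ θ z v, ‖z‖ ≤ ρ → ⟪fderiv ℝ R (0, θ, z) (0, 0, v), v⟫ ≤ -(3 * μ) * ‖v‖ ^ 2)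
    (zero_le : ∀ δ ∈ Icc (0 : ℝ) 1, ∀ θ, ‖R (δ, θ, 0)‖ ≤ μ * ρ) :
    ∃ δ₀ > 0, δ₀ ≤ 1 ∧ ∃ C₁ C₂ : ℝ, ∃ m : ℝ → ℝ, (∀ ε > 0, 0 ≤ m ε) ∧ ∀ δ, 0 < δ → δ ≤ δ₀ →
      ∃ k p r : ℝ → E, JetBound L ρ C₁ C₂ m k p r ∧
        ∀ θ, (δ * s (graphLift δ k θ)) • p θ = R (graphLift δ k θ) := by
  set C₁ := 4 * B / μ with hC₁
  have hC1 : 0 < C₁ := by positivity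
  set C₂ := 4 * (B * (1 + C₁) ^ 2) / μ with hC₂
  have hC2 : 0 < C₂ := by positivity
  obtain ⟨δ₀, hδ₀, hδ₁, hδ⟩ := exists_pos_mul_le_list
    [(B, μ), (B * (1 + C₁) * C₁, 3 * B),
      (3 * (B * (1 + C₁)) * C₂ + (B * (1 + C₁) ^ 2 + B * C₂) * C₁, 3 * (B * (1 + C₁) ^ 2)),
      (7 * (B * (1 + C₁)) + C₁ * B, μ / 2), (C₁, 1)] (by
        simp only [List.forall_mem_cons]
        refine ⟨?_, ?_, ?_, ?_, ?_, by simp⟩ <;> positivity)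
  obtain ⟨τ₀, hτ₀, hτ₁, hτ⟩ := exists_pos_mul_le_list
    [(μ, 1), (B ^ 2, 2 * μ), (B * (1 + C₁), 1)] (by
        simp only [List.forall_mem_cons]
        refine ⟨?_, ?_, ?_, by simp⟩ <;> positivity)
  have main : ∀ δ, 0 < δ → δ ≤ δ₀ → ∀ τ, 0 < τ → τ ≤ τ₀ →
      StepHyp R s L ρ B μ C₁ C₂ δ τ m' := by
    intro δ hd0 hd1 τ ht0 ht1
    have h1 := hδ δ hd0.le hd1
    have h2 := hτ τ ht0.le ht1
    simp only [List.forall_mem_cons] at h1 h2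
    obtain ⟨a1, a2, a3, a4, a5, -⟩ := h1
    obtain ⟨b1, b2, b3, -⟩ := h2
    have hmem : δ ∈ Icc (0 : ℝ) 1 := ⟨hd0.le, hd1.trans hδ₁⟩
    refine ⟨hR, hs, hm', perR, pers, hB.le, hμ, hρ, hmem, ht0, fun θ z v hz => ?_,
      zero_le δ hmem, ?_, ?_, b1, b2, ?_, ?_, ?_, ?_, a5⟩
    · have h3 := hR.fderiv_lipschitz (w := (δ, θ, z)) (w' := (0, θ, z)) ⟨hmem, hz⟩
        ⟨by simp, hz⟩
      have h4 : ‖((δ, θ, z) : ℝ × ℝ × E) - (0, θ, z)‖ = δ := by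
        simp [Prod.norm_def, abs_of_pos hd0, hd0.le]
      rw [h4] at h3
      have h5 : ⟪(fderiv ℝ R (δ, θ, z) - fderiv ℝ R (0, θ, z)) (0, 0, v), v⟫ ≤ μ * ‖v‖ ^ 2 := by
        refine (real_inner_le_norm _ _).trans ?_
        have h6 := ContinuousLinearMap.le_of_opNorm_le _ (h3.trans (by linarith)) (0, 0, v)
          (c := μ)
        rw [norm_vertical] at h6
        calc _ ≤ μ * ‖v‖ * ‖v‖ := by gcongr
          _ = _ := by ring
      have h7 := dissip θ z v hz
      rw [sub_apply, inner_sub_left] at h5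
      linarith
    · rw [hC₁]; field_simp
    · rw [hC₂]; field_simp
    · have : τ * (δ * (B * (1 + C₁))) ≤ τ * (1 * (B * (1 + C₁))) := by gcongr; exact hmem.2
      linarith
    · linarith
    · linarith
    · linarith
  refine ⟨δ₀, hδ₀, hδ₁, C₁, C₂, stepModulus B μ C₁ C₂ m',
    fun ε hε => (main δ₀ hδ₀ le_rfl τ₀ hτ₀ le_rfl).stepModulus_nonneg hε, fun δ h0 h1 => ?_⟩
  exact exists_invariant_graph hτ₀ (main δ h0 h1)

end SmallParameter

section ParametricIntegral

universe u

variable {W : Type u} [NormedAddCommGroup W] [NormedSpace ℝ W] [ProperSpace W]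

theorem hasFDerivAt_parametric_intervalIntegral {F : Type*} [NormedAddCommGroup F]
    [NormedSpace ℝ F] {f : ℝ × W → F} {f' : ℝ × W → W →L[ℝ] F}
    (hf : Continuous f) (hf' : Continuous f') {a b : ℝ}
    (hd : ∀ t w, HasFDerivAt (fun w => f (t, w)) (f' (t, w)) w) (w₀ : W) :
    HasFDerivAt (fun w => ∫ t in a..b, f (t, w)) (∫ t in a..b, f' (t, w₀)) w₀ := by
  obtain ⟨K, hK⟩ := (isCompact_uIcc (a := a) (b := b)).prod (isCompact_closedBall w₀ 1)
    |>.exists_bound_of_continuousOn hf'.continuousOn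
  refine intervalIntegral.hasFDerivAt_integral_of_dominated_of_fderiv_le (bound := fun _ => K)
    (F := fun w t => f (t, w)) (F' := fun w t => f' (t, w))
    (Metric.closedBall_mem_nhds w₀ one_pos) ?_ ?_ ?_ ?_ ?_ ?_
  · exact Eventually.of_forall fun w =>
      (hf.comp (Continuous.prodMk_left w)).aestronglyMeasurable
  · exact (hf.comp (Continuous.prodMk_left w₀)).intervalIntegrable _ _
  · exact (hf'.comp (Continuous.prodMk_left w₀)).aestronglyMeasurable
  · exact Eventually.of_forall fun t ht x hx => hK (t, x) ⟨uIoc_subset_uIcc ht, hx⟩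
  · exact intervalIntegrable_const
  · exact Eventually.of_forall fun t _ x _ => hd t x

theorem ContDiff.parametric_intervalIntegral (n : ℕ) {F : Type u} [NormedAddCommGroup F]
    [NormedSpace ℝ F] {f : ℝ × W → F} (hf : ContDiff ℝ n f) (a b : ℝ) :
    ContDiff ℝ n (fun w => ∫ t in a..b, f (t, w)) := by
  induction n generalizing F with
  | zero =>
    rw [Nat.cast_zero, contDiff_zero] at *
    exact intervalIntegral.continuous_parametric_intervalIntegral_of_continuous'
      (f := fun w t => f (t, w)) (hf.comp continuous_swap) a b
  | succ n ih =>
    set f' : ℝ × W → W →L[ℝ] F := fun x => (fderiv ℝ f x).comp (ContinuousLinearMap.inr ℝ ℝ W)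
    have hf' : ContDiff ℝ n f' := (hf.fderiv_right (by norm_cast)).clm_comp contDiff_const
    rw [Nat.cast_succ, contDiff_succ_iff_hasFDerivAt]
    refine ⟨_, ih hf', fun w => hasFDerivAt_parametric_intervalIntegral hf.continuous
      hf'.continuous (fun t w => ?_) w⟩
    exact (hf.differentiable (by simp) (t, w)).hasFDerivAt.comp w (hasFDerivAt_prodMk_right t w)

end ParametricIntegral

section PeriodicTube

set_option maxSynthPendingDepth 3

variable {E F : Type*} [NormedAddCommGroup E] [ProperSpace E] [NormedAddCommGroup F] {L : ℝ}

theorem periodic_exists_bound_and_modulus {g : ℝ × ℝ × E → F} (hg : Continuous g) (hL : 0 < L)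
    (hper : Function.Periodic g (0, L, 0)) (ρ : ℝ) :
    ∃ B ≥ 0, (∀ w ∈ slowTube E ρ, ‖g w‖ ≤ B) ∧ ∀ ε > 0, ∃ K ≥ 0, ∀ w ∈ slowTube E ρ,
      ∀ w' ∈ slowTube E ρ, ‖g w - g w'‖ ≤ ε + K * ‖w - w'‖ := by
  set S : Set (ℝ × ℝ × E) := Icc (0 : ℝ) 1 ×ˢ (Icc (-L) (2 * L) ×ˢ Metric.closedBall (0 : E) ρ)
    with hS
  have hSc : IsCompact S := isCompact_Icc.prod (isCompact_Icc.prod (isCompact_closedBall 0 ρ))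
  have hshift : ∀ w ∈ slowTube E ρ, ∃ c : ℝ × ℝ × E, c.1 = 0 ∧ c.2.2 = 0 ∧
      (∀ v, g (v - c) = g v) ∧ w.2.1 - c.2.1 ∈ Icc 0 L := by
    intro w _
    refine ⟨⌊w.2.1 / L⌋ • ((0, L, 0) : ℝ × ℝ × E), by simp, by simp, fun v =>
      hper.sub_zsmul_eq _, ?_⟩
    have h1 := Int.floor_le (w.2.1 / L)
    have h2 := (Int.lt_floor_add_one (w.2.1 / L)).le
    rw [le_div_iff₀ hL] at h1
    rw [div_le_iff₀ hL] at h2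
    simp only [Prod.smul_mk, zsmul_eq_mul, mem_Icc]
    constructor <;> linarith
  obtain ⟨B, hB⟩ := hSc.exists_bound_of_continuousOn hg.continuousOn
  have hbound : ∀ w ∈ slowTube E ρ, ‖g w‖ ≤ max B 0 := by
    intro w hw
    obtain ⟨c, hc1, hc2, hgc, hc⟩ := hshift w hw
    rw [← hgc w]
    refine (hB _ ?_).trans (le_max_left _ _)
    refine ⟨?_, ⟨?_, ?_⟩, ?_⟩
    · simpa [hc1] using hw.1
    · simpa using (by linarith [hc.1] : -L ≤ w.2.1 - c.2.1)
    · simpa using (by linarith [hc.2] : w.2.1 - c.2.1 ≤ 2 * L)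
    · simpa [hc2] using hw.2
  refine ⟨max B 0, le_max_right _ _, hbound, fun ε hε => ?_⟩
  obtain ⟨η, hη, hu⟩ := Metric.uniformContinuousOn_iff.1
    (hSc.uniformContinuousOn_of_continuous hg.continuousOn) ε hε
  have hη' : 0 < min η L := lt_min hη hL
  refine ⟨2 * max B 0 / min η L, by positivity, fun w hw w' hw' => ?_⟩
  rcases lt_or_ge ‖w - w'‖ (min η L) with hlt | hge
  · obtain ⟨c, hc1, hc2, hgc, hc⟩ := hshift w hw
    have h21 : |w.2.1 - w'.2.1| ≤ ‖w - w'‖ := (norm_fst_le (w - w').2).trans (norm_snd_le _)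
    have h21' := abs_le.1 (h21.trans (hlt.le.trans (min_le_right _ _)))
    have hmem : w - c ∈ S := by
      refine ⟨?_, ⟨?_, ?_⟩, ?_⟩
      · simpa [hc1] using hw.1
      · simpa using (by linarith [hc.1] : -L ≤ w.2.1 - c.2.1)
      · simpa using (by linarith [hc.2] : w.2.1 - c.2.1 ≤ 2 * L)
      · simpa [hc2] using hw.2
    have hmem' : w' - c ∈ S := by
      refine ⟨?_, ⟨?_, ?_⟩, ?_⟩
      · simpa [hc1] using hw'.1
      · simpa using (by linarith [hc.1] : -L ≤ w'.2.1 - c.2.1)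
      · simpa using (by linarith [hc.2] : w'.2.1 - c.2.1 ≤ 2 * L)
      · simpa [hc2] using hw'.2
    have h3 := hu _ hmem _ hmem' (by
      rw [dist_eq_norm, sub_sub_sub_cancel_right]
      exact hlt.trans_le (min_le_left _ _))
    rw [dist_eq_norm, hgc, hgc] at h3
    have : 0 ≤ 2 * max B 0 / min η L * ‖w - w'‖ := by positivity
    linarith
  · have h1 : 2 * max B 0 ≤ 2 * max B 0 / min η L * ‖w - w'‖ := by
      rw [div_mul_eq_mul_div, le_div_iff₀ hη']
      gcongr
    have := (norm_sub_le (g w) (g w')).trans (add_le_add (hbound w hw) (hbound w' hw'))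
    linarith

variable [NormedSpace ℝ E] [NormedSpace ℝ F]

theorem Function.Periodic.fderiv {W : Type*} [NormedAddCommGroup W] [NormedSpace ℝ W] {f : W → F}
    {c : W} (h : Function.Periodic f c) : Function.Periodic (fderiv ℝ f) c := by
  intro x
  rw [← fderiv_comp_add_right, funext h]

theorem exists_tubeBound {f : ℝ × ℝ × E → F} (hf : ContDiff ℝ 2 f) (hL : 0 < L)
    (hper : Function.Periodic f (0, L, 0)) (ρ : ℝ) :
    ∃ B ≥ 0, ∃ m : ℝ → ℝ, (∀ ε > 0, 0 ≤ m ε) ∧ TubeBound f ρ B m := by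
  have h1 : ContDiff ℝ 1 (fderiv ℝ f) := hf.fderiv_right (by norm_num)
  have h2 : ContDiff ℝ 0 (fderiv ℝ (fderiv ℝ f)) := h1.fderiv_right (by norm_num)
  obtain ⟨B₀, h0, hB₀, -⟩ := periodic_exists_bound_and_modulus hf.continuous hL hper ρ
  obtain ⟨B₁, -, hB₁, -⟩ := periodic_exists_bound_and_modulus h1.continuous hL hper.fderiv ρ
  obtain ⟨B₂, -, hB₂, hmod⟩ :=
    periodic_exists_bound_and_modulus h2.continuous hL hper.fderiv.fderiv ρ
  choose! m hm0 hm using hmod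
  refine ⟨max B₀ (max B₁ B₂), h0.trans (le_max_left _ _), m, hm0, hf,
    fun w hw => (hB₀ w hw).trans (le_max_left _ _), fun w hw => (hB₁ w hw).trans ?_,
    fun w hw => (hB₂ w hw).trans ?_, hm⟩ <;> simp

end PeriodicTube

section ScaledField

set_option maxSynthPendingDepth 3

universe u

variable {E : Type u} [NormedAddCommGroup E] [InnerProductSpace ℝ E]

theorem JetBound.deriv_eq {L ρ C₁ C₂ : ℝ} {m : ℝ → ℝ} {k p r : ℝ → E}
    (h : JetBound L ρ C₁ C₂ m k p r) : _root_.deriv k = p :=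
  funext fun θ => (h.deriv θ).deriv

theorem JetBound.deriv₂_eq {L ρ C₁ C₂ : ℝ} {m : ℝ → ℝ} {k p r : ℝ → E}
    (h : JetBound L ρ C₁ C₂ m k p r) : _root_.deriv (_root_.deriv k) = r := by
  rw [h.deriv_eq]
  exact funext fun θ => (h.deriv₂ θ).deriv

theorem JetBound.contDiff {L ρ C₁ C₂ : ℝ} {m : ℝ → ℝ} {k p r : ℝ → E}
    (h : JetBound L ρ C₁ C₂ m k p r) : ContDiff ℝ 2 k := by
  have hr : Continuous r := by
    rw [continuous_iff_continuousAt]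
    intro x
    rw [ContinuousAt, Metric.tendsto_nhds]
    intro ε hε
    have h1 : Tendsto (fun y => ε / 2 + m (ε / 2) * |y - x|) (nhds x)
        (nhds (ε / 2 + m (ε / 2) * |x - x|)) := Continuous.tendsto (by fun_prop) x
    filter_upwards [h1.eventually (gt_mem_nhds (show _ < ε by simp; linarith))] with y hy
    rw [dist_eq_norm]
    exact (h.modulus (ε / 2) (by positivity) y x).trans_lt hy
  rw [show (2 : WithTop ℕ∞) = 1 + 1 by norm_num, contDiff_succ_iff_deriv]
  refine ⟨fun θ => (h.deriv θ).differentiableAt, by simp, ?_⟩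
  rw [contDiff_one_iff_deriv]
  refine ⟨?_, by rwa [h.deriv₂_eq]⟩
  rw [h.deriv_eq]
  exact fun θ => (h.deriv₂ θ).differentiableAt

/-- The blown-up field `δ⁻¹ (-A + δ G)` at the point `q θ + δ k`, where `A` vanishes on `q`. -/
def scaledField (A G : E → E) (q : ℝ → E) (w : ℝ × ℝ × E) : E :=
  -(∫ t in (0 : ℝ)..1, fderiv ℝ A (q w.2.1 + (t * w.1) • w.2.2) w.2.2) +
    G (q w.2.1 + w.1 • w.2.2)

/-- Tangential speed assigned to the blown-up field. -/
def scaledSpeed (A G : E → E) (q : ℝ → E) (lam : ℝ) (w : ℝ × ℝ × E) : ℝ :=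
  ⟪scaledField A G q w, deriv q w.2.1⟫ + lam * ⟪w.2.2, deriv q w.2.1⟫

/-- The part of the blown-up field not accounted for by the motion of the base point. -/
def scaledRest (A G : E → E) (q : ℝ → E) (lam : ℝ) (w : ℝ × ℝ × E) : E :=
  scaledField A G q w - scaledSpeed A G q lam w • deriv q w.2.1

/-- A closed curve of zeros of `A`, of unit speed, along which `A` is transversally expanding. -/
structure EquilibriumCurve (A : E → E) (q : ℝ → E) (L lam : ℝ) : Prop where
  contDiff_field : ContDiff ℝ 3 A
  contDiff : ContDiff ℝ 3 q
  L_pos : 0 < L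
  lam_pos : 0 < lam
  periodic : Function.Periodic q L
  unit : ∀ θ, ‖deriv q θ‖ = 1
  zero : ∀ θ, A (q θ) = 0
  tangent : ∀ θ, fderiv ℝ A (q θ) (deriv q θ) = 0
  normal : ∀ θ v, ⟪fderiv ℝ A (q θ) v, deriv q θ⟫ = 0
  coercive : ∀ θ w, ⟪w, deriv q θ⟫ = 0 → lam * ‖w‖ ^ 2 ≤ ⟪fderiv ℝ A (q θ) w, w⟫

variable {A G : E → E} {q : ℝ → E} {L lam : ℝ}

theorem EquilibriumCurve.coercive' (h : EquilibriumCurve A q L lam) (θ : ℝ) (v : E) :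
    lam * ‖v‖ ^ 2 ≤ ⟪fderiv ℝ A (q θ) v, v⟫ + lam * ⟪v, deriv q θ⟫ ^ 2 := by
  set τ := deriv q θ with hτ
  set c := ⟪v, τ⟫ with hc
  set w := v - c • τ with hw
  have hττ : ⟪τ, τ⟫ = 1 := by rw [real_inner_self_eq_norm_sq, h.unit θ]; norm_num
  have hwτ : ⟪w, τ⟫ = 0 := by rw [hw, inner_sub_left, inner_smul_left, hττ]; simp [hc]
  have h1 := h.coercive θ w hwτ
  have hv : v = w + c • τ := by rw [hw]; abel
  have h2 : fderiv ℝ A (q θ) v = fderiv ℝ A (q θ) w := by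
    rw [hv, map_add, map_smul, h.tangent θ]; simp
  have h3 : ‖v‖ ^ 2 = ‖w‖ ^ 2 + c ^ 2 := by
    conv_lhs => rw [hv]
    rw [norm_add_sq_real, inner_smul_right, hwτ, norm_smul, h.unit θ]
    simp
  have h4 : ⟪fderiv ℝ A (q θ) v, v⟫ = ⟪fderiv ℝ A (q θ) w, w⟫ := by
    rw [h2]; conv_lhs => rw [hv]
    rw [inner_add_right, inner_smul_right, h.normal θ]; simp
  rw [h3, h4]; linarith

theorem EquilibriumCurve.smul_scaledField [CompleteSpace E] (h : EquilibriumCurve A q L lam)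
    (δ θ : ℝ) (k : E) :
    δ • scaledField A G q (δ, θ, k) = -A (q θ + δ • k) + δ • G (q θ + δ • k) := by
  have hA' : Continuous (fderiv ℝ A) := h.contDiff_field.continuous_fderiv (by norm_num)
  have h1 : ∫ t in (0 : ℝ)..1, δ • fderiv ℝ A (q θ + (t * δ) • k) k =
      A (q θ + (1 * δ) • k) - A (q θ + (0 * δ) • k) := by
    refine intervalIntegral.integral_eq_sub_of_hasDerivAt (f := fun t => A (q θ + (t * δ) • k))
      (fun t _ => ?_) ?_
    · have h2 : HasDerivAt (fun t : ℝ => q θ + (t * δ) • k) (δ • k) t := by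
        have := (((hasDerivAt_id t).mul_const δ).smul_const k).const_add (q θ)
        rwa [one_mul] at this
      have h3 := ((h.contDiff_field.differentiable (by norm_num))
        _).hasFDerivAt.comp_hasDerivAt t h2
      rw [map_smul] at h3
      exact h3
    · refine Continuous.intervalIntegrable ?_ _ _
      fun_prop
  rw [intervalIntegral.integral_smul] at h1
  rw [scaledField, smul_add, smul_neg, h1]
  simp [h.zero]

theorem scaledField_zero [CompleteSpace E] (θ : ℝ) (k : E) :
    scaledField A G q (0, θ, k) = -fderiv ℝ A (q θ) k + G (q θ) := by
  simp [scaledField]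

theorem EquilibriumCurve.contDiff_deriv (h : EquilibriumCurve A q L lam) :
    ContDiff ℝ 2 (deriv q) := by
  have := h.contDiff
  rw [show (3 : WithTop ℕ∞) = 2 + 1 by norm_num, contDiff_succ_iff_deriv] at this
  exact this.2.2

theorem EquilibriumCurve.contDiff_scaledField [FiniteDimensional ℝ E]
    (h : EquilibriumCurve A q L lam) (hG : ContDiff ℝ 2 G) :
    ContDiff ℝ 2 (scaledField A G q) := by
  have hA' : ContDiff ℝ 2 (fderiv ℝ A) := h.contDiff_field.fderiv_right (by norm_num)
  have hq : ContDiff ℝ 2 q := h.contDiff.of_le (by norm_num)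
  have : ProperSpace E := FiniteDimensional.proper_real E
  have h1 : ContDiff ℝ (2 : ℕ) (fun x : ℝ × ℝ × ℝ × E =>
      fderiv ℝ A (q x.2.2.1 + (x.1 * x.2.1) • x.2.2.2) x.2.2.2) := by
    norm_num
    fun_prop
  have h2 := ContDiff.parametric_intervalIntegral 2 h1 0 1
  norm_num at h2
  exact h2.neg.add (by fun_prop)

theorem EquilibriumCurve.periodic_deriv (h : EquilibriumCurve A q L lam) :
    Function.Periodic (deriv q) L := fun θ => by
  rw [← deriv_comp_add_const, funext h.periodic]

theorem EquilibriumCurve.contDiff_scaledSpeed [FiniteDimensional ℝ E]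
    (h : EquilibriumCurve A q L lam) (hG : ContDiff ℝ 2 G) :
    ContDiff ℝ 2 (scaledSpeed A G q lam) := by
  have h1 := h.contDiff_scaledField hG
  have h2 := h.contDiff_deriv
  have h3 : ContDiff ℝ 2 fun w : ℝ × ℝ × E => deriv q w.2.1 := by fun_prop
  exact (h1.inner ℝ h3).add (contDiff_const.mul (contDiff_snd.snd.inner ℝ h3))

theorem EquilibriumCurve.contDiff_scaledRest [FiniteDimensional ℝ E]
    (h : EquilibriumCurve A q L lam) (hG : ContDiff ℝ 2 G) :
    ContDiff ℝ 2 (scaledRest A G q lam) := by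
  have h2 := h.contDiff_deriv
  have h3 : ContDiff ℝ 2 fun w : ℝ × ℝ × E => deriv q w.2.1 := by fun_prop
  exact (h.contDiff_scaledField hG).sub ((h.contDiff_scaledSpeed hG).smul h3)

theorem EquilibriumCurve.periodic_scaledField (h : EquilibriumCurve A q L lam) :
    Function.Periodic (scaledField A G q) (0, L, 0) := fun w => by
  simp [scaledField, h.periodic w.2.1]

theorem EquilibriumCurve.periodic_scaledSpeed (h : EquilibriumCurve A q L lam) :
    Function.Periodic (scaledSpeed A G q lam) (0, L, 0) := fun w => by
  simp [scaledSpeed, h.periodic_scaledField w, h.periodic_deriv w.2.1]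

theorem EquilibriumCurve.periodic_scaledRest (h : EquilibriumCurve A q L lam) :
    Function.Periodic (scaledRest A G q lam) (0, L, 0) := fun w => by
  simp [scaledRest, h.periodic_scaledField w, h.periodic_scaledSpeed w, h.periodic_deriv w.2.1]

theorem EquilibriumCurve.inner_fderiv_scaledRest_le [FiniteDimensional ℝ E]
    (h : EquilibriumCurve A q L lam) (hG : ContDiff ℝ 2 G) (θ : ℝ) (z v : E) :
    ⟪fderiv ℝ (scaledRest A G q lam) (0, θ, z) (0, 0, v), v⟫ ≤ -lam * ‖v‖ ^ 2 := by
  have : CompleteSpace E := FiniteDimensional.complete ℝ E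
  have h1 : HasDerivAt (fun t : ℝ => ((0, θ, z + t • v) : ℝ × ℝ × E)) (0, 0, v) 0 := by
    have := ((hasDerivAt_id (0 : ℝ)).smul_const v).const_add z
    rw [one_smul] at this
    exact (hasDerivAt_const _ _).prodMk ((hasDerivAt_const _ _).prodMk this)
  have h2 : HasFDerivAt (scaledRest A G q lam)
      (fderiv ℝ (scaledRest A G q lam) (0, θ, z)) (0, θ, z + (0 : ℝ) • v) := by
    rw [zero_smul, add_zero]
    exact ((h.contDiff_scaledRest hG).differentiable (by norm_num) _).hasFDerivAt
  have h3 := h2.comp_hasDerivAt (0 : ℝ) h1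
  have h4 : (scaledRest A G q lam ∘ fun t : ℝ => ((0, θ, z + t • v) : ℝ × ℝ × E)) =
      fun t => scaledRest A G q lam (0, θ, z) +
        t • (-fderiv ℝ A (q θ) v - (lam * ⟪v, deriv q θ⟫) • deriv q θ) := by
    funext t
    simp only [Function.comp, scaledRest, scaledSpeed, scaledField_zero, map_add, map_smul,
      inner_add_left, inner_neg_left, inner_smul_left, h.normal]
    simp only [conj_trivial]
    module
  rw [h4] at h3
  have h5 : HasDerivAt (fun t : ℝ => scaledRest A G q lam (0, θ, z) +
        t • (-fderiv ℝ A (q θ) v - (lam * ⟪v, deriv q θ⟫) • deriv q θ))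
      (-fderiv ℝ A (q θ) v - (lam * ⟪v, deriv q θ⟫) • deriv q θ) 0 := by
    have := ((hasDerivAt_id (0 : ℝ)).smul_const
      (-fderiv ℝ A (q θ) v - (lam * ⟪v, deriv q θ⟫) • deriv q θ)).const_add
        (scaledRest A G q lam (0, θ, z))
    rwa [one_smul] at this
  rw [h3.unique h5, inner_sub_left, inner_neg_left, inner_smul_left, real_inner_comm v (deriv q θ)]
  have := h.coercive' θ v
  simp only [conj_trivial]
  nlinarith

/-- Persistence of an equilibrium curve, in blown-up coordinates. -/
theorem EquilibriumCurve.exists_scaled_invariant_curve [FiniteDimensional ℝ E]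
    (h : EquilibriumCurve A q L lam) (hG : ContDiff ℝ 2 G) :
    ∃ δ₀ > 0, δ₀ ≤ (1 : ℝ) ∧ ∃ C ≥ 0, ∀ δ, 0 < δ → δ ≤ δ₀ → ∃ k : ℝ → E,
      ContDiff ℝ 2 k ∧ Function.Periodic k L ∧
      (∀ θ, ‖k θ‖ ≤ C ∧ ‖deriv k θ‖ ≤ C ∧ ‖deriv (deriv k) θ‖ ≤ C) ∧
      ∃ σ : ℝ → ℝ, ∀ θ, -A (q θ + δ • k θ) + δ • G (q θ + δ • k θ) =
        σ θ • (deriv q θ + δ • deriv k θ) := by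
  have : ProperSpace E := FiniteDimensional.proper_real E
  have : CompleteSpace E := FiniteDimensional.complete ℝ E
  have hμ : 0 < lam / 3 := by have := h.lam_pos; positivity
  obtain ⟨B₀, hB₀, m₀, -, h0⟩ :=
    exists_tubeBound (h.contDiff_scaledRest hG) h.L_pos h.periodic_scaledRest 0
  set ρ := B₀ / (lam / 3) with hρdef
  have hρ : 0 ≤ ρ := by positivity
  obtain ⟨B₁, hB₁, m₁, hm₁, h1⟩ :=
    exists_tubeBound (h.contDiff_scaledRest hG) h.L_pos h.periodic_scaledRest ρ
  obtain ⟨B₂, hB₂, m₂, hm₂, h2⟩ :=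
    exists_tubeBound (h.contDiff_scaledSpeed hG) h.L_pos h.periodic_scaledSpeed ρ
  obtain ⟨δ₀, hδ₀, hδ₁, C₁, C₂, m, -, main⟩ := exists_invariant_graph_family (L := L)
    (h1.mono (B' := B₁ + B₂ + 1) (by linarith) (fun ε => le_max_left (m₁ ε) (m₂ ε)))
    (h2.mono (B' := B₁ + B₂ + 1) (by linarith) (fun ε => le_max_right (m₁ ε) (m₂ ε)))
    (fun ε hε => (hm₁ ε hε).trans (le_max_left _ _))
    (fun d θ z => by simpa using h.periodic_scaledRest (G := G) (d, θ, z))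
    (fun d θ z => by simpa using h.periodic_scaledSpeed (G := G) (d, θ, z))
    (by linarith) hμ hρ
    (fun θ z v _ => (h.inner_fderiv_scaledRest_le hG θ z v).trans (le_of_eq (by ring)))
    (fun δ hδ θ => by
      rw [hρdef, mul_div_cancel₀ _ hμ.ne']
      exact h0.norm_le (δ, θ, 0) ⟨hδ, by simp⟩)
  refine ⟨δ₀, hδ₀, hδ₁, max ρ (max C₁ C₂), hρ.trans (le_max_left _ _), fun δ hd0 hd1 => ?_⟩
  obtain ⟨k, p, r, J, hk⟩ := main δ hd0 hd1
  refine ⟨k, J.contDiff, J.periodic, fun θ => ?_,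
    fun θ => δ * scaledSpeed A G q lam (graphLift δ k θ), fun θ => ?_⟩
  · rw [J.deriv₂_eq, J.deriv_eq]
    exact ⟨(J.norm_le θ).trans (le_max_left _ _),
      (J.deriv_le θ).trans ((le_max_left _ _).trans (le_max_right _ _)),
      (J.deriv₂_le θ).trans ((le_max_right _ _).trans (le_max_right _ _))⟩
  · rw [← h.smul_scaledField, J.deriv_eq]
    have h3 := hk θ
    rw [scaledRest, eq_sub_iff_add_eq] at h3
    change δ • scaledField A G q (graphLift δ k θ) = _
    rw [← h3]
    simp only [graphLift]
    module

end ScaledField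

section Reparametrization

set_option maxSynthPendingDepth 3

universe u

theorem exists_contDiff_zero_near_diagonal {g : ℝ × ℝ → ℝ} (hg : ContDiff ℝ 2 g) {ε r L : ℝ}
    (hε : 0 ≤ ε) (hr : 2 * ε < r) (hdiag : ∀ θ, |g (θ, θ)| ≤ ε)
    (hd : ∀ θ x, |x - θ| ≤ r → 1 / 2 ≤ fderiv ℝ g (θ, x) (0, 1))
    (hper : ∀ θ x, g (θ + L, x + L) = g (θ, x)) :
    ∃ Θ : ℝ → ℝ, ContDiff ℝ 2 Θ ∧
      ∀ θ, Θ (θ + L) = Θ θ + L ∧ |Θ θ - θ| ≤ 2 * ε ∧ g (θ, Θ θ) = 0 := by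
  have hgd : Differentiable ℝ g := hg.differentiable (by norm_num)
  have hderiv : ∀ θ x, HasDerivAt (fun x => g (θ, x)) (fderiv ℝ g (θ, x) (0, 1)) x := fun θ x =>
    (hgd (θ, x)).hasFDerivAt.comp_hasDerivAt x ((hasDerivAt_const x θ).prodMk (hasDerivAt_id x))
  have hcont : ∀ θ, Continuous fun x => g (θ, x) := fun θ =>
    hg.continuous.comp (Continuous.prodMk_right θ)
  have mem_iff : ∀ θ x : ℝ, x ∈ Icc (θ - r) (θ + r) ↔ |x - θ| ≤ r := fun θ x => by
    rw [mem_Icc, abs_le]; constructor <;> rintro ⟨h1, h2⟩ <;> constructor <;> linarith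
  have hgrow : ∀ θ, ∀ x ∈ Icc (θ - r) (θ + r), ∀ y ∈ Icc (θ - r) (θ + r), x ≤ y →
      1 / 2 * (y - x) ≤ g (θ, y) - g (θ, x) := fun θ =>
    (convex_Icc _ _).mul_sub_le_image_sub_of_le_deriv (hcont θ).continuousOn
      (fun x _ => (hderiv θ x).differentiableAt.differentiableWithinAt) fun x hx => by
        rw [(hderiv θ x).deriv]
        exact hd θ x ((mem_iff θ x).1 (interior_subset hx))
  have huniq : ∀ θ x y, |x - θ| ≤ r → |y - θ| ≤ r → g (θ, x) = 0 → g (θ, y) = 0 → x = y := by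
    intro θ x y hx hy h1 h2
    rcases le_total x y with h | h
    · have := hgrow θ x ((mem_iff θ x).2 hx) y ((mem_iff θ y).2 hy) h
      linarith
    · have := hgrow θ y ((mem_iff θ y).2 hy) x ((mem_iff θ x).2 hx) h
      linarith
  have hex : ∀ θ, ∃ x, |x - θ| ≤ 2 * ε ∧ g (θ, x) = 0 := by
    intro θ
    have h0 := abs_le.1 (hdiag θ)
    have m0 : θ ∈ Icc (θ - r) (θ + r) := ⟨by linarith, by linarith⟩
    have m1 : θ - 2 * ε ∈ Icc (θ - r) (θ + r) := ⟨by linarith, by linarith⟩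
    have m2 : θ + 2 * ε ∈ Icc (θ - r) (θ + r) := ⟨by linarith, by linarith⟩
    have h1 := hgrow θ _ m1 _ m0 (by linarith)
    have h2 := hgrow θ _ m0 _ m2 (by linarith)
    obtain ⟨x, hx, hx0⟩ := intermediate_value_Icc (show θ - 2 * ε ≤ θ + 2 * ε by linarith)
      (hcont θ).continuousOn (show (0 : ℝ) ∈ Icc _ _ from ⟨by linarith, by linarith⟩)
    exact ⟨x, abs_le.2 ⟨by linarith [hx.1], by linarith [hx.2]⟩, hx0⟩
  choose Θ hΘ hΘ0 using hex
  refine ⟨Θ, contDiff_iff_contDiffAt.2 fun θ => ?_, fun θ => ⟨?_, hΘ θ, hΘ0 θ⟩⟩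
  · have cdf : ContDiffAt ℝ 2 g (θ, Θ θ) := hg.contDiffAt
    have hd0 : fderiv ℝ g (θ, Θ θ) (0, 1) ≠ 0 := by
      have := hd θ (Θ θ) ((hΘ θ).trans hr.le)
      linarith
    have hinv : (fderiv ℝ g (θ, Θ θ) ∘L .inr ℝ ℝ ℝ).IsInvertible := by
      refine ContinuousLinearMap.IsInvertible.of_inverse
        (g := (fderiv ℝ g (θ, Θ θ) (0, 1))⁻¹ • ContinuousLinearMap.id ℝ ℝ) ?_ ?_ <;>
      · ext
        simp [hd0]
    set ψ := cdf.implicitFunction two_ne_zero hinv with hψ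
    have hψs : ContDiffAt ℝ 2 ψ θ := cdf.contDiffAt_implicitFunction two_ne_zero hinv
    have hψθ : ψ θ = Θ θ := cdf.implicitFunction_apply_self two_ne_zero hinv
    have hev : ∀ᶠ x in nhds θ, |ψ x - x| < r := by
      have : ContinuousAt (fun x => |ψ x - x|) θ := (hψs.continuousAt.sub continuousAt_id).abs
      refine this.eventually_lt continuousAt_const ?_
      rw [hψθ]
      exact (hΘ θ).trans_lt hr
    refine hψs.congr_of_eventuallyEq ?_
    filter_upwards [hev, cdf.eventually_apply_implicitFunction two_ne_zero hinv] with x hx hx0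
    exact huniq x _ _ ((hΘ x).trans hr.le) hx.le (hΘ0 x) (hx0.trans (hΘ0 θ))
  · refine huniq (θ + L) _ _ ((hΘ _).trans hr.le) ?_ (hΘ0 _) ((hper _ _).trans (hΘ0 θ))
    rw [add_sub_add_right_eq_sub]
    exact (hΘ θ).trans hr.le

variable {E : Type u} [NormedAddCommGroup E] [InnerProductSpace ℝ E]

/-- A curve `q + j` that is `C²`-close to `q` is a normal graph over `q`, up to
reparametrization. -/
theorem exists_normal_reparametrization {q j : ℝ → E} {L D ε : ℝ} (hq : ContDiff ℝ 3 q)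
    (hqper : Function.Periodic q L) (hunit : ∀ θ, ‖deriv q θ‖ = 1) (hD : 1 ≤ D)
    (hq₂ : ∀ θ, ‖deriv (deriv q) θ‖ ≤ D) (hq₃ : ∀ θ, ‖deriv (deriv (deriv q)) θ‖ ≤ D)
    (hj : ContDiff ℝ 2 j) (hjper : Function.Periodic j L) (hj₀ : ∀ θ, ‖j θ‖ ≤ ε)
    (hj₁ : ∀ θ, ‖deriv j θ‖ ≤ ε) (hj₂ : ∀ θ, ‖deriv (deriv j) θ‖ ≤ ε) (hε : 16 * D * ε ≤ 1) :
    ∃ (Θ : ℝ → ℝ) (Φ : ℝ → E), ContDiff ℝ 2 Θ ∧ ContDiff ℝ 2 Φ ∧ Function.Periodic Φ L ∧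
      ∀ θ, q θ + Φ θ = q (Θ θ) + j (Θ θ) ∧ deriv Θ θ ≠ 0 ∧ ⟪Φ θ, deriv q θ⟫ = 0 ∧
        ‖Φ θ‖ ≤ 400 * D ^ 2 * ε ∧ ‖deriv Φ θ‖ ≤ 400 * D ^ 2 * ε ∧
        ‖deriv (deriv Φ) θ‖ ≤ 400 * D ^ 2 * ε := by
  have hε0 : 0 ≤ ε := (norm_nonneg _).trans (hj₀ 0)
  have hDε : ε ≤ D * ε := le_mul_of_one_le_left hε0 hD
  have hDDε : D * ε ≤ D ^ 2 * ε := by nlinarith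
  have cq₁ : ContDiff ℝ 2 (deriv q) := by
    rw [show (3 : WithTop ℕ∞) = 2 + 1 by norm_num, contDiff_succ_iff_deriv] at hq
    exact hq.2.2
  have cq₂ : ContDiff ℝ 1 (deriv (deriv q)) := by
    rw [show (2 : WithTop ℕ∞) = 1 + 1 by norm_num, contDiff_succ_iff_deriv] at cq₁
    exact cq₁.2.2
  have cj₁ : ContDiff ℝ 1 (deriv j) := by
    rw [show (2 : WithTop ℕ∞) = 1 + 1 by norm_num, contDiff_succ_iff_deriv] at hj
    exact hj.2.2
  have dq : ∀ x, HasDerivAt q (deriv q x) x := fun x =>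
    (hq.differentiable (by norm_num) x).hasDerivAt
  have dq₁ : ∀ x, HasDerivAt (deriv q) (deriv (deriv q) x) x := fun x =>
    (cq₁.differentiable (by norm_num) x).hasDerivAt
  have dq₂ : ∀ x, HasDerivAt (deriv (deriv q)) (deriv (deriv (deriv q)) x) x := fun x =>
    (cq₂.differentiable (by norm_num) x).hasDerivAt
  have dj : ∀ x, HasDerivAt j (deriv j x) x := fun x =>
    (hj.differentiable (by norm_num) x).hasDerivAt
  have dj₁ : ∀ x, HasDerivAt (deriv j) (deriv (deriv j) x) x := fun x =>
    (cj₁.differentiable (by norm_num) x).hasDerivAt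
  have lip : ∀ {f : ℝ → E} {c : ℝ} (_ : Differentiable ℝ f) (_ : ∀ x, ‖deriv f x‖ ≤ c) (x y : ℝ),
      ‖f y - f x‖ ≤ c * |y - x| := fun hf hc x y =>
    convex_univ.norm_image_sub_le_of_norm_deriv_le (fun x _ => hf x) (fun x _ => hc x)
      (mem_univ x) (mem_univ y)
  have lq := lip (hq.differentiable (by norm_num)) fun x => (hunit x).le
  have lq₁ := lip (cq₁.differentiable (by norm_num)) hq₂
  have lq₂ := lip (cq₂.differentiable (by norm_num)) hq₃
  have unit_inner : ∀ θ, ⟪deriv q θ, deriv q θ⟫ = 1 := fun θ => by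
    rw [real_inner_self_eq_norm_sq, hunit θ, one_pow]
  have inner_q₁₂ : ∀ θ, ⟪deriv (deriv q) θ, deriv q θ⟫ = 0 := fun θ => by
    have h1 := (dq₁ θ).inner ℝ (dq₁ θ)
    rw [funext unit_inner] at h1
    have h2 := h1.unique (hasDerivAt_const θ (1 : ℝ))
    rw [real_inner_comm] at h2
    linarith
  have abs_inner_unit : ∀ (x : E) θ, |⟪x, deriv q θ⟫| ≤ ‖x‖ := fun x θ => by
    simpa [hunit θ] using abs_real_inner_le_norm x (deriv q θ)
  have dg : ∀ θ x, HasDerivAt (fun x => ⟪q x + j x - q θ, deriv q θ⟫)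
      ⟪deriv q x + deriv j x, deriv q θ⟫ x := fun θ x => by
    simpa using (((dq x).add (dj x)).sub_const (q θ)).inner ℝ (hasDerivAt_const x (deriv q θ))
  have speed : ∀ θ x, |⟪deriv q x + deriv j x, deriv q θ⟫ - 1| ≤ D * |x - θ| + ε := fun θ x => by
    rw [← unit_inner θ, ← inner_sub_left]
    refine (abs_inner_unit _ θ).trans ?_
    rw [add_sub_right_comm]
    exact (norm_add_le _ _).trans (add_le_add (lq₁ θ x) (hj₁ x))
  have cg : ContDiff ℝ 2 fun w : ℝ × ℝ => ⟪q w.2 + j w.2 - q w.1, deriv q w.1⟫ := by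
    have : ContDiff ℝ 2 q := hq.of_le (by norm_num)
    exact (((this.comp contDiff_snd).add (hj.comp contDiff_snd)).sub
      (this.comp contDiff_fst)).inner ℝ (cq₁.comp contDiff_fst)
  have hper₁ : Function.Periodic (deriv q) L := fun θ => by
    rw [← deriv_comp_add_const, funext hqper]
  obtain ⟨Θ, cΘ, hΘ⟩ := exists_contDiff_zero_near_diagonal (L := L) (r := 1 / (4 * D)) cg hε0
    (by rw [lt_div_iff₀ (by positivity)]; linarith)
    (fun θ => by simpa using (abs_inner_unit _ θ).trans (hj₀ θ))
    (fun θ x hx => by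
      have h1 := ((cg.differentiable (by norm_num)) (θ, x)).hasFDerivAt.comp_hasDerivAt x
        ((hasDerivAt_const x θ).prodMk (hasDerivAt_id x))
      rw [h1.unique (dg θ x)]
      have h2 := (abs_le.1 (speed θ x)).1
      rw [le_div_iff₀ (by positivity)] at hx
      linarith)
    (fun θ x => by simp only [hqper _, hjper _, hper₁ _])
  have dΘ : ∀ θ, HasDerivAt Θ (deriv Θ θ) θ := fun θ =>
    (cΘ.differentiable (by norm_num) θ).hasDerivAt
  have dΘ₁ : ∀ θ, HasDerivAt (deriv Θ) (deriv (deriv Θ) θ) θ := fun θ => by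
    rw [show (2 : WithTop ℕ∞) = 1 + 1 by norm_num, contDiff_succ_iff_deriv] at cΘ
    exact (cΘ.2.2.differentiable (by norm_num) θ).hasDerivAt
  set Φ : ℝ → E := fun θ => q (Θ θ) + j (Θ θ) - q θ with hΦ
  have dΦ : ∀ θ, HasDerivAt Φ
      (deriv Θ θ • (deriv q (Θ θ) + deriv j (Θ θ)) - deriv q θ) θ := fun θ => by
    rw [smul_add]
    exact (((dq (Θ θ)).scomp θ (dΘ θ)).add ((dj (Θ θ)).scomp θ (dΘ θ))).sub (dq θ)
  have eΦ : deriv Φ = fun θ => deriv Θ θ • (deriv q (Θ θ) + deriv j (Θ θ)) - deriv q θ :=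
    funext fun θ => (dΦ θ).deriv
  have dΦ₁ : ∀ θ, HasDerivAt (deriv Φ)
      (deriv Θ θ • (deriv Θ θ • (deriv (deriv q) (Θ θ) + deriv (deriv j) (Θ θ))) +
        deriv (deriv Θ) θ • (deriv q (Θ θ) + deriv j (Θ θ)) - deriv (deriv q) θ) θ := fun θ => by
    rw [eΦ, smul_add (deriv Θ θ) (deriv (deriv q) (Θ θ))]
    exact ((dΘ₁ θ).smul (((dq₁ (Θ θ)).scomp θ (dΘ θ)).add ((dj₁ (Θ θ)).scomp θ (dΘ θ)))).sub (dq₁ θ)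
  have orth : ∀ θ, ⟪Φ θ, deriv q θ⟫ = 0 := fun θ => (hΘ θ).2.2
  have orth₁ : ∀ θ, ⟪Φ θ, deriv (deriv q) θ⟫ + ⟪deriv Φ θ, deriv q θ⟫ = 0 := fun θ => by
    have h1 := (dΦ θ).inner ℝ (dq₁ θ)
    rw [← (dΦ θ).deriv, funext orth] at h1
    exact h1.unique (hasDerivAt_const θ (0 : ℝ))
  have orth₂ : ∀ θ, ⟪Φ θ, deriv (deriv (deriv q)) θ⟫ + ⟪deriv Φ θ, deriv (deriv q) θ⟫ +
      (⟪deriv Φ θ, deriv (deriv q) θ⟫ + ⟪deriv (deriv Φ) θ, deriv q θ⟫) = 0 := fun θ => by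
    have h1 := ((dΦ θ).inner ℝ (dq₂ θ)).add ((dΦ₁ θ).inner ℝ (dq₁ θ))
    rw [← (dΦ θ).deriv, ← (dΦ₁ θ).deriv] at h1
    exact (h1.congr_of_eventuallyEq (Eventually.of_forall fun x => (orth₁ x).symm)).unique
      (hasDerivAt_const θ (0 : ℝ))
  refine ⟨Θ, Φ, cΘ, ?_, fun θ => ?_, fun θ => ?_⟩
  · have : ContDiff ℝ 2 q := hq.of_le (by norm_num)
    exact ((this.comp cΘ).add (hj.comp cΘ)).sub this
  · simp only [hΦ, (hΘ θ).1, hqper _, hjper _]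
  have hη := (hΘ θ).2.1
  set c := deriv Θ θ with hc
  set c₂ := deriv (deriv Θ) θ with hc₂
  set e := deriv q θ with he
  set e₂ := deriv (deriv q) θ with he₂
  set u := deriv q (Θ θ) + deriv j (Θ θ) with hu
  set u₂ := deriv (deriv q) (Θ θ) + deriv (deriv j) (Θ θ) with hu₂
  have b₀ : ‖Φ θ‖ ≤ 3 * ε := by
    have : Φ θ = (q (Θ θ) - q θ) + j (Θ θ) := by simp only [hΦ]; abel
    rw [this]
    have := (norm_add_le (q (Θ θ) - q θ) (j (Θ θ))).trans (add_le_add (lq θ (Θ θ)) (hj₀ _))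
    linarith
  have bη : D * |Θ θ - θ| ≤ D * (2 * ε) := by gcongr
  have bu : ‖u - e‖ ≤ 3 * (D * ε) := by
    rw [hu, add_sub_right_comm]
    have := (norm_add_le (deriv q (Θ θ) - e) (deriv j (Θ θ))).trans
      (add_le_add (lq₁ θ (Θ θ)) (hj₁ _))
    linarith
  have bu₂ : ‖u₂ - e₂‖ ≤ 3 * (D * ε) := by
    rw [hu₂, add_sub_right_comm]
    have := (norm_add_le (deriv (deriv q) (Θ θ) - e₂) (deriv (deriv j) (Θ θ))).trans
      (add_le_add (lq₂ θ (Θ θ)) (hj₂ _))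
    linarith
  have nu : ‖u‖ ≤ 2 := by
    have := norm_le_norm_add_norm_sub' u e
    rw [hunit θ] at this
    linarith
  have nu₂ : ‖u₂‖ ≤ 2 * D := by
    have := norm_le_norm_add_norm_sub' u₂ e₂
    have := hq₂ θ
    linarith
  have iu := (abs_inner_unit (u - e) θ).trans bu
  rw [inner_sub_left, unit_inner] at iu
  have iu' : 1 / 2 ≤ ⟪u, e⟫ := by linarith [(abs_le.1 iu).1]
  have iu₂ := (abs_inner_unit (u₂ - e₂) θ).trans bu₂
  rw [inner_sub_left, inner_q₁₂, sub_zero] at iu₂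
  have half_le : ∀ x, |x| ≤ 2 * |x * ⟪u, e⟫| := fun x => by
    rw [abs_mul, abs_of_nonneg (by linarith : 0 ≤ ⟪u, e⟫)]
    nlinarith [abs_nonneg x]
  have i₁ : |⟪Φ θ, e₂⟫| ≤ 3 * (D * ε) := by
    refine (abs_real_inner_le_norm _ _).trans ?_
    calc ‖Φ θ‖ * ‖e₂‖ ≤ 3 * ε * D := by gcongr; exact hq₂ θ
      _ = _ := by ring
  have bc : |c - 1| ≤ 12 * (D * ε) := by
    have h0 : ⟪deriv Φ θ, e⟫ = c * ⟪u, e⟫ - 1 := by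
      rw [(dΦ θ).deriv, inner_sub_left, real_inner_smul_left, unit_inner]
    have h1 := orth₁ θ
    rw [h0] at h1
    have h2 : (c - 1) * ⟪u, e⟫ = -(⟪u, e⟫ - 1) - ⟪Φ θ, e₂⟫ := by linear_combination h1
    have h3 := half_le (c - 1)
    rw [h2] at h3
    have h4 := abs_sub (-(⟪u, e⟫ - 1)) ⟪Φ θ, e₂⟫
    rw [abs_neg] at h4
    linarith
  have bc' : |c| ≤ 2 := by
    have := abs_le.1 bc
    exact abs_le.2 ⟨by linarith, by linarith⟩
  have b₁ : ‖deriv Φ θ‖ ≤ 27 * (D * ε) := by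
    have : deriv Φ θ = (c - 1) • u + (u - e) := by rw [(dΦ θ).deriv]; module
    rw [this]
    refine (norm_add_le _ _).trans ?_
    rw [norm_smul, Real.norm_eq_abs]
    have : |c - 1| * ‖u‖ ≤ 12 * (D * ε) * 2 := by gcongr
    linarith
  have i₂ : |⟪deriv Φ θ, e₂⟫| ≤ 27 * (D ^ 2 * ε) := by
    refine (abs_real_inner_le_norm _ _).trans ?_
    calc ‖deriv Φ θ‖ * ‖e₂‖ ≤ 27 * (D * ε) * D := by gcongr; exact hq₂ θ
      _ = _ := by ring
  have i₃ : |⟪Φ θ, deriv (deriv (deriv q)) θ⟫| ≤ 3 * (D * ε) := by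
    refine (abs_real_inner_le_norm _ _).trans ?_
    calc ‖Φ θ‖ * ‖deriv (deriv (deriv q)) θ‖ ≤ 3 * ε * D := by gcongr; exact hq₃ θ
      _ = _ := by ring
  have bcc : |c * c| ≤ 4 := by
    rw [abs_mul]
    nlinarith [abs_nonneg c]
  have bc₂ : |c₂| ≤ 138 * (D ^ 2 * ε) := by
    have h0 : ⟪deriv (deriv Φ) θ, e⟫ = c * (c * ⟪u₂, e⟫) + c₂ * ⟪u, e⟫ - 0 := by
      rw [(dΦ₁ θ).deriv, inner_sub_left, inner_add_left, real_inner_smul_left,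
        real_inner_smul_left, real_inner_smul_left, inner_q₁₂]
    have h1 := orth₂ θ
    rw [h0] at h1
    have h2 : c₂ * ⟪u, e⟫ = -(c * c * ⟪u₂, e⟫) - (2 * ⟪deriv Φ θ, e₂⟫ +
        ⟪Φ θ, deriv (deriv (deriv q)) θ⟫) := by linear_combination h1
    have h3 := half_le c₂
    rw [h2] at h3
    have h4 := abs_sub (-(c * c * ⟪u₂, e⟫)) (2 * ⟪deriv Φ θ, e₂⟫ +
        ⟪Φ θ, deriv (deriv (deriv q)) θ⟫)
    have h5 := abs_add_le (2 * ⟪deriv Φ θ, e₂⟫) ⟪Φ θ, deriv (deriv (deriv q)) θ⟫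
    rw [abs_neg, abs_mul] at h4
    rw [abs_mul, abs_two] at h5
    have h6 : |c * c| * |⟪u₂, e⟫| ≤ 4 * (3 * (D * ε)) := by gcongr
    linarith
  have b₂ : ‖deriv (deriv Φ) θ‖ ≤ 351 * (D ^ 2 * ε) := by
    have : deriv (deriv Φ) θ = c₂ • u + ((c - 1) * (c + 1)) • u₂ + (u₂ - e₂) := by
      rw [(dΦ₁ θ).deriv]; module
    rw [this]
    refine (norm_add₃_le).trans ?_
    rw [norm_smul, norm_smul, Real.norm_eq_abs, Real.norm_eq_abs, abs_mul]
    have h1 : |c₂| * ‖u‖ ≤ 138 * (D ^ 2 * ε) * 2 := by gcongr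
    have h2 : |c + 1| ≤ 3 := by
      have := abs_add_le c 1
      rw [abs_one] at this
      linarith
    have h3 : |c - 1| * |c + 1| * ‖u₂‖ ≤ 12 * (D * ε) * 3 * (2 * D) := by gcongr
    linarith
  refine ⟨by simp only [hΦ]; abel, ?_, orth θ, by linarith, by linarith, by linarith⟩
  intro h0
  rw [h0] at bc
  norm_num at bc
  linarith

end Reparametrization

section GlobalSolution

set_option maxSynthPendingDepth 3

universe u

variable {X : Type u} [NormedAddCommGroup X] [NormedSpace ℝ X]

theorem norm_integral_le_mul_cosh {f : ℝ → X} {C K : ℝ} (hK : 0 < K) (hC : 0 ≤ C)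
    (h : ∀ s, ‖f s‖ ≤ C * Real.cosh (K * s)) (t : ℝ) :
    ‖∫ s in (0 : ℝ)..t, f s‖ ≤ C / K * Real.cosh (K * t) := by
  have hc : Continuous fun s => C * Real.cosh (K * s) := by fun_prop
  have h1 : ∫ s in (0 : ℝ)..t, C * Real.cosh (K * s) = C / K * Real.sinh (K * t) := by
    have : ∀ s ∈ uIcc 0 t, HasDerivAt (fun s => C / K * Real.sinh (K * s))
        (C * Real.cosh (K * s)) s := fun s _ => by
      have := ((Real.hasDerivAt_sinh (K * s)).comp s ((hasDerivAt_id s).const_mul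
        K)).const_mul (C / K)
      rwa [show C / K * (Real.cosh (K * s) * (K * 1)) = C * Real.cosh (K * s) by field_simp] at this
    rw [intervalIntegral.integral_eq_sub_of_hasDerivAt this (hc.intervalIntegrable _ _)]
    simp
  refine (intervalIntegral.norm_integral_le_abs_of_norm_le
    (ae_of_all _ fun s => h s) (hc.intervalIntegrable _ _)).trans ?_
  rw [h1, abs_mul, abs_of_nonneg (by positivity : 0 ≤ C / K)]
  gcongr
  rw [abs_le]
  have h2 := Real.cosh_sq (K * t)
  have h3 := Real.cosh_pos (K * t)
  constructor <;> nlinarith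

/-- A continuous, globally Lipschitz, time-dependent vector field has global solutions. -/
theorem exists_forall_hasDerivAt_of_lipschitz [CompleteSpace X] {v : ℝ → X → X}
    (hv : Continuous (Function.uncurry v)) {K M : ℝ} (hK : 0 < K)
    (hlip : ∀ t x y, ‖v t x - v t y‖ ≤ K * ‖x - y‖) (x₀ : X)
    (hM : ∀ t, ‖v t x₀‖ ≤ M) :
    ∃ x : ℝ → X, x 0 = x₀ ∧ ∀ t, HasDerivAt x (v t (x t)) t := by
  have hM0 : 0 ≤ M := (norm_nonneg _).trans (hM 0)
  set w : ℝ → ℝ := fun t => Real.cosh (2 * K * t) with hw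
  have cw : Continuous w := by simp only [hw]; fun_prop
  have w_one : ∀ t, 1 ≤ w t := fun t => Real.one_le_cosh _
  have w_pos : ∀ t, 0 < w t := fun t => Real.cosh_pos _
  let lift : BoundedContinuousFunction ℝ X → ℝ → X := fun z t => x₀ + w t • z t
  have clift : ∀ z, Continuous fun t => v t (lift z t) := fun z =>
    hv.comp (continuous_id.prodMk (continuous_const.add (cw.smul z.continuous)))
  have hbound : ∀ (z : BoundedContinuousFunction ℝ X) t,
      ‖v t (lift z t)‖ ≤ (M + K * ‖z‖) * w t := fun z t => by
    have h1 := hlip t (lift z t) x₀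
    have h2 : ‖lift z t - x₀‖ ≤ w t * ‖z‖ := by
      simp only [lift, add_sub_cancel_left, norm_smul, Real.norm_eq_abs, abs_of_pos (w_pos t)]
      have := (w_pos t).le
      gcongr
      exact z.norm_coe_le_norm t
    have h3 : K * ‖lift z t - x₀‖ ≤ K * (w t * ‖z‖) := by gcongr
    have h4 := norm_le_norm_add_norm_sub' (v t (lift z t)) (v t x₀)
    have h5 : M * 1 ≤ M * w t := by gcongr; exact w_one t
    linarith [hM t]
  let T : BoundedContinuousFunction ℝ X → BoundedContinuousFunction ℝ X := fun z =>
    BoundedContinuousFunction.ofNormedAddCommGroup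
      (fun t => (w t)⁻¹ • ∫ s in (0 : ℝ)..t, v s (lift z s))
      ((cw.inv₀ fun t => (w_pos t).ne').smul
        (intervalIntegral.continuous_primitive (fun a b => (clift z).intervalIntegrable a b) 0))
      ((M + K * ‖z‖) / (2 * K)) fun t => by
        have := norm_integral_le_mul_cosh (by positivity : 0 < 2 * K) (by positivity) (hbound z) t
        rw [norm_smul, norm_inv, Real.norm_eq_abs, abs_of_pos (w_pos t), inv_mul_le_iff₀ (w_pos t)]
        linarith
  have hT : ContractingWith (1 / 2) T := by
    refine ⟨by norm_num, LipschitzWith.of_dist_le_mul fun z₁ z₂ => ?_⟩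
    rw [BoundedContinuousFunction.dist_le (by positivity)]
    intro t
    have hs : ∀ s, ‖v s (lift z₁ s) - v s (lift z₂ s)‖ ≤ K * dist z₁ z₂ * w s := fun s => by
      refine (hlip s _ _).trans ?_
      rw [mul_assoc]
      gcongr
      simp only [lift, add_sub_add_left_eq_sub, ← smul_sub, norm_smul, Real.norm_eq_abs,
        abs_of_pos (w_pos s)]
      rw [mul_comm, ← dist_eq_norm]
      have := (w_pos s).le
      gcongr
      exact BoundedContinuousFunction.dist_coe_le_dist s
    have h1 := norm_integral_le_mul_cosh (by positivity : 0 < 2 * K) (by positivity) hs t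
    rw [intervalIntegral.integral_sub ((clift z₁).intervalIntegrable _ _)
      ((clift z₂).intervalIntegrable _ _)] at h1
    simp only [T, BoundedContinuousFunction.coe_ofNormedAddCommGroup]
    rw [dist_eq_norm, ← smul_sub, norm_smul, norm_inv, Real.norm_eq_abs, abs_of_pos (w_pos t),
      inv_mul_le_iff₀ (w_pos t)]
    refine h1.trans (le_of_eq ?_)
    simp only [hw]
    push_cast
    field_simp
  set z := hT.fixedPoint T with hz
  have hfix : ∀ t, lift z t = x₀ + ∫ s in (0 : ℝ)..t, v s (lift z s) := fun t => by
    have h1 : T z t = z t := by rw [hz, hT.fixedPoint_isFixedPt]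
    simp only [T, BoundedContinuousFunction.coe_ofNormedAddCommGroup] at h1
    conv_lhs => simp only [lift]
    rw [← h1, smul_inv_smul₀ (w_pos t).ne']
  refine ⟨lift z, by rw [hfix]; simp, fun t => ?_⟩
  have := (intervalIntegral.integral_hasDerivAt_right ((clift z).intervalIntegrable 0 t)
    (clift z).aestronglyMeasurable.stronglyMeasurableAtFilter (clift z).continuousAt).const_add x₀
  rwa [← funext hfix] at this

end GlobalSolution

section InvariantCurve

set_option maxSynthPendingDepth 3

universe u

variable {E : Type u} [NormedAddCommGroup E] [InnerProductSpace ℝ E]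

/-- A simple closed curve invariant under the flow of `F`, traversed at speed `s`, whose normal
directions are contracted at rate `μ` and whose tangent direction is stretched at rate at most
`κ`. -/
structure AttractingCurve (F : E → E) (K : ℝ → E) (s : ℝ → ℝ) (L κ μ : ℝ) : Prop where
  contDiff_field : ContDiff ℝ 1 F
  contDiff : ContDiff ℝ 2 K
  contDiff_speed : ContDiff ℝ 1 s
  L_pos : 0 < L
  periodic : Function.Periodic K L
  inj : ∀ θ₁ θ₂, K θ₁ = K θ₂ → ∃ k : ℤ, θ₂ - θ₁ = k * L
  half_le_norm_deriv : ∀ θ, 1 / 2 ≤ ‖deriv K θ‖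
  norm_deriv_le : ∀ θ, ‖deriv K θ‖ ≤ 2
  field_eq : ∀ θ, F (K θ) = s θ • deriv K θ
  deriv_speed_le : ∀ θ, |deriv s θ| ≤ κ
  normal : ∀ θ v, ⟪v, deriv K θ⟫ = 0 → ⟪fderiv ℝ F (K θ) v, v⟫ ≤ -μ * ‖v‖ ^ 2

namespace AttractingCurve

variable {F : E → E} {K : ℝ → E} {s : ℝ → ℝ} {L κ μ : ℝ}

theorem hasDerivAt (h : AttractingCurve F K s L κ μ) (θ : ℝ) : HasDerivAt K (deriv K θ) θ :=
  (h.contDiff.differentiable (by norm_num) θ).hasDerivAt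

theorem hasDerivAt_deriv (h : AttractingCurve F K s L κ μ) (θ : ℝ) :
    HasDerivAt (deriv K) (deriv (deriv K) θ) θ := by
  have := h.contDiff
  rw [show (2 : WithTop ℕ∞) = 1 + 1 by norm_num, contDiff_succ_iff_deriv] at this
  exact (this.2.2.differentiable (by norm_num) θ).hasDerivAt

theorem deriv_ne_zero (h : AttractingCurve F K s L κ μ) (θ : ℝ) : deriv K θ ≠ 0 := by
  have := h.half_le_norm_deriv θ
  exact norm_pos_iff.1 (by linarith)

theorem fderiv_tangent (h : AttractingCurve F K s L κ μ) (θ : ℝ) :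
    fderiv ℝ F (K θ) (deriv K θ) = s θ • deriv (deriv K) θ + deriv s θ • deriv K θ := by
  have h1 := (h.contDiff_field.differentiable (by norm_num) (K θ)).hasFDerivAt.comp_hasDerivAt θ
    (h.hasDerivAt θ)
  have h2 := (h.contDiff_speed.differentiable (by norm_num) θ).hasDerivAt.smul
    (h.hasDerivAt_deriv θ)
  exact h1.unique (h2.congr_of_eventuallyEq (Eventually.of_forall h.field_eq))

theorem deriv_eq_of_eq (h : AttractingCurve F K s L κ μ) {θ₁ θ₂ : ℝ} (he : K θ₁ = K θ₂) :
    deriv K θ₁ = deriv K θ₂ := by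
  have hper : Function.Periodic (deriv K) L := fun θ => by
    rw [← deriv_comp_add_const, funext h.periodic]
  obtain ⟨k, hk⟩ := h.inj θ₁ θ₂ he
  rw [show θ₂ = θ₁ + k * L by linarith, hper.int_mul k θ₁]

theorem exists_phase (h : AttractingCurve F K s L κ μ) (θ₀ : ℝ) :
    ∃ Θ : ℝ → ℝ, Θ 0 = θ₀ ∧ ∀ t, HasDerivAt Θ (s (Θ t)) t := by
  have hκ : 0 ≤ κ := (abs_nonneg _).trans (h.deriv_speed_le 0)
  refine exists_forall_hasDerivAt_of_lipschitz (v := fun _ θ => s θ) (K := κ + 1)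
    (h.contDiff_speed.continuous.comp continuous_snd) (by positivity) (fun _ x y => ?_) θ₀
    fun _ => le_rfl
  refine (convex_univ.norm_image_sub_le_of_norm_deriv_le
    (fun x _ => h.contDiff_speed.differentiable (by norm_num) x)
    (fun x _ => h.deriv_speed_le x) (mem_univ y) (mem_univ x)).trans ?_
  gcongr
  linarith

theorem continuous_fderiv (h : AttractingCurve F K s L κ μ) :
    Continuous fun θ => fderiv ℝ F (K θ) :=
  (h.contDiff_field.continuous_fderiv (by norm_num)).comp h.contDiff.continuous

theorem exists_norm_fderiv_le (h : AttractingCurve F K s L κ μ) :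
    ∃ B > 0, ∀ θ, ‖fderiv ℝ F (K θ)‖ ≤ B := by
  have hper : Function.Periodic (fun θ => fderiv ℝ F (K θ)) L := fun θ => by
    simp only [h.periodic θ]
  obtain ⟨B, hB⟩ := (hper.isBounded_of_continuous h.L_pos.ne' h.continuous_fderiv).exists_norm_le
  exact ⟨max B 1, by positivity, fun θ => (hB _ (mem_range_self θ)).trans (le_max_left _ _)⟩

theorem exists_linear_flow [CompleteSpace E] (h : AttractingCurve F K s L κ μ) {Θ : ℝ → ℝ}
    (hΘ : Continuous Θ) : ∃ U : ℝ → E →L[ℝ] E, U 0 = ContinuousLinearMap.id ℝ E ∧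
      ∀ u t, HasDerivAt (fun t => U t u) (fderiv ℝ F (K (Θ t)) (U t u)) t := by
  obtain ⟨B, hB0, hB⟩ := h.exists_norm_fderiv_le
  obtain ⟨U, hU0, hU⟩ := exists_forall_hasDerivAt_of_lipschitz
    (v := fun t (T : E →L[ℝ] E) => (fderiv ℝ F (K (Θ t))).comp T)
    (((h.continuous_fderiv.comp hΘ).comp continuous_fst).clm_comp continuous_snd) hB0
    (fun t S T => by
      rw [← ContinuousLinearMap.comp_sub]
      exact (ContinuousLinearMap.opNorm_comp_le _ _).trans (by gcongr; exact hB _))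
    (ContinuousLinearMap.id ℝ E)
    (fun t => by rw [ContinuousLinearMap.comp_id]; exact hB _)
  exact ⟨U, hU0, fun u t => by simpa using (hU t).clm_apply (hasDerivAt_const t u)⟩

theorem hasDerivAt_comp (h : AttractingCurve F K s L κ μ) {Θ : ℝ → ℝ}
    (hΘ : ∀ t, HasDerivAt Θ (s (Θ t)) t) (t : ℝ) :
    HasDerivAt (fun t => K (Θ t)) (F (K (Θ t))) t := by
  rw [h.field_eq]
  exact (h.hasDerivAt (Θ t)).scomp t (hΘ t)

theorem eq_comp_of_hasDerivAt (h : AttractingCurve F K s L κ μ) {Θ : ℝ → ℝ}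
    (hΘ : ∀ t, HasDerivAt Θ (s (Θ t)) t) {Y : ℝ → E} (hY : ∀ t, HasDerivAt Y (F (Y t)) t)
    (h0 : Y 0 = K (Θ 0)) (t : ℝ) : Y t = K (Θ t) := by
  have cY : Continuous Y := continuous_iff_continuousAt.2 fun t => (hY t).continuousAt
  have cK : Continuous fun t => K (Θ t) :=
    continuous_iff_continuousAt.2 fun t => (h.hasDerivAt_comp hΘ t).continuousAt
  have hopen : IsOpen {t | Y t = K (Θ t)} := by
    refine isOpen_iff_mem_nhds.2 fun t₀ (ht₀ : Y t₀ = K (Θ t₀)) => ?_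
    obtain ⟨C, S, hS, hC⟩ := (h.contDiff_field.contDiffAt (x := Y t₀)).exists_lipschitzOnWith
    refine ODE_solution_unique_of_eventually (v := fun _ => F) (s := fun _ => S)
      (Eventually.of_forall fun _ => hC) ?_ ?_ ht₀
    · filter_upwards [cY.continuousAt.eventually_mem hS] with t ht using ⟨hY t, ht⟩
    · rw [ht₀] at hS
      filter_upwards [cK.continuousAt.eventually_mem hS] with t ht using
        ⟨h.hasDerivAt_comp hΘ t, ht⟩
  exact eq_univ_iff_forall.1
    (IsClopen.eq_univ ⟨isClosed_eq cY cK, hopen⟩ ⟨0, h0⟩) t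

theorem hasDerivAt_deriv_comp (h : AttractingCurve F K s L κ μ) {Θ : ℝ → ℝ}
    (hΘ : ∀ t, HasDerivAt Θ (s (Θ t)) t) (t : ℝ) :
    HasDerivAt (fun t => deriv K (Θ t)) (s (Θ t) • deriv (deriv K) (Θ t)) t :=
  (h.hasDerivAt_deriv (Θ t)).scomp t (hΘ t)

/-- Normal components of linearized solutions grow at rate at least `μ` backward in time. -/
theorem norm_normal_ge (h : AttractingCurve F K s L κ μ) {Θ : ℝ → ℝ}
    (hΘ : ∀ t, HasDerivAt Θ (s (Θ t)) t) {y : ℝ → E}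
    (hy : ∀ t, HasDerivAt y (fderiv ℝ F (K (Θ t)) (y t)) t) (h0 : ⟪y 0, deriv K (Θ 0)⟫ = 0)
    {t : ℝ} (ht : t ≤ 0) :
    ‖y 0‖ * Real.exp (-μ * t) ≤
      ‖y t - (⟪deriv K (Θ t), y t⟫ / ‖deriv K (Θ t)‖ ^ 2) • deriv K (Θ t)‖ := by
  set τ : ℝ → E := fun t => deriv K (Θ t) with hτ
  set α : ℝ → ℝ := fun t => ⟪τ t, y t⟫ / ‖τ t‖ ^ 2 with hα
  set N : ℝ → E := fun t => y t - α t • τ t with hN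
  have dτ : ∀ t, HasDerivAt τ (s (Θ t) • deriv (deriv K) (Θ t)) t := h.hasDerivAt_deriv_comp hΘ
  have τ_ne : ∀ t, ‖τ t‖ ^ 2 ≠ 0 := fun t => by
    have := h.deriv_ne_zero (Θ t)
    positivity
  have orth : ∀ t, ⟪N t, τ t⟫ = 0 := fun t => by
    simp only [hN, hα]
    rw [inner_sub_left, real_inner_smul_left, real_inner_self_eq_norm_sq,
      div_mul_cancel₀ _ (τ_ne t), real_inner_comm, sub_self]
  have dα : ∀ t, HasDerivAt α (deriv α t) t := fun t =>
    ((((dτ t).inner ℝ (hy t)).differentiableAt).div ((dτ t).differentiableAt.norm_sq ℝ)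
      (τ_ne t)).hasDerivAt
  have dN : ∀ t, HasDerivAt N (fderiv ℝ F (K (Θ t)) (y t) -
      (α t • (s (Θ t) • deriv (deriv K) (Θ t)) + deriv α t • τ t)) t := fun t =>
    (hy t).sub ((dα t).smul (dτ t))
  have inner_le : ∀ t, ⟪N t, fderiv ℝ F (K (Θ t)) (y t) -
      (α t • (s (Θ t) • deriv (deriv K) (Θ t)) + deriv α t • τ t)⟫ ≤ -μ * ‖N t‖ ^ 2 := fun t => by
    have hyN : y t = N t + α t • τ t := by simp only [hN]; abel
    have h1 := h.normal (Θ t) (N t) (orth t)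
    have h2 : fderiv ℝ F (K (Θ t)) (y t) -
        (α t • (s (Θ t) • deriv (deriv K) (Θ t)) + deriv α t • τ t) =
        fderiv ℝ F (K (Θ t)) (N t) + (α t * deriv s (Θ t) - deriv α t) • τ t := by
      rw [hyN, map_add, map_smul, h.fderiv_tangent]
      simp only [hτ]
      module
    rw [h2, inner_add_right, inner_smul_right, orth t, real_inner_comm]
    linarith
  set g : ℝ → ℝ := fun t => Real.exp (2 * μ * t) * ‖N t‖ ^ 2 with hg
  have dg : ∀ t, HasDerivAt g (Real.exp (2 * μ * t) * (2 * μ) * ‖N t‖ ^ 2 +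
      Real.exp (2 * μ * t) * (2 * ⟪N t, fderiv ℝ F (K (Θ t)) (y t) -
      (α t • (s (Θ t) • deriv (deriv K) (Θ t)) + deriv α t • τ t)⟫)) t := fun t => by
    have h1 : HasDerivAt (fun t => Real.exp (2 * μ * t)) (Real.exp (2 * μ * t) * (2 * μ)) t := by
      simpa using ((hasDerivAt_id t).const_mul (2 * μ)).exp
    exact h1.mul (dN t).norm_sq
  have hanti : Antitone g := antitone_of_deriv_nonpos (fun t => (dg t).differentiableAt) fun t => by
    rw [(dg t).deriv]
    have := Real.exp_pos (2 * μ * t)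
    nlinarith [inner_le t]
  have h1 := hanti ht
  have hN0 : N 0 = y 0 := by
    simp only [hN, hα, hτ]
    rw [real_inner_comm, h0]
    simp
  simp only [hg, hN0, mul_zero, Real.exp_zero, one_mul] at h1
  have h2 : (‖y 0‖ * Real.exp (-μ * t)) ^ 2 ≤ ‖N t‖ ^ 2 := by
    have h3 : Real.exp (-μ * t) ^ 2 * Real.exp (2 * μ * t) = 1 := by
      rw [← Real.exp_nat_mul, ← Real.exp_add]
      simp
      ring
    calc (‖y 0‖ * Real.exp (-μ * t)) ^ 2 = ‖y 0‖ ^ 2 * Real.exp (-μ * t) ^ 2 := by ring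
      _ ≤ Real.exp (2 * μ * t) * ‖N t‖ ^ 2 * Real.exp (-μ * t) ^ 2 := by gcongr
      _ = (Real.exp (-μ * t) ^ 2 * Real.exp (2 * μ * t)) * ‖N t‖ ^ 2 := by ring
      _ = ‖N t‖ ^ 2 := by rw [h3, one_mul]
  exact (pow_le_pow_iff_left₀ (by positivity) (norm_nonneg _) two_ne_zero).1 h2

/-- Linearized solutions starting in the tangent direction stay tangent. -/
theorem exists_eq_smul_of_tangent (h : AttractingCurve F K s L κ μ) {Θ : ℝ → ℝ}
    (hΘ : ∀ t, HasDerivAt Θ (s (Θ t)) t) {y : ℝ → E}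
    (hy : ∀ t, HasDerivAt y (fderiv ℝ F (K (Θ t)) (y t)) t) {c : ℝ}
    (h0 : y 0 = c • deriv K (Θ 0)) (t : ℝ) :
    ∃ m, y t = m • deriv K (Θ t) ∧ |m| ≤ |c| * Real.exp (κ * |t|) := by
  have cΘ : Continuous Θ := continuous_iff_continuousAt.2 fun t => (hΘ t).continuousAt
  have cs : Continuous fun t => deriv s (Θ t) :=
    (h.contDiff_speed.continuous_deriv (by norm_num)).comp cΘ
  set m : ℝ → ℝ := fun t => c * Real.exp (∫ r in (0 : ℝ)..t, deriv s (Θ r)) with hm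
  have dm : ∀ t, HasDerivAt m (m t * deriv s (Θ t)) t := fun t => by
    have h1 := (intervalIntegral.integral_hasDerivAt_right (cs.intervalIntegrable 0 t)
      cs.aestronglyMeasurable.stronglyMeasurableAtFilter cs.continuousAt).exp.const_mul c
    rwa [← mul_assoc] at h1
  have dmτ : ∀ t, HasDerivAt (fun t => m t • deriv K (Θ t))
      (fderiv ℝ F (K (Θ t)) (m t • deriv K (Θ t))) t := fun t => by
    have h1 := (dm t).smul (h.hasDerivAt_deriv_comp hΘ t)
    rw [map_smul, h.fderiv_tangent, smul_add, smul_smul (m t) (deriv s (Θ t))]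
    exact h1
  obtain ⟨B, -, hB⟩ := h.exists_norm_fderiv_le
  have key := ODE_solution_unique_univ (v := fun t => fderiv ℝ F (K (Θ t))) (s := fun _ => univ)
    (K := B.toNNReal) (t₀ := 0) (f := y) (g := fun t => m t • deriv K (Θ t))
    (fun t => ((fderiv ℝ F (K (Θ t))).lipschitz.weaken
      (by rw [← norm_toNNReal]; exact Real.toNNReal_le_toNNReal (hB _))).lipschitzOnWith)
    (fun t => ⟨hy t, mem_univ _⟩) (fun t => ⟨dmτ t, mem_univ _⟩) (by simp [hm, h0])
  refine ⟨m t, congrFun key t, ?_⟩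
  simp only [hm]
  rw [abs_mul, Real.abs_exp]
  gcongr
  have := intervalIntegral.norm_integral_le_of_norm_le_const (a := (0 : ℝ)) (b := t)
    (f := fun r => deriv s (Θ r)) (C := κ) fun r _ => h.deriv_speed_le (Θ r)
  rw [sub_zero] at this
  exact (le_abs_self _).trans this

theorem mem_range_of_hasDerivAt (h : AttractingCurve F K s L κ μ) {Y : ℝ → E}
    (hY : ∀ t, HasDerivAt Y (F (Y t)) t) (h0 : Y 0 ∈ range K) (t : ℝ) : Y t ∈ range K := by
  obtain ⟨θ₀, hθ₀⟩ := h0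
  obtain ⟨Θ, hΘ0, hΘ⟩ := h.exists_phase θ₀
  exact ⟨Θ t, (h.eq_comp_of_hasDerivAt hΘ hY (by rw [hΘ0, hθ₀]) t).symm⟩

/-- The flow on the curve, written through a phase, together with its linearization. -/
theorem exists_flow [CompleteSpace E] (h : AttractingCurve F K s L κ μ) :
    ∃ (flow : E → ℝ → E) (U : E → ℝ → E →L[ℝ] E), ∀ θ₀, ∃ Θ : ℝ → ℝ,
      (∀ t, HasDerivAt Θ (s (Θ t)) t) ∧ K (Θ 0) = K θ₀ ∧ (∀ t, flow (K θ₀) t = K (Θ t)) ∧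
      U (K θ₀) 0 = ContinuousLinearMap.id ℝ E ∧
      ∀ u t, HasDerivAt (fun t => U (K θ₀) t u) (fderiv ℝ F (K (Θ t)) (U (K θ₀) t u)) t := by
  choose Θ hΘ0 hΘ using h.exists_phase
  choose U hU0 hU using fun θ => h.exists_linear_flow
    (continuous_iff_continuousAt.2 fun t => (hΘ θ t).continuousAt)
  let θ : E → ℝ := Function.invFun K
  refine ⟨fun p t => K (Θ (θ p) t), fun p => U (θ p), fun θ₀ => ⟨Θ (θ (K θ₀)), hΘ _, ?_,
    fun _ => rfl, hU0 _, hU _⟩⟩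
  rw [hΘ0]
  exact Function.invFun_eq ⟨θ₀, rfl⟩

/-- Normal perturbations are contracted at a uniform exponential rate. -/
theorem tendsto_normal (h : AttractingCurve F K s L κ μ) (hμ : 0 < μ) {Θ : ℝ → ℝ}
    (hΘ : ∀ t, HasDerivAt Θ (s (Θ t)) t) {y : ℝ → E}
    (hy : ∀ t, HasDerivAt y (fderiv ℝ F (K (Θ t)) (y t)) t) (h0 : ⟪y 0, deriv K (Θ 0)⟫ = 0) :
    Tendsto (fun t => (‖y 0‖ /
      ‖y t - (⟪deriv K (Θ t), y t⟫ / ‖deriv K (Θ t)‖ ^ 2) • deriv K (Θ t)‖) /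
        Real.exp (-(μ / 2)) ^ (-t)) atBot (nhds 0) := by
  have hlim : Tendsto (fun t : ℝ => Real.exp (μ / 2 * t)) atBot (nhds 0) :=
    Real.tendsto_exp_atBot.comp (tendsto_id.const_mul_atBot (by positivity))
  refine tendsto_of_tendsto_of_tendsto_of_le_of_le' tendsto_const_nhds hlim
    (Eventually.of_forall fun t => by positivity) ?_
  filter_upwards [eventually_le_atBot 0] with t ht
  have h1 := h.norm_normal_ge hΘ hy h0 ht
  rw [← Real.exp_mul, div_le_iff₀ (Real.exp_pos _), ← Real.exp_add]
  refine div_le_of_le_mul₀ (norm_nonneg _) (Real.exp_pos _).le ?_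
  calc ‖y 0‖ = Real.exp (μ / 2 * t + -(μ / 2) * -t) * (‖y 0‖ * Real.exp (-μ * t)) := by
        rw [mul_left_comm, ← Real.exp_add]; ring_nf; simp
    _ ≤ _ := by gcongr

/-- Normal perturbations contract faster than the square of tangential ones. -/
theorem tendsto_tangent_div_normal (h : AttractingCurve F K s L κ μ) (hκ : κ < μ / 2) {Θ : ℝ → ℝ}
    (hΘ : ∀ t, HasDerivAt Θ (s (Θ t)) t) {y z : ℝ → E}
    (hy : ∀ t, HasDerivAt y (fderiv ℝ F (K (Θ t)) (y t)) t) (h0 : ⟪y 0, deriv K (Θ 0)⟫ = 0)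
    (hz : ∀ t, HasDerivAt z (fderiv ℝ F (K (Θ t)) (z t)) t) (hz0 : z 0 ≠ 0) {c : ℝ}
    (hc : z 0 = c • deriv K (Θ 0)) :
    Tendsto (fun t => (‖y 0‖ ^ (1 / 2 : ℝ) / ‖z 0‖) /
      (‖y t - (⟪deriv K (Θ t), y t⟫ / ‖deriv K (Θ t)‖ ^ 2) • deriv K (Θ t)‖ ^ (1 / 2 : ℝ) /
        ‖(⟪deriv K (Θ t), z t⟫ / ‖deriv K (Θ t)‖ ^ 2) • deriv K (Θ t)‖)) atBot (nhds 0) := by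
  have hlim : Tendsto (fun t : ℝ => 4 * Real.exp ((μ / 2 - κ) * t)) atBot (nhds 0) := by
    simpa using (Real.tendsto_exp_atBot.comp
      (tendsto_id.const_mul_atBot (sub_pos.2 hκ))).const_mul (4 : ℝ)
  refine tendsto_of_tendsto_of_tendsto_of_le_of_le' tendsto_const_nhds hlim
    (Eventually.of_forall fun t => by positivity) ?_
  filter_upwards [eventually_le_atBot 0] with t ht
  obtain ⟨m, hm, hmc⟩ := h.exists_eq_smul_of_tangent hΘ hz hc t
  have hτ0 := norm_pos_iff.2 (h.deriv_ne_zero (Θ t))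
  have hproj : (⟪deriv K (Θ t), z t⟫ / ‖deriv K (Θ t)‖ ^ 2) • deriv K (Θ t) =
      m • deriv K (Θ t) := by
    rw [hm, inner_smul_right, real_inner_self_eq_norm_sq, mul_div_assoc, div_self (by positivity),
      mul_one]
  have hzpos := norm_pos_iff.2 hz0
  have hnum : ‖m • deriv K (Θ t)‖ ≤ 4 * Real.exp (-κ * t) * ‖z 0‖ := by
    have h1 := h.half_le_norm_deriv (Θ 0)
    rw [hc, norm_smul, norm_smul, Real.norm_eq_abs, Real.norm_eq_abs]
    rw [abs_of_nonpos ht, mul_neg, ← neg_mul] at hmc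
    calc |m| * ‖deriv K (Θ t)‖ ≤ (|c| * Real.exp (-κ * t)) * 2 :=
          mul_le_mul hmc (h.norm_deriv_le _) (norm_nonneg _) (by positivity)
      _ = 4 * Real.exp (-κ * t) * (|c| * (1 / 2)) := by ring
      _ ≤ _ := by gcongr
  have h1 := h.norm_normal_ge hΘ hy h0 ht
  rw [hproj]
  set N := ‖y t - (⟪deriv K (Θ t), y t⟫ / ‖deriv K (Θ t)‖ ^ 2) • deriv K (Θ t)‖
  have h2 : ‖y 0‖ ^ (1 / 2 : ℝ) / N ^ (1 / 2 : ℝ) ≤ Real.exp (μ / 2 * t) := by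
    refine div_le_of_le_mul₀ (by positivity) (Real.exp_pos _).le ?_
    have h3 := Real.rpow_le_rpow (by positivity) h1 (by norm_num : (0 : ℝ) ≤ 1 / 2)
    rw [Real.mul_rpow (norm_nonneg _) (Real.exp_pos _).le, ← Real.exp_mul] at h3
    calc ‖y 0‖ ^ (1 / 2 : ℝ) = Real.exp (μ / 2 * t) *
          (‖y 0‖ ^ (1 / 2 : ℝ) * Real.exp (-μ * t * (1 / 2))) := by
          rw [mul_left_comm, ← Real.exp_add]; ring_nf; simp
      _ ≤ _ := by gcongr
  calc (‖y 0‖ ^ (1 / 2 : ℝ) / ‖z 0‖) / (N ^ (1 / 2 : ℝ) / ‖m • deriv K (Θ t)‖)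
      = (‖y 0‖ ^ (1 / 2 : ℝ) / N ^ (1 / 2 : ℝ)) * (‖m • deriv K (Θ t)‖ / ‖z 0‖) := by
        rw [div_div_div_eq, div_mul_div_comm, mul_comm ‖z 0‖]
    _ ≤ Real.exp (μ / 2 * t) * (4 * Real.exp (-κ * t)) := by
        gcongr
        exact (div_le_iff₀ hzpos).2 hnum
    _ = 4 * Real.exp ((μ / 2 - κ) * t) := by
        rw [mul_left_comm, ← Real.exp_add]; ring_nf

end AttractingCurve

namespace EquilibriumCurve

variable {A : E → E} {q : ℝ → E} {L lam : ℝ}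

theorem exists_norm_deriv_le (h : EquilibriumCurve A q L lam) :
    ∃ D, 1 ≤ D ∧ ∀ θ, ‖q θ‖ ≤ D ∧ ‖deriv (deriv q) θ‖ ≤ D ∧ ‖deriv (deriv (deriv q)) θ‖ ≤ D := by
  have h2 := h.contDiff_deriv
  rw [show (2 : WithTop ℕ∞) = 1 + 1 by norm_num, contDiff_succ_iff_deriv] at h2
  have h3 := h2.2.2
  have per : ∀ {f : ℝ → E}, Function.Periodic f L → Function.Periodic (deriv f) L :=
    fun hf θ => by rw [← deriv_comp_add_const, funext hf]
  have bdd : ∀ {f : ℝ → E}, Continuous f → Function.Periodic f L → ∃ D, ∀ θ, ‖f θ‖ ≤ D :=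
    fun hf hp => by
      obtain ⟨D, hD⟩ := (hp.isBounded_of_continuous h.L_pos.ne' hf).exists_norm_le
      exact ⟨D, fun θ => hD _ (mem_range_self θ)⟩
  obtain ⟨D₀, hD₀⟩ := bdd h.contDiff.continuous h.periodic
  obtain ⟨D₂, hD₂⟩ := bdd h3.continuous (per (per h.periodic))
  obtain ⟨D₃, hD₃⟩ := bdd (h3.continuous_deriv le_rfl) (per (per (per h.periodic)))
  exact ⟨max 1 (max D₀ (max D₂ D₃)), le_max_left _ _, fun θ =>
    ⟨(hD₀ θ).trans (by simp), (hD₂ θ).trans (by simp), (hD₃ θ).trans (by simp)⟩⟩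

/-- The perturbed field has an invariant curve which is a normal graph over the curve of
equilibria. -/
theorem exists_normal_invariant_curve [FiniteDimensional ℝ E] (h : EquilibriumCurve A q L lam)
    {G : E → E} (hG : ContDiff ℝ 2 G) :
    ∃ δ₀ > 0, ∃ C > 0, ∀ δ, 0 < δ → δ ≤ δ₀ → ∃ Φ : ℝ → E,
      ContDiff ℝ 2 Φ ∧ Function.Periodic Φ L ∧ (∀ θ, ⟪Φ θ, deriv q θ⟫ = 0) ∧
      (∀ θ, ‖Φ θ‖ ≤ C * δ ∧ ‖deriv Φ θ‖ ≤ C * δ ∧ ‖deriv (deriv Φ) θ‖ ≤ C * δ) ∧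
      ∃ s : ℝ → ℝ, ∀ θ,
        -A (q θ + Φ θ) + δ • G (q θ + Φ θ) = s θ • (deriv q θ + deriv Φ θ) := by
  obtain ⟨D, hD1, hD⟩ := h.exists_norm_deriv_le
  obtain ⟨δ₀, hδ₀, -, C, hC, H⟩ := h.exists_scaled_invariant_curve hG
  have hpos : 0 < 16 * D * C + 1 := by positivity
  refine ⟨min δ₀ (1 / (16 * D * C + 1)), by positivity, 400 * D ^ 2 * C + 1, by positivity,
    fun δ hδ hδle => ?_⟩
  obtain ⟨k, hk, hkper, hkb, σ, hσ⟩ := H δ hδ (hδle.trans (min_le_left _ _))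
  have hsmall : 16 * D * (δ * C) ≤ 1 := by
    have := (le_div_iff₀ hpos).1 (hδle.trans (min_le_right _ _))
    linarith
  have hd1 : deriv (fun θ => δ • k θ) = fun θ => δ • deriv k θ :=
    funext fun θ => deriv_fun_const_smul δ (hk.differentiable (by norm_num) θ)
  have hk' : Differentiable ℝ (deriv k) := by
    have := hk
    rw [show (2 : WithTop ℕ∞) = 1 + 1 by norm_num, contDiff_succ_iff_deriv] at this
    exact this.2.2.differentiable (by norm_num)
  have hd2 : deriv (deriv fun θ => δ • k θ) = fun θ => δ • deriv (deriv k) θ := by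
    rw [hd1]
    exact funext fun θ => deriv_fun_const_smul δ (hk' θ)
  have hle : ∀ {x : E}, ‖x‖ ≤ C → ‖δ • x‖ ≤ δ * C := fun {x} hx => by
    rw [norm_smul, Real.norm_of_nonneg hδ.le]
    gcongr
  obtain ⟨Θ, Φ, hΘ, hΦ, hΦper, hΘΦ⟩ := exists_normal_reparametrization (j := fun θ => δ • k θ)
    h.contDiff h.periodic h.unit hD1 (fun θ => (hD θ).2.1) (fun θ => (hD θ).2.2)
    (contDiff_const.smul hk) (fun θ => by simp only [hkper θ]) (fun θ => hle (hkb θ).1)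
    (fun θ => by rw [hd1]; exact hle (hkb θ).2.1) (fun θ => by rw [hd2]; exact hle (hkb θ).2.2)
    hsmall
  have hbd : 400 * D ^ 2 * (δ * C) ≤ (400 * D ^ 2 * C + 1) * δ := by nlinarith
  refine ⟨Φ, hΦ, hΦper, fun θ => (hΘΦ θ).2.2.1, fun θ => ⟨(hΘΦ θ).2.2.2.1.trans hbd,
    (hΘΦ θ).2.2.2.2.1.trans hbd, (hΘΦ θ).2.2.2.2.2.trans hbd⟩,
    fun θ => σ (Θ θ) / deriv Θ θ, fun θ => ?_⟩
  have hqd : ∀ θ, HasDerivAt q (deriv q θ) θ := fun θ =>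
    (h.contDiff.differentiable (by norm_num) θ).hasDerivAt
  have hkd : ∀ θ, HasDerivAt k (deriv k θ) θ := fun θ =>
    (hk.differentiable (by norm_num) θ).hasDerivAt
  have h1 : HasDerivAt (fun θ => q θ + Φ θ) (deriv q θ + deriv Φ θ) θ :=
    (hqd θ).add (hΦ.differentiable (by norm_num) θ).hasDerivAt
  have h2 : HasDerivAt (fun θ => q (Θ θ) + δ • k (Θ θ))
      (deriv Θ θ • (deriv q (Θ θ) + δ • deriv k (Θ θ))) θ :=
    ((hqd (Θ θ)).add ((hkd (Θ θ)).const_smul δ)).scomp θ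
      (hΘ.differentiable (by norm_num) θ).hasDerivAt
  rw [h1.unique (h2.congr_of_eventuallyEq (Eventually.of_forall fun θ => (hΘΦ θ).1)), smul_smul,
    div_mul_cancel₀ _ (hΘΦ θ).2.1, (hΘΦ θ).1, hσ]

/-- A simple closed curve is bi-Lipschitz onto its image. -/
theorem exists_mul_abs_le_norm_sub (h : EquilibriumCurve A q L lam)
    [CompleteSpace E] (hinj : ∀ θ₁ θ₂, q θ₁ = q θ₂ → ∃ k : ℤ, θ₂ - θ₁ = k * L) :
    ∃ c > 0, ∀ x y, |y| ≤ L / 2 → c * |y| ≤ ‖q (x + y) - q x‖ := by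
  have hL := h.L_pos
  have hc : Continuous (deriv q) := h.contDiff_deriv.continuous
  let f : ℝ × ℝ → E := fun p => ∫ u in (0 : ℝ)..1, deriv q (p.1 + p.2 * u)
  have hf : Continuous f := intervalIntegral.continuous_parametric_intervalIntegral_of_continuous'
    (by unfold Function.uncurry; fun_prop) 0 1
  have hsub : ∀ x y, y • f (x, y) = q (x + y) - q x := fun x y => by
    simp only [f]
    rw [intervalIntegral.smul_integral_comp_add_mul (f := deriv q), mul_zero, add_zero, mul_one]
    exact intervalIntegral.integral_deriv_eq_sub
      (fun θ _ => h.contDiff.differentiable (by norm_num) θ) (hc.intervalIntegrable _ _)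
  have hne : ∀ p ∈ Icc 0 L ×ˢ Icc (-(L / 2)) (L / 2), 0 < ‖f p‖ := by
    rintro ⟨x, y⟩ ⟨-, hy⟩
    rw [norm_pos_iff]
    intro h0
    have h1 := hsub x y
    rw [h0, smul_zero, eq_comm, sub_eq_zero] at h1
    obtain ⟨k, hk⟩ := hinj _ _ h1
    have hy0 : y = 0 := by
      have h2 : |(k : ℝ)| * L ≤ L / 2 := by
        rw [← abs_of_pos hL, ← abs_mul, ← hk, abs_of_pos hL]
        exact abs_le.2 ⟨by linarith [hy.2], by linarith [hy.1]⟩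
      have h3 : |(k : ℝ)| < 1 := by
        by_contra! h4
        nlinarith
      have h4 : k = 0 := Int.abs_lt_one_iff.1 (by exact_mod_cast h3)
      rw [h4] at hk
      simp at hk
      exact hk
    have h5 : f (x, y) = deriv q x := by simp [f, hy0]
    have h6 := h.unit x
    rw [← h5, h0, norm_zero] at h6
    exact zero_ne_one h6
  obtain ⟨c, hc0, hcle⟩ := (isCompact_Icc.prod isCompact_Icc).exists_forall_le'
    hf.norm.continuousOn hne
  refine ⟨c, hc0, fun x y hy => ?_⟩
  obtain ⟨x', hx', hxx⟩ := Function.Periodic.exists_mem_Ico₀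
    (f := fun x => q (x + y) - q x) (c := L)
    (fun x => by simp only [add_right_comm x L y, h.periodic _]) hL x
  rw [show q (x + y) - q x = _ from hxx, ← hsub, norm_smul, Real.norm_eq_abs, mul_comm]
  gcongr
  exact hcle (x', y) ⟨Ico_subset_Icc_self hx', abs_le.1 hy⟩

end EquilibriumCurve

theorem exists_bound_closedBall [ProperSpace E] {A G : E → E} (hA : ContDiff ℝ 2 A)
    (hG : ContDiff ℝ 1 G) (R : ℝ) :
    ∃ M ≥ 0, ∀ x ∈ Metric.closedBall (0 : E) R, ‖fderiv ℝ A x‖ ≤ M ∧ ‖G x‖ ≤ M ∧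
      ‖fderiv ℝ G x‖ ≤ M ∧ ∀ y ∈ Metric.closedBall (0 : E) R,
        ‖A x - A y‖ ≤ M * ‖x - y‖ ∧ ‖fderiv ℝ A x - fderiv ℝ A y‖ ≤ M * ‖x - y‖ := by
  have hA1 : ContDiff ℝ 1 (fderiv ℝ A) := hA.fderiv_right (by norm_num)
  have hK := isCompact_closedBall (0 : E) R
  obtain ⟨M₁, h₁⟩ := hK.exists_bound_of_continuousOn hA1.continuous.continuousOn
  obtain ⟨M₂, h₂⟩ := hK.exists_bound_of_continuousOn
    (hA1.continuous_fderiv (by norm_num)).continuousOn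
  obtain ⟨M₃, h₃⟩ := hK.exists_bound_of_continuousOn hG.continuous.continuousOn
  obtain ⟨M₄, h₄⟩ := hK.exists_bound_of_continuousOn
    (hG.continuous_fderiv (by norm_num)).continuousOn
  have l₁ : M₁ ≤ max (max M₁ M₂) (max M₃ (max M₄ 0)) := by simp
  have l₂ : M₂ ≤ max (max M₁ M₂) (max M₃ (max M₄ 0)) := by simp
  have l₃ : M₃ ≤ max (max M₁ M₂) (max M₃ (max M₄ 0)) := by simp
  have l₄ : M₄ ≤ max (max M₁ M₂) (max M₃ (max M₄ 0)) := by simp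
  refine ⟨max (max M₁ M₂) (max M₃ (max M₄ 0)), by simp, fun x hx => ⟨(h₁ x hx).trans l₁,
    (h₃ x hx).trans l₃, (h₄ x hx).trans l₄, fun y hy => ⟨?_, ?_⟩⟩⟩
  · exact (convex_closedBall (0 : E) R).norm_image_sub_le_of_norm_fderiv_le
      (fun z _ => hA.differentiable (by norm_num) z) (fun z hz => (h₁ z hz).trans l₁) hy hx
  · exact (convex_closedBall (0 : E) R).norm_image_sub_le_of_norm_fderiv_le
      (fun z _ => hA1.differentiable (by norm_num) z) (fun z hz => (h₂ z hz).trans l₂) hy hx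

theorem injective_mod_period_of_close {q Φ : ℝ → E} {L c ε : ℝ} (hL : 0 < L)
    (hqper : Function.Periodic q L)
    (hc : ∀ x y, |y| ≤ L / 2 → c * |y| ≤ ‖q (x + y) - q x‖) (hΦ : Differentiable ℝ Φ)
    (hΦper : Function.Periodic Φ L) (hΦ' : ∀ θ, ‖deriv Φ θ‖ ≤ ε) (hεc : ε < c) (θ₁ θ₂ : ℝ)
    (he : q θ₁ + Φ θ₁ = q θ₂ + Φ θ₂) : ∃ k : ℤ, θ₂ - θ₁ = k * L := by
  set k : ℤ := round ((θ₂ - θ₁) / L)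
  set y : ℝ := θ₂ - k * L - θ₁ with hy
  have hyL : |y| ≤ L / 2 := by
    have h1 := abs_sub_round ((θ₂ - θ₁) / L)
    have h2 : y = ((θ₂ - θ₁) / L - k) * L := by
      rw [hy, sub_mul, div_mul_cancel₀ _ hL.ne']
      ring
    rw [h2, abs_mul, abs_of_pos hL]
    calc |(θ₂ - θ₁) / L - k| * L ≤ 1 / 2 * L := by gcongr
      _ = L / 2 := by ring
  have hxy : θ₁ + y = θ₂ - k * L := by rw [hy]; ring
  have h1 := hc θ₁ y hyL
  have h2 : ‖q (θ₁ + y) - q θ₁‖ ≤ ε * |y| := by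
    have h3 : q (θ₁ + y) - q θ₁ = Φ θ₁ - Φ (θ₁ + y) := by
      rw [hxy, hqper.sub_int_mul_eq, hΦper.sub_int_mul_eq, sub_eq_sub_iff_add_eq_add, ← he,
        add_comm]
    rw [h3]
    refine (convex_univ.norm_image_sub_le_of_norm_deriv_le (fun z _ => hΦ z)
      (fun z _ => hΦ' z) (mem_univ (θ₁ + y)) (mem_univ θ₁)).trans_eq ?_
    rw [Real.norm_eq_abs, sub_add_cancel_left, abs_neg]
  have hy0 : |y| ≤ 0 := by
    by_contra! h3
    nlinarith
  exact ⟨k, by linarith [abs_nonpos_iff.1 hy0]⟩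

namespace EquilibriumCurve

variable {A : E → E} {q : ℝ → E} {L lam : ℝ}

/-- Invariant normal graphs over the curve of equilibria are attracting. -/
theorem exists_attractingCurve [FiniteDimensional ℝ E] (h : EquilibriumCurve A q L lam)
    (hinj : ∀ θ₁ θ₂, q θ₁ = q θ₂ → ∃ k : ℤ, θ₂ - θ₁ = k * L) {G : E → E} (hG : ContDiff ℝ 2 G)
    {C : ℝ} (hC : 0 ≤ C) :
    ∃ δ₀ > 0, ∀ δ, 0 < δ → δ ≤ δ₀ → ∀ (Φ : ℝ → E) (s : ℝ → ℝ), ContDiff ℝ 2 Φ →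
      Function.Periodic Φ L →
      (∀ θ, ‖Φ θ‖ ≤ C * δ ∧ ‖deriv Φ θ‖ ≤ C * δ ∧ ‖deriv (deriv Φ) θ‖ ≤ C * δ) →
      (∀ θ, -A (q θ + Φ θ) + δ • G (q θ + Φ θ) = s θ • (deriv q θ + deriv Φ θ)) →
      AttractingCurve (fun X => -A X + δ • G X) (fun θ => q θ + Φ θ) s L (lam / 8) (lam / 2) := by
  have hlam := h.lam_pos
  obtain ⟨D, hD1, hD⟩ := h.exists_norm_deriv_le
  obtain ⟨c, hc0, hc⟩ := h.exists_mul_abs_le_norm_sub hinj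
  obtain ⟨M, hM0, hM⟩ := exists_bound_closedBall (h.contDiff_field.of_le (by norm_num))
    (hG.of_le (by norm_num)) (D + 1)
  obtain ⟨δ₀, hδ₀, hδ₀1, hsmall⟩ := exists_pos_mul_le_list
    [(C, 1 / 2), (C, c / 2), (2 * (M * (3 * C + 2) + 2 * (M * (C + 1)) * (D + 1)), lam / 8),
      (lam * C + M * C + M, lam / 2)] (by
        simp only [List.forall_mem_cons]
        exact ⟨by norm_num, by positivity, by positivity, by positivity, by simp⟩)
  refine ⟨δ₀, hδ₀, fun δ hδ hδle Φ s hΦ hΦper hΦb hs => ?_⟩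
  have hδ1 := hδle.trans hδ₀1
  have hsm := hsmall δ hδ.le hδle
  simp only [List.forall_mem_cons] at hsm
  obtain ⟨hs1, hs2, hs3, hs4, -⟩ := hsm
  set ε := C * δ with hε
  have hε0 : 0 ≤ ε := by positivity
  have hε1 : ε ≤ 1 / 2 := by linarith
  have hA2 : ContDiff ℝ 2 A := h.contDiff_field.of_le (by norm_num)
  have hAd : Differentiable ℝ A := hA2.differentiable (by norm_num)
  have hGd : Differentiable ℝ G := hG.differentiable (by norm_num)
  have hF2 : ContDiff ℝ 2 fun X => -A X + δ • G X := hA2.neg.add (contDiff_const.smul hG)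
  have hDF : ∀ X, fderiv ℝ (fun X => -A X + δ • G X) X = -fderiv ℝ A X + δ • fderiv ℝ G X :=
    fun X => ((hAd X).hasFDerivAt.neg.add ((hGd X).hasFDerivAt.const_smul δ)).fderiv
  have hq2 : ContDiff ℝ 2 q := h.contDiff.of_le (by norm_num)
  have hK2 : ContDiff ℝ 2 fun θ => q θ + Φ θ := hq2.add hΦ
  have splitd : ∀ {f : ℝ → E}, ContDiff ℝ 2 f → ContDiff ℝ 1 (deriv f) := fun hf => by
    rw [show (2 : WithTop ℕ∞) = 1 + 1 by norm_num, contDiff_succ_iff_deriv] at hf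
    exact hf.2.2
  have hqd : ∀ θ, HasDerivAt q (deriv q θ) θ := fun θ =>
    (hq2.differentiable (by norm_num) θ).hasDerivAt
  have hKd : ∀ θ, HasDerivAt (fun θ => q θ + Φ θ) (deriv q θ + deriv Φ θ) θ := fun θ =>
    (hqd θ).add (hΦ.differentiable (by norm_num) θ).hasDerivAt
  have hdK : deriv (fun θ => q θ + Φ θ) = fun θ => deriv q θ + deriv Φ θ :=
    funext fun θ => (hKd θ).deriv
  have hK1 : ContDiff ℝ 1 fun θ => deriv q θ + deriv Φ θ := (splitd hq2).add (splitd hΦ)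
  have hKdd : ∀ θ, HasDerivAt (fun θ => deriv q θ + deriv Φ θ)
      (deriv (deriv q) θ + deriv (deriv Φ) θ) θ := fun θ =>
    ((splitd hq2).differentiable (by norm_num) θ).hasDerivAt.add
      ((splitd hΦ).differentiable (by norm_num) θ).hasDerivAt
  have hhalf : ∀ θ, 1 / 2 ≤ ‖deriv q θ + deriv Φ θ‖ := fun θ => by
    have h1 := norm_sub_le_norm_add (deriv q θ) (deriv Φ θ)
    rw [h.unit] at h1
    linarith [(hΦb θ).2.1]
  have htwo : ∀ θ, ‖deriv q θ + deriv Φ θ‖ ≤ 2 := fun θ => by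
    have h1 := norm_add_le (deriv q θ) (deriv Φ θ)
    rw [h.unit] at h1
    linarith [(hΦb θ).2.1]
  have hmem : ∀ θ, q θ + Φ θ ∈ Metric.closedBall (0 : E) (D + 1) := fun θ => by
    rw [mem_closedBall_zero_iff]
    linarith [norm_add_le (q θ) (Φ θ), (hΦb θ).1, (hD θ).1]
  have hmem' : ∀ θ, q θ ∈ Metric.closedBall (0 : E) (D + 1) := fun θ => by
    rw [mem_closedBall_zero_iff]
    linarith [(hD θ).1]
  have hDA : ∀ θ, ‖fderiv ℝ A (q θ + Φ θ) - fderiv ℝ A (q θ)‖ ≤ M * ε := fun θ => by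
    refine ((hM _ (hmem θ)).2.2.2 _ (hmem' θ)).2.trans ?_
    rw [add_sub_cancel_left]
    gcongr
    exact (hΦb θ).1
  have hFK : ∀ θ, ‖-A (q θ + Φ θ) + δ • G (q θ + Φ θ)‖ ≤ M * (C + 1) * δ := fun θ => by
    have h1 := ((hM _ (hmem θ)).2.2.2 _ (hmem' θ)).1
    rw [h.zero, sub_zero, add_sub_cancel_left] at h1
    calc _ ≤ ‖-A (q θ + Φ θ)‖ + ‖δ • G (q θ + Φ θ)‖ := norm_add_le _ _
      _ ≤ M * ε + δ * M := by
        rw [norm_neg, norm_smul, Real.norm_of_nonneg hδ.le]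
        gcongr
        · exact h1.trans (by gcongr; exact (hΦb θ).1)
        · exact (hM _ (hmem θ)).2.1
      _ = M * (C + 1) * δ := by rw [hε]; ring
  have hDFK : ∀ θ, ‖fderiv ℝ (fun X => -A X + δ • G X) (q θ + Φ θ) (deriv q θ + deriv Φ θ)‖ ≤
      M * (3 * C + 2) * δ := fun θ => by
    have h1 : fderiv ℝ (fun X => -A X + δ • G X) (q θ + Φ θ) (deriv q θ + deriv Φ θ) =
        -(fderiv ℝ A (q θ + Φ θ) - fderiv ℝ A (q θ)) (deriv q θ + deriv Φ θ) -
          fderiv ℝ A (q θ) (deriv Φ θ) +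
          δ • fderiv ℝ G (q θ + Φ θ) (deriv q θ + deriv Φ θ) := by
      simp only [hDF, add_apply, neg_apply, sub_apply, smul_apply, map_add, h.tangent, smul_add]
      abel
    rw [h1]
    calc _ ≤ ‖(fderiv ℝ A (q θ + Φ θ) - fderiv ℝ A (q θ)) (deriv q θ + deriv Φ θ)‖ +
          ‖fderiv ℝ A (q θ) (deriv Φ θ)‖ +
          ‖δ • fderiv ℝ G (q θ + Φ θ) (deriv q θ + deriv Φ θ)‖ := by
          refine (norm_add_le _ _).trans ?_
          gcongr
          refine (norm_sub_le _ _).trans_eq ?_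
          rw [norm_neg]
      _ ≤ M * ε * 2 + M * ε + δ * (M * 2) := by
          rw [norm_smul, Real.norm_of_nonneg hδ.le]
          gcongr
          · exact ContinuousLinearMap.le_of_opNorm_le_of_le _ (hDA θ) (htwo θ)
          · exact ContinuousLinearMap.le_of_opNorm_le_of_le _ (hM _ (hmem' θ)).1 (hΦb θ).2.1
          · exact ContinuousLinearMap.le_of_opNorm_le_of_le _ (hM _ (hmem θ)).2.2.1 (htwo θ)
      _ = M * (3 * C + 2) * δ := by rw [hε]; ring
  have hne : ∀ θ, ‖deriv q θ + deriv Φ θ‖ ^ 2 ≠ 0 := fun θ => by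
    have := hhalf θ
    positivity
  have hs_eq : s = fun θ => ⟪-A (q θ + Φ θ) + δ • G (q θ + Φ θ), deriv q θ + deriv Φ θ⟫ /
      ‖deriv q θ + deriv Φ θ‖ ^ 2 := funext fun θ => by
    rw [hs, real_inner_smul_left, real_inner_self_eq_norm_sq, mul_div_cancel_right₀ _ (hne θ)]
  have hs1' : ContDiff ℝ 1 s := by
    rw [hs_eq]
    exact (((hF2.comp hK2).of_le (by norm_num)).inner ℝ hK1).div (hK1.norm_sq ℝ) hne
  have hs_le : ∀ θ, |s θ| ≤ 2 * (M * (C + 1) * δ) := fun θ => by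
    have h1 := hFK θ
    rw [hs, norm_smul, Real.norm_eq_abs] at h1
    nlinarith [hhalf θ, abs_nonneg (s θ)]
  refine ⟨hF2.of_le (by norm_num), hK2, hs1', h.L_pos, fun θ => by
    simp only [h.periodic θ, hΦper θ], fun θ₁ θ₂ => ?_, ?_, ?_, ?_, fun θ => ?_, fun θ v hv => ?_⟩
  · exact injective_mod_period_of_close h.L_pos h.periodic hc
      (hΦ.differentiable (by norm_num)) hΦper (fun θ => (hΦb θ).2.1) (by linarith) θ₁ θ₂
  · rwa [hdK]
  · rwa [hdK]
  · rwa [hdK]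
  · have h1 := ((hF2.differentiable (by norm_num)) (q θ + Φ θ)).hasFDerivAt.comp_hasDerivAt θ
      (hKd θ)
    have h2 := (hs1'.differentiable (by norm_num) θ).hasDerivAt.smul (hKdd θ)
    have h3 := h1.unique (h2.congr_of_eventuallyEq (Eventually.of_forall hs))
    have h4 : ‖deriv s θ • (deriv q θ + deriv Φ θ)‖ ≤
        M * (3 * C + 2) * δ + 2 * (M * (C + 1) * δ) * (D + 1) := by
      rw [← sub_eq_iff_eq_add'.2 h3]
      refine (norm_sub_le _ _).trans ?_
      gcongr
      · exact hDFK θ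
      · rw [norm_smul, Real.norm_eq_abs]
        gcongr
        · exact hs_le θ
        · linarith [norm_add_le (deriv (deriv q) θ) (deriv (deriv Φ) θ), (hD θ).2.1, (hΦb θ).2.2]
    rw [norm_smul, Real.norm_eq_abs] at h4
    nlinarith [hhalf θ, abs_nonneg (deriv s θ)]
  · rw [(hKd θ).deriv, inner_add_right] at hv
    have h1 : ⟪v, deriv q θ⟫ ^ 2 ≤ ε * ‖v‖ ^ 2 := by
      have h2 : |⟪v, deriv q θ⟫| ≤ ‖v‖ * ε := by
        rw [eq_neg_of_add_eq_zero_left hv, abs_neg]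
        exact (abs_real_inner_le_norm _ _).trans (by gcongr; exact (hΦb θ).2.1)
      calc ⟪v, deriv q θ⟫ ^ 2 = |⟪v, deriv q θ⟫| ^ 2 := (sq_abs _).symm
        _ ≤ (‖v‖ * ε) ^ 2 := by gcongr
        _ = ε * (ε * ‖v‖ ^ 2) := by ring
        _ ≤ 1 * (ε * ‖v‖ ^ 2) := by gcongr; linarith
        _ = _ := one_mul _
    have quad : ∀ {T : E →L[ℝ] E} {B : ℝ}, ‖T‖ ≤ B → |⟪T v, v⟫| ≤ B * ‖v‖ ^ 2 := fun {T B} hT =>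
      calc |⟪T v, v⟫| ≤ ‖T v‖ * ‖v‖ := abs_real_inner_le_norm _ _
        _ ≤ (B * ‖v‖) * ‖v‖ := by gcongr; exact T.le_of_opNorm_le hT v
        _ = B * ‖v‖ ^ 2 := by ring
    have h2 := h.coercive' θ v
    have h3 := neg_le_of_abs_le (quad (hDA θ))
    have h4 := le_of_abs_le (quad (hM _ (hmem θ)).2.2.1)
    have h5 : ⟪fderiv ℝ (fun X => -A X + δ • G X) (q θ + Φ θ) v, v⟫ =
        -⟪fderiv ℝ A (q θ) v, v⟫ - ⟪(fderiv ℝ A (q θ + Φ θ) - fderiv ℝ A (q θ)) v, v⟫ +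
          δ * ⟪fderiv ℝ G (q θ + Φ θ) v, v⟫ := by
      simp only [hDF, add_apply, neg_apply, sub_apply, smul_apply, inner_add_left,
        inner_neg_left, inner_sub_left, real_inner_smul_left]
      ring
    rw [h5]
    have h6 := mul_le_mul_of_nonneg_left h4 hδ.le
    have h7 := mul_le_mul_of_nonneg_left h1 hlam.le
    have h8 := mul_le_mul_of_nonneg_right hs4 (sq_nonneg ‖v‖)
    have h9 : δ * (lam * C + M * C + M) * ‖v‖ ^ 2 =
        lam * (ε * ‖v‖ ^ 2) + M * ε * ‖v‖ ^ 2 + δ * (M * ‖v‖ ^ 2) := by rw [hε]; ring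
    linarith

end EquilibriumCurve

/-- A curve of nondegenerate critical points of `V` is a curve of equilibria of its gradient. -/
theorem equilibriumCurve_gradient [CompleteSpace E] {V : E → ℝ} {q : ℝ → E} {L lam : ℝ}
    (hV : ContDiff ℝ 4 V) (hL : 0 < L) (hq : ContDiff ℝ 3 q) (hqper : Function.Periodic q L)
    (hqunit : ∀ θ, ‖deriv q θ‖ = 1)
    (hgrad : ∀ θ, gradient V (q θ) = 0)
    (hHtan : ∀ θ, fderiv ℝ (gradient V) (q θ) (deriv q θ) = 0) (hlam : 0 < lam)
    (hspec : ∀ θ w, ⟪w, deriv q θ⟫ = 0 →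
      lam * ‖w‖ ^ 2 ≤ ⟪fderiv ℝ (gradient V) (q θ) w, w⟫) :
    EquilibriumCurve (gradient V) q L lam := by
  have hV3 : ContDiff ℝ 3 (fderiv ℝ V) := hV.fderiv_right (by norm_num)
  have hD : ∀ X u v, ⟪fderiv ℝ (gradient V) X u, v⟫ = fderiv ℝ (fderiv ℝ V) X u v := fun X u v => by
    have h1 : HasFDerivAt (gradient V)
        ((InnerProductSpace.toDual ℝ E).symm.toContinuousLinearEquiv.toContinuousLinearMap.comp
          (fderiv ℝ (fderiv ℝ V) X)) X :=
      ((InnerProductSpace.toDual ℝ E).symm.toContinuousLinearEquiv.hasFDerivAt).comp X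
        (hV3.differentiable (by norm_num) X).hasFDerivAt
    rw [h1.fderiv]
    exact InnerProductSpace.toDual_symm_apply
  refine ⟨(InnerProductSpace.toDual ℝ E).symm.contDiff.comp hV3, hq, hL, hlam, hqper, hqunit,
    hgrad, hHtan, fun θ v => ?_, fun θ w hw => hspec θ w hw⟩
  have hsymm : IsSymmSndFDerivAt ℝ V (q θ) :=
    hV.contDiffAt.isSymmSndFDerivAt (by simp; norm_num)
  rw [hD, hsymm.eq, ← hD, hHtan, inner_zero_left]

end InvariantCurve

/-- Theorem 2.4 (Fenichel persistence): for small `δ` the curve `M` persists as a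
`C²` graph `M^δ = {q θ + φ_δ θ}`, invariant for the perturbed flow, which is a stable
normally hyperbolic manifold (generalized Lyapunov-type numbers `ν̄ < 1`, `σ̄ < 1`). -/
theorem persistence_normally_hyperbolic {n : ℕ}
    (V : EuclideanSpace ℝ (Fin n) → ℝ) (G : EuclideanSpace ℝ (Fin n) → EuclideanSpace ℝ (Fin n))
    (q : ℝ → EuclideanSpace ℝ (Fin n)) (L lam : ℝ)
    (hV : ContDiff ℝ 4 V) (hG : ContDiff ℝ 2 G)
    (hL : 0 < L) (hq : ContDiff ℝ 3 q) (hqper : Function.Periodic q L)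
    (hqunit : ∀ θ, ‖deriv q θ‖ = 1)
    (hqinj : ∀ θ₁ θ₂ : ℝ, q θ₁ = q θ₂ → ∃ k : ℤ, θ₂ - θ₁ = k * L)
    (hgrad : ∀ θ, gradient V (q θ) = 0) (hV0 : ∀ θ, V (q θ) = 0)
    (hHtan : ∀ θ, hessLM V (q θ) (deriv q θ) = 0)
    (hlam : 0 < lam)
    (hspec : ∀ θ : ℝ, ∀ w : EuclideanSpace ℝ (Fin n), ⟪w, deriv q θ⟫ = 0 →
      lam * ‖w‖ ^ 2 ≤ ⟪hessLM V (q θ) w, w⟫)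
    :
    ∃ δ₀ > (0:ℝ), ∃ C > (0:ℝ), ∀ δ : ℝ, 0 < δ → δ ≤ δ₀ →
      ∃ Φδ : ℝ → EuclideanSpace ℝ (Fin n),
        ContDiff ℝ 2 Φδ ∧ Function.Periodic Φδ L ∧
        (∀ θ, ⟪Φδ θ, deriv q θ⟫ = 0) ∧
        (∀ θ, ‖Φδ θ‖ ≤ C * δ ∧ ‖deriv Φδ θ‖ ≤ C * δ ∧ ‖deriv (deriv Φδ) θ‖ ≤ C * δ) ∧
        flowInvariant V G δ (Set.range fun θ => q θ + Φδ θ) ∧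
        ∃ (flow : EuclideanSpace ℝ (Fin n) → ℝ → EuclideanSpace ℝ (Fin n))
          (Φlin : EuclideanSpace ℝ (Fin n) → ℝ → (EuclideanSpace ℝ (Fin n) →L[ℝ] EuclideanSpace ℝ (Fin n))),
          (∀ θ₀ : ℝ, flow (q θ₀ + Φδ θ₀) 0 = q θ₀ + Φδ θ₀ ∧
            (∀ t, HasDerivAt (flow (q θ₀ + Φδ θ₀))
              (-(gradient V (flow (q θ₀ + Φδ θ₀) t)) + δ • G (flow (q θ₀ + Φδ θ₀) t)) t) ∧
            Φlin (q θ₀ + Φδ θ₀) 0 = ContinuousLinearMap.id ℝ (EuclideanSpace ℝ (Fin n)) ∧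
            (∀ u : EuclideanSpace ℝ (Fin n), ∀ t : ℝ, HasDerivAt (fun s => Φlin (q θ₀ + Φδ θ₀) s u)
              (fderiv ℝ (fun X => -(gradient V X) + δ • G X) (flow (q θ₀ + Φδ θ₀) t)
                (Φlin (q θ₀ + Φδ θ₀) t u)) t)) ∧
          (∃ a : ℝ, 0 < a ∧ a < 1 ∧
            ∀ θ₀ : ℝ, ∀ Θ : ℝ → ℝ, Θ 0 = θ₀ →
              (∀ t, flow (q θ₀ + Φδ θ₀) t = q (Θ t) + Φδ (Θ t)) →
              ∀ w : EuclideanSpace ℝ (Fin n), ⟪w, deriv q θ₀ + deriv Φδ θ₀⟫ = 0 →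
                Tendsto (fun t : ℝ =>
                  (‖w‖ / ‖projNor (deriv q (Θ t) + deriv Φδ (Θ t))
                    (Φlin (q θ₀ + Φδ θ₀) t w)‖) / a ^ (-t)) atBot (nhds 0)) ∧
          (∃ b : ℝ, 0 < b ∧ b < 1 ∧
            ∀ θ₀ : ℝ, ∀ Θ : ℝ → ℝ, Θ 0 = θ₀ →
              (∀ t, flow (q θ₀ + Φδ θ₀) t = q (Θ t) + Φδ (Θ t)) →
              ∀ w v : EuclideanSpace ℝ (Fin n), ⟪w, deriv q θ₀ + deriv Φδ θ₀⟫ = 0 → v ≠ 0 →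
                (∃ c : ℝ, v = c • (deriv q θ₀ + deriv Φδ θ₀)) →
                Tendsto (fun t : ℝ =>
                  (‖w‖ ^ b / ‖v‖) /
                    (‖projNor (deriv q (Θ t) + deriv Φδ (Θ t))
                        (Φlin (q θ₀ + Φδ θ₀) t w)‖ ^ b /
                      ‖projTan (deriv q (Θ t) + deriv Φδ (Θ t))
                        (Φlin (q θ₀ + Φδ θ₀) t v)‖)) atBot (nhds 0)) := by
  have hVd : Differentiable ℝ V := hV.differentiable (by norm_num)
  obtain ⟨δ₁, hδ₁, C, hC, H₁⟩ :=
    (equilibriumCurve_gradient hV hL hq hqper hqunit hgrad hHtan hlam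
      hspec).exists_normal_invariant_curve hG
  obtain ⟨δ₂, hδ₂, H₂⟩ :=
    (equilibriumCurve_gradient hV hL hq hqper hqunit hgrad hHtan hlam
      hspec).exists_attractingCurve hqinj hG hC.le
  refine ⟨min δ₁ δ₂, lt_min hδ₁ hδ₂, C, hC, fun δ hδ hδle => ?_⟩
  obtain ⟨Φ, hΦ, hΦper, hΦorth, hΦb, s, hs⟩ := H₁ δ hδ (hδle.trans (min_le_left _ _))
  have h := H₂ δ hδ (hδle.trans (min_le_right _ _)) Φ s hΦ hΦper hΦb hs
  obtain ⟨flow, U, hU⟩ := h.exists_flow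
  have hdK : ∀ θ, deriv (fun θ => q θ + Φ θ) θ = deriv q θ + deriv Φ θ := fun θ =>
    deriv_fun_add (hq.differentiable (by norm_num) θ) (hΦ.differentiable (by norm_num) θ)
  refine ⟨Φ, hΦ, hΦper, hΦorth, hΦb, fun Y hY h0 => h.mem_range_of_hasDerivAt hY h0, flow, U,
    fun θ₀ => ?_, ⟨Real.exp (-(lam / 2 / 2)), Real.exp_pos _, by rw [Real.exp_lt_one_iff]; linarith,
      fun θ₀ Θ hΘ0 hΘ w hw => ?_⟩, ⟨1 / 2, by norm_num, by norm_num,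
      fun θ₀ Θ hΘ0 hΘ w v hw hv hvc => ?_⟩⟩ <;>
    obtain ⟨Ψ, hΨ, hΨ0, hflow, hU0, hUd⟩ := hU θ₀
  · have hfun : flow (q θ₀ + Φ θ₀) = fun t => q (Ψ t) + Φ (Ψ t) := funext hflow
    refine ⟨(hflow 0).trans hΨ0, fun t => ?_, hU0, fun u t => ?_⟩
    · rw [hfun]
      exact h.hasDerivAt_comp hΨ t
    · rw [hfun]
      exact hUd u t
  all_goals
    have hτ : ∀ t, deriv q (Θ t) + deriv Φ (Θ t) = deriv (fun θ => q θ + Φ θ) (Ψ t) := fun t => by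
      rw [← hdK]
      exact h.deriv_eq_of_eq ((hΘ t).symm.trans (hflow t))
    have hτ0 := hτ 0
    rw [hΘ0] at hτ0
    have hU0' : ∀ u, U (q θ₀ + Φ θ₀) 0 u = u := fun u => by rw [hU0]; rfl
    rw [hτ0] at hw
    simp only [projNor, projTan, hτ]
  · simpa only [hU0'] using h.tendsto_normal (by linarith) hΨ (hUd w)
      (by simpa only [hU0'] using hw)
  · obtain ⟨c, hc⟩ := hvc
    rw [hτ0] at hc
    simpa only [hU0'] using h.tendsto_tangent_div_normal (by linarith) hΨ (hUd w)
      (by simpa only [hU0'] using hw) (hUd v) (by simpa only [hU0'] using hv)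
      (by simpa only [hU0'] using hc)

end
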